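/- arXiv:math/0206251 — 2 statements merged into one kernel-verified Lean document; each statement's English description precedes it below -/
import Mathlib

section
/- Let X be a separable Banach space, let 0 < T ≤ ∞, and let F : [0,T) × X → P(X) be a set-valued map with nonempty closed values satisfying: (H1') F is L[0,T) ⊗ B(X) measurable; (H2') for each R > 0 there exists a locally integrable function k_R : [0,T) → ℝ such that d_H(F(t,ξ), F(t,η)) ≤ k_R(t)|ξ − η| for all ξ, η in the closed ball B(0,R) and almost every t ∈ [0,T); (H3') for each R > 0 there exists a locally integrable function α_R : [0,T) → ℝ such that sup{|ζ| : ζ ∈ F(t,ξ)} ≤ α_R(t) for each ξ ∈ B(0,R) and almost every t ∈ [0,T). Fix ξ ∈ X and let z : [0,T) → X be a solution of the relaxed differential inclusion ẋ(t) ∈ clco F(t, x(t)) with z(0) = ξ, where clco denotes closed convex hull. Let r : [0,T) → ℝ_{>0} be a continuous strictly positive function. Then there exists η⁰ ∈ X with |η⁰ − ξ| ≤ r(0) and a solution γ : [0,T) → X of the differential inclusion ẋ(t) ∈ F(t, x(t)) with γ(0) = η⁰ such that |z(t) − γ(t)| ≤ r(t) for all t ∈ [0,T). -/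
open MeasureTheory Set
open scoped ENNReal

section Relaxation

open Filter Topology

/-- The Lebesgue measure of the part of `A` to the left of `t`. -/
noncomputable def cumVol (A : Set ℝ) (t : ℝ) : ℝ := volume.real (A ∩ Iio t)

theorem cumVol_mono {A : Set ℝ} (hA : volume A ≠ ∞) : Monotone (cumVol A) := fun _ _ hst =>
  measureReal_mono (inter_subset_inter_right _ (Iio_subset_Iio hst))
    (measure_ne_top_of_subset inter_subset_left hA)

theorem continuous_cumVol {A : Set ℝ} (hA : volume A ≠ ∞) : Continuous (cumVol A) := by
  refine LipschitzWith.continuous (K := 1) (LipschitzWith.of_le_add fun s t => ?_)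
  have hsub : A ∩ Iio s ⊆ (A ∩ Iio t) ∪ Ico t s := by
    rintro x ⟨hx, hxs⟩
    rcases lt_or_ge x t with h | h
    · exact Or.inl ⟨hx, h⟩
    · exact Or.inr ⟨h, hxs⟩
  have h1 : volume (A ∩ Iio t) ≠ ∞ := measure_ne_top_of_subset inter_subset_left hA
  calc cumVol A s ≤ volume.real ((A ∩ Iio t) ∪ Ico t s) :=
        measureReal_mono hsub (measure_union_ne_top h1 (by simp))
    _ ≤ cumVol A t + volume.real (Ico t s) := measureReal_union_le _ _
    _ ≤ cumVol A t + dist s t := by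
        gcongr
        rw [Real.volume_real_Ico, Real.dist_eq]
        exact max_le (le_abs_self _) (abs_nonneg _)

theorem cumVol_nonneg (A : Set ℝ) (t : ℝ) : 0 ≤ cumVol A t := measureReal_nonneg

theorem cumVol_le {A : Set ℝ} (hA : volume A ≠ ∞) (t : ℝ) : cumVol A t ≤ volume.real A :=
  measureReal_mono inter_subset_left hA

/-- The cumulative volume of a bounded set pushes Lebesgue measure on the set forward to Lebesgue
measure on an interval. -/
theorem map_cumVol {A : Set ℝ} {a b : ℝ} (hAab : A ⊆ Ico a b) :
    (volume.restrict A).map (cumVol A) = volume.restrict (Ioc 0 (volume.real A)) := by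
  have hA : volume A ≠ ∞ := measure_ne_top_of_subset hAab (by simp)
  have : IsFiniteMeasure (volume.restrict A) := ⟨by simpa using hA.lt_top⟩
  have hcont := continuous_cumVol hA
  have hmono := cumVol_mono hA
  refine Measure.ext_of_Iic _ _ fun y => ?_
  rw [Measure.map_apply hcont.measurable measurableSet_Iic,
    Measure.restrict_apply (hcont.measurable measurableSet_Iic),
    Measure.restrict_apply measurableSet_Iic]
  rcases lt_or_ge y 0 with hy | hy
  · have h1 : cumVol A ⁻¹' Iic y ∩ A = ∅ := by
      ext x
      simp only [mem_inter_iff, mem_preimage, mem_Iic, mem_empty_iff_false, iff_false, not_and]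
      intro h
      exact absurd (cumVol_nonneg A x) (by linarith)
    have h2 : Iic y ∩ Ioc 0 (volume.real A) = ∅ := by
      ext x
      simp only [mem_inter_iff, mem_Iic, mem_Ioc, mem_empty_iff_false, iff_false]
      intro h
      linarith [h.1, h.2.1]
    rw [h1, h2, measure_empty]
  rcases le_or_gt (volume.real A) y with hyM | hyM
  · have h1 : cumVol A ⁻¹' Iic y ∩ A = A :=
      inter_eq_right.2 fun x _ => (cumVol_le hA x).trans hyM
    have h2 : Iic y ∩ Ioc 0 (volume.real A) = Ioc 0 (volume.real A) :=
      inter_eq_right.2 fun x hx => hx.2.trans hyM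
    rw [h1, h2, Real.volume_Ioc, sub_zero, ofReal_measureReal hA]
  have hab : a ≤ b := by
    by_contra! h
    have : A = ∅ := subset_empty_iff.1 (by simpa [Ico_eq_empty_of_le h.le] using hAab)
    simp [this] at hyM
    linarith
  have ha : cumVol A a = 0 := by
    have : A ∩ Iio a = ∅ := by
      ext x
      simp only [mem_inter_iff, mem_Iio, mem_empty_iff_false, iff_false, not_and, not_lt]
      exact fun hx => (hAab hx).1
    simp [cumVol, this]
  have hb : cumVol A b = volume.real A := by
    rw [cumVol, inter_eq_left.2 (show A ⊆ Iio b from fun x hx => (hAab hx).2)]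
  obtain ⟨s, ⟨hsab, hsy⟩, hmax⟩ : ∃ s, IsGreatest (Icc a b ∩ cumVol A ⁻¹' Iic y) s :=
    (isCompact_Icc.inter_right (isClosed_Iic.preimage hcont)).exists_isGreatest
      ⟨a, left_mem_Icc.2 hab, by simpa [ha] using hy⟩
  obtain ⟨s', hs', hs'y⟩ : y ∈ cumVol A '' Icc a b :=
    intermediate_value_Icc hab hcont.continuousOn ⟨by rwa [ha], by rw [hb]; exact hyM.le⟩
  have hys : cumVol A s = y :=
    le_antisymm hsy (hs'y ▸ hmono (hmax ⟨hs', hs'y.le⟩))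
  have h1 : cumVol A ⁻¹' Iic y ∩ A = A ∩ Iic s := by
    ext x
    simp only [mem_inter_iff, mem_preimage, mem_Iic]
    refine ⟨fun h => ⟨h.2, hmax ⟨Ico_subset_Icc_self (hAab h.2), h.1⟩⟩, fun h => ⟨?_, h.1⟩⟩
    exact (hmono h.2).trans hsy
  have h2 : Iic y ∩ Ioc 0 (volume.real A) = Ioc 0 y := by
    ext x
    simp only [mem_inter_iff, mem_Iic, mem_Ioc]
    constructor
    · exact fun h => ⟨h.2.1, h.1⟩
    · exact fun h => ⟨h.2, h.1, h.2.trans hyM.le⟩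
  have h3 : volume (A ∩ Iic s) = volume (A ∩ Iio s) :=
    measure_congr ((ae_eq_refl _).inter Iio_ae_eq_Iic.symm)
  rw [h1, h2, h3, Real.volume_Ioc, sub_zero, ← hys, cumVol,
    ofReal_measureReal (measure_ne_top_of_subset inter_subset_left hA)]

theorem setIntegral_comp_cumVol {E : Type*} [NormedAddCommGroup E] [NormedSpace ℝ E]
    {A : Set ℝ} {a b : ℝ} (hAm : MeasurableSet A) (hAab : A ⊆ Ico a b) {f : ℝ → E}
    (hf : StronglyMeasurable f) (t : ℝ) :
    ∫ s in A ∩ Iio t, f (cumVol A s) = ∫ x in (0 : ℝ)..cumVol A t, f x := by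
  have hA : volume A ≠ ∞ := measure_ne_top_of_subset hAab (by simp)
  have hBm : MeasurableSet (A ∩ Iio t) := hAm.inter measurableSet_Iio
  have hB : volume (A ∩ Iio t) ≠ ∞ := measure_ne_top_of_subset inter_subset_left hA
  have h1 : ∫ s in A ∩ Iio t, f (cumVol A s) = ∫ s in A ∩ Iio t, f (cumVol (A ∩ Iio t) s) := by
    refine setIntegral_congr_fun hBm fun s hs => ?_
    have : A ∩ Iio t ∩ Iio s = A ∩ Iio s := by
      rw [inter_assoc, inter_eq_right.2 (Iio_subset_Iio (le_of_lt hs.2))]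
    simp only [cumVol, this]
  rw [h1, intervalIntegral.integral_of_le (cumVol_nonneg A t)]
  rw [show cumVol A t = volume.real (A ∩ Iio t) from rfl,
    ← map_cumVol (inter_subset_left.trans hAab),
    integral_map (continuous_cumVol hB).aemeasurable hf.aestronglyMeasurable]

/-- On a bounded set one can switch so fast between `m` given vectors that the integral stays
close to the integral of their average. -/
theorem exists_oscillation {E : Type*} [NormedAddCommGroup E] [NormedSpace ℝ E] [CompleteSpace E]
    [MeasurableSpace E] [BorelSpace E]
    {A : Set ℝ} {a b : ℝ} (hAm : MeasurableSet A) (hAab : A ⊆ Ico a b) {m : ℕ} (hm : 0 < m)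
    (p : ℕ → E) {β : ℝ} (hβ : 0 < β) :
    ∃ j : ℝ → ℕ, Measurable j ∧ (∀ s, j s < m) ∧
      (∀ t, ‖∫ s in A ∩ Iio t, (p (j s) - (m : ℝ)⁻¹ • ∑ i ∈ Finset.range m, p i)‖ ≤ β) ∧
      ∫ s in A, (p (j s) - (m : ℝ)⁻¹ • ∑ i ∈ Finset.range m, p i) = 0 := by
  have hA : volume A ≠ ∞ := measure_ne_top_of_subset hAab (by simp)
  set q := (m : ℝ)⁻¹ • ∑ i ∈ Finset.range m, p i with hq
  rcases (measureReal_nonneg (μ := volume) (s := A)).eq_or_lt with hM | hM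
  · have h0 : volume A = 0 := by
      rcases (measureReal_eq_zero_iff hA).1 hM.symm with h
      exact h
    refine ⟨fun _ => 0, measurable_const, fun _ => hm, fun t => ?_, ?_⟩
    · rw [setIntegral_measure_zero _ (measure_mono_null inter_subset_left h0), norm_zero]
      exact hβ.le
    · rw [setIntegral_measure_zero _ h0]
  set M := volume.real A with hMdef
  set C := ∑ i ∈ Finset.range m, ‖p i - q‖ with hC
  have hC0 : 0 ≤ C := Finset.sum_nonneg fun _ _ => norm_nonneg _
  obtain ⟨N, hN⟩ := exists_nat_gt (C * M / β)
  have hN0 : (0 : ℝ) < N := lt_of_le_of_lt (by positivity) hN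
  have hm' : (0 : ℝ) < m := by exact_mod_cast hm
  set h := M / (N * m) with hh
  have hh0 : 0 < h := by positivity
  let idx : ℝ → ℕ := fun x => (⌊x / h⌋ % (m : ℤ)).toNat
  have hidx : ∀ x, idx x < m := fun x => by
    have h1 := Int.emod_nonneg ⌊x / h⌋ (b := (m : ℤ)) (by omega)
    have h2 := Int.emod_lt_of_pos ⌊x / h⌋ (b := (m : ℤ)) (by omega)
    simp only [idx]
    omega
  have hidxm : Measurable idx :=
    (measurable_of_countable (fun n : ℤ => (n % (m : ℤ)).toNat)).comp
      (Int.measurable_floor.comp (measurable_id.div_const h))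
  let f : ℝ → E := fun x => p (idx x) - q
  have hfm : StronglyMeasurable f :=
    ((StronglyMeasurable.of_discrete (f := p)).comp_measurable hidxm).sub
      stronglyMeasurable_const
  have hfb : ∀ x, ‖f x‖ ≤ C := fun x =>
    Finset.single_le_sum (f := fun i => ‖p i - q‖) (fun _ _ => norm_nonneg _)
      (Finset.mem_range.2 (hidx x))
  have hInt : ∀ x y, IntervalIntegrable f volume x y := fun x y =>
    (intervalIntegrable_const (c := C)).mono_fun hfm.aestronglyMeasurable
      (ae_of_all _ fun x => (hfb x).trans (le_abs_self C))
  have hper : Function.Periodic f (m * h) := fun x => by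
    have : (x + m * h) / h = x / h + (m : ℤ) := by
      push_cast
      field_simp
    simp only [f, idx, this, Int.floor_add_intCast, Int.add_emod_right]
  have hpiece : ∀ i < m, ∫ x in ((i : ℕ) : ℝ) * h..((i + 1 : ℕ) : ℝ) * h, f x
      = h • (p i - q) := fun i hi => by
    have hle : (i : ℝ) * h ≤ ((i + 1 : ℕ) : ℝ) * h := by push_cast; nlinarith
    have : ∫ x in ((i : ℕ) : ℝ) * h..((i + 1 : ℕ) : ℝ) * h, f x =
        ∫ x in ((i : ℕ) : ℝ) * h..((i + 1 : ℕ) : ℝ) * h, (p i - q) := by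
      rw [intervalIntegral.integral_of_le hle, intervalIntegral.integral_of_le hle,
        ← integral_Ico_eq_integral_Ioc, ← integral_Ico_eq_integral_Ioc]
      refine setIntegral_congr_fun measurableSet_Ico fun x hx => ?_
      have : ⌊x / h⌋ = (i : ℤ) := by
        rw [Int.floor_eq_iff]
        refine ⟨?_, ?_⟩
        · rw [le_div_iff₀ hh0]; exact_mod_cast hx.1
        · rw [div_lt_iff₀ hh0]; exact_mod_cast hx.2
      have h3 : (i : ℤ) % (m : ℤ) = i := Int.emod_eq_of_lt (by omega) (by omega)
      simp only [f, idx, this, h3, Int.toNat_natCast]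
    rw [this, intervalIntegral.integral_const]
    congr 1
    push_cast
    ring
  have hzero : ∫ x in (0 : ℝ)..m * h, f x = 0 := by
    have hs := intervalIntegral.sum_integral_adjacent_intervals
      (a := fun i : ℕ => (i : ℝ) * h) (f := f) (μ := volume) (n := m) fun i _ => hInt _ _
    simp only [Nat.cast_zero, zero_mul] at hs
    rw [← hs, Finset.sum_congr rfl fun i hi => hpiece i (Finset.mem_range.1 hi),
      ← Finset.smul_sum, Finset.sum_sub_distrib, Finset.sum_const, Finset.card_range, hq,
      ← Nat.cast_smul_eq_nsmul ℝ, smul_smul, mul_inv_cancel₀ hm'.ne', one_smul, sub_self,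
      smul_zero]
  have hmult : ∀ n : ℤ, ∫ x in (0 : ℝ)..n • (m * h), f x = 0 := fun n => by
    have := hper.intervalIntegral_add_zsmul_eq n 0 hInt
    simpa [hzero] using this
  refine ⟨fun s => idx (cumVol A s), hidxm.comp (continuous_cumVol hA).measurable,
    fun s => hidx _, fun t => ?_, ?_⟩
  · have := setIntegral_comp_cumVol hAm hAab hfm t
    simp only [f] at this
    rw [this]
    change ‖∫ x in (0 : ℝ)..cumVol A t, f x‖ ≤ β
    set y := cumVol A t
    have hP : 0 < m * h := by positivity
    have hsplit := intervalIntegral.integral_add_adjacent_intervals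
      (hInt 0 (⌊y / (m * h)⌋ • (m * h))) (hInt (⌊y / (m * h)⌋ • (m * h)) y)
    rw [← hsplit, hmult, zero_add]
    have hy1 : ⌊y / (m * h)⌋ * (m * h) ≤ y := by
      rw [← le_div_iff₀ hP]; exact Int.floor_le _
    have hy2 : y ≤ ⌊y / (m * h)⌋ * (m * h) + m * h := by
      have := (Int.lt_floor_add_one (y / (m * h))).le
      rw [div_le_iff₀ hP] at this
      linarith
    calc ‖∫ x in (⌊y / (m * h)⌋ • (m * h))..y, f x‖
        ≤ C * |y - ⌊y / (m * h)⌋ • (m * h)| :=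
          intervalIntegral.norm_integral_le_of_norm_le_const fun x _ => hfb x
      _ ≤ C * (m * h) := by
          gcongr
          rw [zsmul_eq_mul, abs_of_nonneg (by linarith)]
          linarith
      _ ≤ β := by
          have : m * h = M / N := by rw [hh]; field_simp
          rw [this, mul_div_assoc', div_le_iff₀ hN0]
          rw [div_lt_iff₀ hβ] at hN
          linarith
  · have hAb : A ∩ Iio b = A := inter_eq_left.2 fun x hx => (hAab hx).2
    have := setIntegral_comp_cumVol hAm hAab hfm b
    have hb : cumVol A b = (N : ℤ) • (m * h) := by
      rw [cumVol, hAb, ← hMdef, hh]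
      simp only [zsmul_eq_mul, Int.cast_natCast]
      field_simp
    rw [hAb, hb, hmult] at this
    exact this
/-- The averages of finite nonempty lists of elements of `G`. -/
def averages {E : Type*} [AddCommGroup E] [Module ℝ E] (G : Set E) : Set E :=
  {x | ∃ l : List E, l ≠ [] ∧ (∀ g ∈ l, g ∈ G) ∧ x = (l.length : ℝ)⁻¹ • l.sum}

theorem segment_subset_closure_averages {E : Type*} [NormedAddCommGroup E] [NormedSpace ℝ E]
    {G : Set E} {x y : E} (hx : x ∈ averages G) (hy : y ∈ averages G) :
    segment ℝ x y ⊆ closure (averages G) := by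
  obtain ⟨l, hl, hlG, rfl⟩ := hx
  obtain ⟨l', hl', hlG', rfl⟩ := hy
  have hn : (0 : ℝ) < l.length := by exact_mod_cast List.length_pos_iff.2 hl
  have hn' : (0 : ℝ) < l'.length := by exact_mod_cast List.length_pos_iff.2 hl'
  set u := (l.length : ℝ)⁻¹ • l.sum with hu
  set w := (l'.length : ℝ)⁻¹ • l'.sum with hw
  have hrat : ∀ c d : ℕ, 0 < d → c ≤ d → AffineMap.lineMap u w ((c : ℝ) / d) ∈ averages G := by
    intro c d hd hcd
    obtain ⟨e, rfl⟩ := Nat.exists_eq_add_of_le hcd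
    refine ⟨(List.replicate (e * l'.length) l).flatten ++
      (List.replicate (c * l.length) l').flatten, ?_, ?_, ?_⟩
    · have h1 : 0 < l.length := List.length_pos_iff.2 hl
      have h2 : 0 < l'.length := List.length_pos_iff.2 hl'
      rw [← List.length_pos_iff]
      simp only [List.length_append, List.length_flatten, List.map_replicate,
        List.sum_replicate, smul_eq_mul]
      rcases Nat.eq_zero_or_pos e with rfl | he
      · have : 0 < c := by omega
        positivity
      · positivity
    · intro g hg
      simp only [List.mem_append, List.mem_flatten, List.mem_replicate] at hg
      rcases hg with ⟨_, ⟨_, rfl⟩, h⟩ | ⟨_, ⟨_, rfl⟩, h⟩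
      · exact hlG g h
      · exact hlG' g h
    · have hd' : (0 : ℝ) < c + e := by exact_mod_cast hd
      simp only [List.length_append, List.length_flatten, List.map_replicate,
        List.sum_replicate, smul_eq_mul, List.sum_append, List.sum_flatten]
      have h1 : l.sum = (l.length : ℝ) • u := by rw [hu, smul_smul, mul_inv_cancel₀ hn.ne', one_smul]
      have h2 : l'.sum = (l'.length : ℝ) • w := by
        rw [hw, smul_smul, mul_inv_cancel₀ hn'.ne', one_smul]
      rw [h1, h2, AffineMap.lineMap_apply_module]
      clear_value u w
      simp only [← Nat.cast_smul_eq_nsmul ℝ, smul_add, smul_smul]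
      have hden : (e * l'.length * l.length + c * l.length * l'.length : ℝ) =
          (c + e) * (l.length * l'.length) := by ring
      congr 2 <;> push_cast <;> rw [hden] <;> field_simp
      ring
  rw [segment_eq_image_lineMap]
  rintro _ ⟨θ, hθ, rfl⟩
  have hlim : Tendsto (fun n : ℕ => (⌊θ * n⌋₊ : ℝ) / n) atTop (𝓝 θ) :=
    (tendsto_nat_floor_mul_div_atTop hθ.1).comp tendsto_natCast_atTop_atTop
  have hlim2 : Tendsto (fun n : ℕ => AffineMap.lineMap u w ((⌊θ * n⌋₊ : ℝ) / n)) atTop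
      (𝓝 (AffineMap.lineMap u w θ)) :=
    (AffineMap.lineMap_continuous.tendsto θ).comp hlim
  refine mem_closure_of_tendsto hlim2 ?_
  filter_upwards [eventually_gt_atTop 0] with n hn0
  refine hrat _ _ hn0 ?_
  refine Nat.floor_le_of_le ?_
  exact mul_le_of_le_one_left (by positivity) hθ.2

theorem closure_convexHull_subset_closure_averages {E : Type*} [NormedAddCommGroup E]
    [NormedSpace ℝ E] (G : Set E) : closure (convexHull ℝ G) ⊆ closure (averages G) := by
  refine closure_minimal (convexHull_min ?_ ?_) isClosed_closure
  · refine fun g hg => subset_closure ⟨[g], by simp, by simpa using hg, by simp⟩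
  · intro x hx y hy a b ha hb hab
    have hc : Continuous fun p : E × E => a • p.1 + b • p.2 := by fun_prop
    have : (x, y) ∈ closure (averages G ×ˢ averages G) := by
      rw [closure_prod_eq]; exact ⟨hx, hy⟩
    have h2 := map_mem_closure hc this (t := closure (averages G)) fun p hp =>
      segment_subset_closure_averages hp.1 hp.2 ⟨a, b, ha, hb, hab, rfl⟩
    rwa [closure_closure] at h2

/-- A countable family of measurable conditions, at least one of which holds almost everywhere,
has a measurable choice of a valid condition. -/
theorem exists_measurable_choice {α ι : Type*} [MeasurableSpace α] {μ : Measure α} [Countable ι]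
    [Nonempty ι] [MeasurableSpace ι] {P : ι → Set α} (hP : ∀ i, NullMeasurableSet (P i) μ)
    (hcov : ∀ᵐ x ∂μ, ∃ i, x ∈ P i) :
    ∃ c : α → ι, Measurable c ∧ ∀ᵐ x ∂μ, x ∈ P (c x) := by
  classical
  obtain ⟨e, he⟩ := exists_surjective_nat ι
  choose Q hQ hQm hQe using fun n => (hP (e n)).exists_measurable_subset_ae_eq
  let S : ℕ → Set α := fun n => Q n ∪ (⋃ k, Q k)ᶜ
  have hSm : ∀ n, MeasurableSet (S n) := fun n => (hQm n).union (MeasurableSet.iUnion hQm).compl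
  have hS : ∀ x, ∃ n, x ∈ S n := fun x => by
    by_cases h : x ∈ ⋃ k, Q k
    · obtain ⟨n, hn⟩ := mem_iUnion.1 h
      exact ⟨n, Or.inl hn⟩
    · exact ⟨0, Or.inr h⟩
  refine ⟨fun x => e (Nat.find (hS x)), (measurable_of_countable e).comp
    (measurable_find hS hSm), ?_⟩
  have hall : ∀ᵐ x ∂μ, ∀ n, (x ∈ Q n ↔ x ∈ P (e n)) :=
    ae_all_iff.2 fun n => (hQe n).mem_iff
  filter_upwards [hall, hcov] with x hx hxc
  obtain ⟨i, hi⟩ := hxc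
  obtain ⟨n, rfl⟩ := he i
  have hmem : x ∈ ⋃ k, Q k := mem_iUnion.2 ⟨n, (hx n).2 hi⟩
  rcases Nat.find_spec (hS x) with h | h
  · exact (hx _).1 h
  · exact absurd hmem h

/-- The distance from a fixed point to a Lebesgue–Borel measurable set-valued map is measurable
along measurable curves. -/
theorem aemeasurable_infDist_comp {X : Type*} [NormedAddCommGroup X]
    [MeasurableSpace X] [BorelSpace X] {Iv : Set ℝ} (hIvm : MeasurableSet Iv) {F : ℝ → X → Set X}
    (hFne : ∀ t ∈ Iv, ∀ ξ : X, (F t ξ).Nonempty)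
    (H1 : ∀ U : Set X, IsOpen U →
      MeasurableSet[MeasurableSpace.prod
          (inferInstanceAs (MeasurableSpace (NullMeasurableSpace ℝ volume)))
          (inferInstance : MeasurableSpace X)]
        {p : ℝ × X | p.1 ∈ Iv ∧ (F p.1 p.2 ∩ U).Nonempty})
    {y : ℝ → X} (hy : AEMeasurable y (volume.restrict Iv)) (x : X) :
    AEMeasurable (fun t => Metric.infDist x (F t (y t))) (volume.restrict Iv) := by
  obtain ⟨y', hy'm, hyy'⟩ := hy
  suffices h : AEMeasurable (fun t => Metric.infDist x (F t (y' t))) (volume.restrict Iv) by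
    refine h.congr ?_
    filter_upwards [hyy'] with t ht
    rw [ht]
  refine NullMeasurable.aemeasurable ?_
  have key : ∀ c : ℝ, NullMeasurableSet
      ({t | Metric.infDist x (F t (y' t)) < c}) (volume.restrict Iv) := by
    intro c
    have h1 := H1 (Metric.ball x c) Metric.isOpen_ball
    have hmap : @Measurable (NullMeasurableSpace ℝ volume) (NullMeasurableSpace ℝ volume × X)
        _ _ (fun t => (t, y' t)) :=
      measurable_id.prodMk (hy'm.nullMeasurable (μ := volume)).measurable'
    have h2 : NullMeasurableSet {t : ℝ | t ∈ Iv ∧ (F t (y' t) ∩ Metric.ball x c).Nonempty}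
      volume := hmap h1
    refine (h2.mono_ac Measure.restrict_le_self.absolutelyContinuous).congr ?_
    filter_upwards [ae_restrict_mem hIvm] with t ht
    apply propext
    change (t ∈ Iv ∧ (F t (y' t) ∩ Metric.ball x c).Nonempty) ↔ Metric.infDist x (F t (y' t)) < c
    rw [Metric.infDist_lt_iff (hFne t ht _)]
    constructor
    · rintro ⟨-, ζ, hζ, hζc⟩
      exact ⟨ζ, hζ, by rwa [dist_comm]⟩
    · rintro ⟨ζ, hζ, hζc⟩
      exact ⟨ht, ζ, hζ, by rwa [Metric.mem_ball, dist_comm]⟩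
  intro s hs
  have : @Measurable (NullMeasurableSpace ℝ (volume.restrict Iv)) ℝ _ _
    (fun t => Metric.infDist x (F t (y' t))) := measurable_of_Iio key
  exact this hs
/-- The monotone sequence `τ` starts at `0` and exhausts the half-open interval `I` starting
at `0`. -/
structure Exhausts (τ : ℕ → ℝ) (I : Set ℝ) : Prop where
  zero : τ 0 = 0
  mono : Monotone τ
  mem : ∀ n, τ n ∈ I
  mem_iff : ∀ t, t ∈ I ↔ 0 ≤ t ∧ ∃ n, t < τ n

namespace Exhausts

variable {τ : ℕ → ℝ} {I : Set ℝ}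

theorem nonneg (h : Exhausts τ I) {t : ℝ} (ht : t ∈ I) : 0 ≤ t := ((h.mem_iff t).1 ht).1

theorem zero_mem (h : Exhausts τ I) : (0 : ℝ) ∈ I := h.zero ▸ h.mem 0

theorem mem_of_le (h : Exhausts τ I) {s t : ℝ} (hs : 0 ≤ s) (hst : s ≤ t) (ht : t ∈ I) : s ∈ I :=
  (h.mem_iff s).2 ⟨hs, ((h.mem_iff t).1 ht).2.imp fun _ hn => hst.trans_lt hn⟩

theorem Icc_subset (h : Exhausts τ I) {t : ℝ} (ht : t ∈ I) : Icc 0 t ⊆ I :=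
  fun _ hs => h.mem_of_le hs.1 hs.2 ht

theorem exists_index (h : Exhausts τ I) {t : ℝ} (ht : t ∈ I) :
    ∃ i, t ∈ Ico (τ i) (τ (i + 1)) := by
  classical
  obtain ⟨h0, hn⟩ := (h.mem_iff t).1 ht
  have hpos : Nat.find hn ≠ 0 := fun h1 => by
    have := Nat.find_spec hn
    rw [h1, h.zero] at this
    linarith
  obtain ⟨i, hi⟩ := Nat.exists_eq_succ_of_ne_zero hpos
  refine ⟨i, not_lt.1 (Nat.find_min hn (by omega)), ?_⟩
  have := Nat.find_spec hn
  rwa [hi] at this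

theorem Ico_subset (h : Exhausts τ I) (i : ℕ) : Ico (τ i) (τ (i + 1)) ⊆ I := fun _ ht =>
  h.mem_of_le ((h.nonneg (h.mem i)).trans ht.1) ht.2.le (h.mem _)

theorem iUnion_Ico (h : Exhausts τ I) : ⋃ i, Ico (τ i) (τ (i + 1)) = I :=
  subset_antisymm (iUnion_subset h.Ico_subset) fun _ ht => mem_iUnion.2 (h.exists_index ht)

theorem measurableSet (h : Exhausts τ I) : MeasurableSet I :=
  h.iUnion_Ico ▸ MeasurableSet.iUnion fun _ => measurableSet_Ico

theorem aestronglyMeasurable {E : Type*} [NormedAddCommGroup E] (h : Exhausts τ I) {u : ℝ → E}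
    (hu : ∀ t ∈ I, IntegrableOn u (Icc 0 t)) : AEStronglyMeasurable u (volume.restrict I) := by
  rw [← h.iUnion_Ico, aestronglyMeasurable_iUnion_iff]
  exact fun i => ((hu _ (h.mem (i + 1))).mono_set
    fun t ht => ⟨(h.nonneg (h.mem i)).trans ht.1, ht.2.le⟩).aestronglyMeasurable

theorem intervalIntegrable {E : Type*} [NormedAddCommGroup E] (h : Exhausts τ I) {u : ℝ → E}
    (hu : ∀ t ∈ I, IntegrableOn u (Icc 0 t)) {s t : ℝ} (hs : s ∈ I) (ht : t ∈ I) :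
    IntervalIntegrable u volume s t := by
  refine ((hu (max s t) ?_).mono_set ?_).intervalIntegrable
  · rcases max_choice s t with h1 | h1 <;> rw [h1] <;> assumption
  · exact Icc_subset_Icc (le_min (h.nonneg hs) (h.nonneg ht)) le_rfl

theorem continuousOn_primitive {E : Type*} [NormedAddCommGroup E] [NormedSpace ℝ E]
    (h : Exhausts τ I) {u : ℝ → E} (hu : ∀ t ∈ I, IntegrableOn u (Icc 0 t)) :
    ContinuousOn (fun t => ∫ s in (0 : ℝ)..t, u s) I := by
  intro t ht
  obtain ⟨-, n, hn⟩ := (h.mem_iff t).1 ht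
  have h1 : ContinuousOn (fun t => ∫ s in (0 : ℝ)..t, u s) (Icc 0 (τ n)) := by
    rw [← uIcc_of_le (h.nonneg (h.mem n))]
    refine intervalIntegral.continuousOn_primitive_interval ?_
    rw [uIcc_of_le (h.nonneg (h.mem n))]
    exact hu _ (h.mem n)
  refine (h1 t ⟨h.nonneg ht, hn.le⟩).mono_of_mem_nhdsWithin ?_
  filter_upwards [self_mem_nhdsWithin, mem_nhdsWithin_of_mem_nhds (Iio_mem_nhds hn)] with s hs hsn
  exact ⟨h.nonneg hs, le_of_lt hsn⟩

/-- Locally integrable functions on the pieces of the exhaustion glue together. -/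
theorem exists_glue (h : Exhausts τ I) {P : ℕ → ℝ → ℝ → Prop}
    (hP : ∀ i, ∃ k : ℝ → ℝ, (∀ t ∈ I, IntegrableOn k (Icc 0 t)) ∧
      ∀ᵐ t ∂volume.restrict I, P i t (k t)) :
    ∃ k : ℝ → ℝ, (∀ t ∈ I, IntegrableOn k (Icc 0 t)) ∧
      ∀ᵐ t ∂volume.restrict I, ∃ i, t ∈ Ico (τ i) (τ (i + 1)) ∧ P i t (k t) := by
  classical
  choose k hk hkP using hP
  let idx : ℝ → ℕ := fun t => if ht : t ∈ I then (h.exists_index ht).choose else 0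
  have hidx : ∀ t ∈ I, t ∈ Ico (τ (idx t)) (τ (idx t + 1)) := fun t ht => by
    simp only [idx, dif_pos ht]
    exact (h.exists_index ht).choose_spec
  have huniq : ∀ i, ∀ t ∈ Ico (τ i) (τ (i + 1)), idx t = i := fun i t ht => by
    by_contra hne
    exact (h.mono.pairwise_disjoint_on_Ico_succ hne).le_bot
      ⟨hidx t (h.Ico_subset i ht), ht⟩
  refine ⟨fun t => k (idx t) t, fun t ht => ?_, ?_⟩
  · obtain ⟨-, n, hn⟩ := (h.mem_iff t).1 ht
    have hfin : IntegrableOn (fun t => k (idx t) t)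
        (⋃ i ∈ Finset.range n, Ico (τ i) (τ (i + 1))) := by
      rw [integrableOn_finset_iUnion]
      intro i _
      refine IntegrableOn.congr_fun (f := k i) ?_ (fun s hs => ?_) measurableSet_Ico
      · exact (hk i _ (h.mem (i + 1))).mono_set
          fun s hs => ⟨(h.nonneg (h.mem i)).trans hs.1, hs.2.le⟩
      · simp only [huniq i s hs]
    refine hfin.mono_set fun s hs => ?_
    obtain ⟨i, hi⟩ := h.exists_index (h.Icc_subset ht hs)
    refine mem_biUnion (x := i) ?_ hi
    simp only [Finset.coe_range, mem_Iio]
    by_contra! hni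
    linarith [h.mono hni, hi.1, hs.2]
  · filter_upwards [ae_all_iff.2 hkP, ae_restrict_mem h.measurableSet] with t ht htI
    exact ⟨idx t, hidx t htI, ht _⟩

theorem integral_mul_exp_neg_le (h : Exhausts τ I) {k : ℝ → ℝ}
    (hk : ∀ t ∈ I, IntegrableOn k (Icc 0 t)) (hk0 : ∀ t, 0 ≤ k t) {c : ℝ} (hc : 0 < c)
    {a b : ℝ} (ha : a ∈ I) (hb : b ∈ I) (hab : a ≤ b) :
    ∫ t in a..b, k t * Real.exp (-(c * ∫ s in (0 : ℝ)..t, k s)) ≤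
      Real.exp (-(c * ∫ s in (0 : ℝ)..a, k s)) / c := by
  set K : ℝ → ℝ := fun t => ∫ s in (0 : ℝ)..t, k s with hK
  have hKmono : ∀ s t, s ∈ I → t ∈ I → s ≤ t → K s ≤ K t := fun s t hs ht hst => by
    have := intervalIntegral.integral_interval_sub_left
      (h.intervalIntegrable hk h.zero_mem ht) (h.intervalIntegrable hk h.zero_mem hs)
    have h2 : 0 ≤ ∫ x in s..t, k x := intervalIntegral.integral_nonneg hst fun x _ => hk0 x
    simp only [hK]
    linarith
  let f : ℝ → ℝ := fun t => -(Real.exp (-(c * K t)) / c)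
  have hI : uIcc a b ⊆ I := by
    rw [uIcc_of_le hab]
    exact fun t ht => h.mem_of_le ((h.nonneg ha).trans ht.1) ht.2 hb
  have hf : MonotoneOn f (uIcc a b) := fun s hs t ht hst => by
    have := hKmono s t (hI hs) (hI ht) hst
    simp only [f]
    gcongr
  have hder : ∀ᵐ t, t ∈ uIoc a b → k t * Real.exp (-(c * K t)) = deriv f t := by
    filter_upwards [(h.intervalIntegrable hk h.zero_mem hb).ae_hasDerivAt_integral] with t ht htab
    have htab' := hI (uIoc_subset_uIcc htab)
    have hmem : t ∈ uIcc 0 b := by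
      rw [uIcc_of_le (h.nonneg hb)]
      refine ⟨h.nonneg htab', ?_⟩
      rw [uIoc_of_le hab] at htab
      exact htab.2
    have h1 : HasDerivAt K (k t) t := ht hmem 0 left_mem_uIcc
    have h2 : HasDerivAt f (-(Real.exp (-(c * K t)) * (-(c * k t)) / c)) t :=
      (((h1.const_mul c).neg.exp).div_const c).neg
    rw [h2.deriv]
    field_simp
  rw [intervalIntegral.integral_congr_ae hder]
  have hmem := hf.intervalIntegral_deriv_mem_uIcc
  have hfab : f a ≤ f b := hf left_mem_uIcc right_mem_uIcc hab
  rw [uIcc_of_le (by linarith)] at hmem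
  refine hmem.2.trans ?_
  have : 0 ≤ Real.exp (-(c * K b)) / c := by positivity
  simp only [f]
  linarith

theorem integrableOn_mul_exp_neg (h : Exhausts τ I) {k : ℝ → ℝ}
    (hk : ∀ t ∈ I, IntegrableOn k (Icc 0 t)) (hk0 : ∀ t, 0 ≤ k t) {c : ℝ} (hc : 0 < c)
    {a : ℝ} (ha : a ∈ I) :
    IntegrableOn (fun t => k t * Real.exp (-(c * ∫ s in (0 : ℝ)..t, k s))) (I ∩ Ici a) ∧
    ∫ t in I ∩ Ici a, k t * Real.exp (-(c * ∫ s in (0 : ℝ)..t, k s)) ≤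
      Real.exp (-(c * ∫ s in (0 : ℝ)..a, k s)) / c := by
  set g : ℝ → ℝ := fun t => k t * Real.exp (-(c * ∫ s in (0 : ℝ)..t, k s)) with hg
  have hg0 : ∀ t, 0 ≤ g t := fun t => mul_nonneg (hk0 t) (Real.exp_pos _).le
  have hcont : ContinuousOn (fun t => Real.exp (-(c * ∫ s in (0 : ℝ)..t, k s))) I :=
    ((continuousOn_const.mul (h.continuousOn_primitive hk)).neg).rexp
  have hgm : AEStronglyMeasurable g (volume.restrict I) :=
    (h.aestronglyMeasurable hk).mul (hcont.aestronglyMeasurable h.measurableSet)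
  have hgm' : AEStronglyMeasurable g (volume.restrict (I ∩ Ici a)) :=
    hgm.mono_measure (Measure.restrict_mono inter_subset_left le_rfl)
  have hgloc : ∀ b ∈ I, IntegrableOn g (Icc 0 b) := fun b hb =>
    (hk b hb).mul_continuousOn (hcont.mono (h.Icc_subset hb)) isCompact_Icc
  have hU : I ∩ Ici a = ⋃ n, Ico a (τ n) := by
    ext t
    simp only [mem_inter_iff, h.mem_iff, mem_Ici, mem_iUnion, mem_Ico, exists_and_left]
    constructor
    · exact fun ht => ⟨ht.2, ht.1.2⟩
    · exact fun ht => ⟨⟨(h.nonneg ha).trans ht.1, ht.2⟩, ht.1⟩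
  have hlin : ∫⁻ t in I ∩ Ici a, ENNReal.ofReal (g t) ≤
      ENNReal.ofReal (Real.exp (-(c * ∫ s in (0 : ℝ)..a, k s)) / c) := by
    rw [hU, setLIntegral_iUnion_of_directed _
      (directed_of_isDirected_le fun m n hmn => Ico_subset_Ico_right (h.mono hmn))]
    refine iSup_le fun n => ?_
    rcases le_or_gt (τ n) a with hn | hn
    · simp [Ico_eq_empty_of_le hn]
    · have hInt : IntegrableOn g (Ico a (τ n)) := (hgloc _ (h.mem n)).mono_set
        fun t ht => ⟨(h.nonneg ha).trans ht.1, ht.2.le⟩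
      rw [← ofReal_integral_eq_lintegral_ofReal hInt (ae_of_all _ hg0),
        integral_Ico_eq_integral_Ioc, ← intervalIntegral.integral_of_le hn.le]
      exact ENNReal.ofReal_le_ofReal (h.integral_mul_exp_neg_le hk hk0 hc ha (h.mem n) hn.le)
  refine ⟨⟨hgm', ?_⟩, ?_⟩
  · rw [hasFiniteIntegral_iff_ofReal (ae_of_all _ hg0)]
    exact hlin.trans_lt ENNReal.ofReal_lt_top
  · rw [integral_eq_lintegral_of_nonneg_ae (ae_of_all _ hg0) hgm']
    exact ENNReal.toReal_le_of_le_ofReal (by positivity) hlin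

/-- A decreasing weight below `ρ` that dominates the tail integrals of its product with `k`. -/
theorem exists_weight (h : Exhausts τ I) {k ρ : ℝ → ℝ}
    (hk : ∀ t ∈ I, IntegrableOn k (Icc 0 t)) (hk0 : ∀ t, 0 ≤ k t)
    (hρ : ContinuousOn ρ I) (hρ0 : ∀ t ∈ I, 0 < ρ t) {c : ℝ} (hc : 0 < c) :
    ∃ ε : ℝ → ℝ, (∀ t ∈ I, 0 < ε t) ∧ (∀ t ∈ I, ε t ≤ ρ t) ∧ AntitoneOn ε I ∧
      IntegrableOn (fun t => k t * ε t) I ∧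
      ∀ t ∈ I, ∫ s in I ∩ Ici t, k s * ε s ≤ ε t / c := by
  let m : ℝ → ℝ := fun t => sInf (ρ '' Icc 0 t)
  have hcpt : ∀ t ∈ I, IsCompact (ρ '' Icc 0 t) := fun t ht =>
    isCompact_Icc.image_of_continuousOn (hρ.mono (h.Icc_subset ht))
  have hmm : ∀ t ∈ I, m t ∈ ρ '' Icc 0 t := fun t ht =>
    (hcpt t ht).sInf_mem ((nonempty_Icc.2 (h.nonneg ht)).image ρ)
  have hm0 : ∀ t ∈ I, 0 < m t := fun t ht => by
    obtain ⟨s, hs, hsm⟩ := hmm t ht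
    exact hsm ▸ hρ0 s (h.Icc_subset ht hs)
  have hmρ : ∀ t ∈ I, m t ≤ ρ t := fun t ht =>
    csInf_le (hcpt t ht).bddBelow (mem_image_of_mem ρ (right_mem_Icc.2 (h.nonneg ht)))
  have hmanti : AntitoneOn m I := fun s hs t ht hst =>
    csInf_le_csInf (hcpt t ht).bddBelow ((nonempty_Icc.2 (h.nonneg hs)).image ρ)
      (image_mono (Icc_subset_Icc_right hst))
  let e : ℝ → ℝ := fun t => Real.exp (-(c * ∫ s in (0 : ℝ)..t, k s))
  have he0 : ∀ t, 0 < e t := fun t => Real.exp_pos _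
  have he1 : ∀ t ∈ I, e t ≤ 1 := fun t ht => by
    refine Real.exp_le_one_iff.2 (neg_nonpos.2 (mul_nonneg hc.le ?_))
    exact intervalIntegral.integral_nonneg (h.nonneg ht) fun x _ => hk0 x
  have heanti : AntitoneOn e I := fun s hs t ht hst => by
    have := intervalIntegral.integral_interval_sub_left
      (h.intervalIntegrable hk h.zero_mem ht) (h.intervalIntegrable hk h.zero_mem hs)
    have h2 : 0 ≤ ∫ x in s..t, k x := intervalIntegral.integral_nonneg hst fun x _ => hk0 x
    have h3 : ∫ x in (0 : ℝ)..s, k x ≤ ∫ x in (0 : ℝ)..t, k x := by linarith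
    simp only [e]
    gcongr
  have hεanti : AntitoneOn (fun t => m t * e t) I := fun s hs t ht hst =>
    mul_le_mul (hmanti hs ht hst) (heanti hs ht hst) (he0 t).le (hm0 s hs).le
  have htail : ∀ t ∈ I, ∀ s ∈ I ∩ Ici t, k s * (m s * e s) ≤ m t * (k s * e s) :=
    fun t ht s hs => by
      have := mul_le_mul_of_nonneg_right (hmanti ht hs.1 hs.2) (mul_nonneg (hk0 s) (he0 s).le)
      linarith
  have hInt : ∀ t ∈ I, IntegrableOn (fun s => k s * (m s * e s)) (I ∩ Ici t) := fun t ht => by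
    refine ((h.integrableOn_mul_exp_neg hk hk0 hc ht).1.const_mul (m t)).mono' ?_ ?_
    · refine AEStronglyMeasurable.mono_measure (μ := volume.restrict I) ?_
        (Measure.restrict_mono inter_subset_left le_rfl)
      exact (h.aestronglyMeasurable hk).mul
        (aemeasurable_restrict_of_antitoneOn h.measurableSet hεanti).aestronglyMeasurable
    · filter_upwards [ae_restrict_mem (h.measurableSet.inter measurableSet_Ici)] with s hs
      rw [Real.norm_of_nonneg (mul_nonneg (hk0 s) (mul_nonneg (hm0 s hs.1).le (he0 s).le))]
      exact htail t ht s hs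
  refine ⟨fun t => m t * e t, fun t ht => mul_pos (hm0 t ht) (he0 t), fun t ht => ?_, hεanti,
    ?_, fun t ht => ?_⟩
  · exact (mul_le_of_le_one_right (hm0 t ht).le (he1 t ht)).trans (hmρ t ht)
  · have := hInt 0 h.zero_mem
    rwa [inter_eq_left.2 (show I ⊆ Ici 0 from fun s hs => h.nonneg hs)] at this
  · obtain ⟨hi, hle⟩ := h.integrableOn_mul_exp_neg hk hk0 hc ht
    calc ∫ s in I ∩ Ici t, k s * (m s * e s) ≤ ∫ s in I ∩ Ici t, m t * (k s * e s) :=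
          setIntegral_mono_on (hInt t ht) (hi.const_mul _)
            (h.measurableSet.inter measurableSet_Ici) (htail t ht)
      _ = m t * ∫ s in I ∩ Ici t, k s * e s := integral_const_mul _ _
      _ ≤ m t * (e t / c) := mul_le_mul_of_nonneg_left hle (hm0 t ht).le
      _ = m t * e t / c := by ring

end Exhausts

theorem exists_exhausts {T : ℝ≥0∞} (hT : 0 < T) :
    ∃ τ : ℕ → ℝ, Exhausts τ {t : ℝ | 0 ≤ t ∧ ENNReal.ofReal t < T} := by
  rcases eq_or_ne T ∞ with rfl | hT'
  · refine ⟨fun n => n, by simp, Nat.mono_cast, fun n => ⟨by positivity, by simp⟩, fun t => ?_⟩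
    exact and_congr_right fun _ => ⟨fun _ => exists_nat_gt t, fun _ => ENNReal.ofReal_lt_top⟩
  · have hT0 : 0 < T.toReal := ENNReal.toReal_pos hT.ne' hT'
    have hlt : ∀ t : ℝ, 0 ≤ t → (ENNReal.ofReal t < T ↔ t < T.toReal) := fun t ht => by
      rw [ENNReal.ofReal_lt_iff_lt_toReal ht hT']
    have hτ : ∀ n : ℕ, T.toReal * (1 - 1 / ((n : ℝ) + 1)) < T.toReal := fun n => by
      have : 0 < 1 / ((n : ℝ) + 1) := by positivity
      nlinarith
    refine ⟨fun n => T.toReal * (1 - 1 / ((n : ℝ) + 1)), by simp, fun m n hmn => ?_,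
      fun n => ?_, fun t => ?_⟩
    · gcongr
    · have h1 : 0 ≤ T.toReal * (1 - 1 / ((n : ℝ) + 1)) := by
        refine mul_nonneg hT0.le (sub_nonneg.2 ?_)
        rw [div_le_one (by positivity)]
        linarith [(Nat.cast_nonneg n : (0 : ℝ) ≤ n)]
      exact ⟨h1, (hlt _ h1).2 (hτ n)⟩
    · refine and_congr_right fun ht => ?_
      rw [hlt t ht]
      constructor
      · intro h
        obtain ⟨n, hn⟩ := exists_nat_one_div_lt (sub_pos.2 ((div_lt_one hT0).2 h))
        refine ⟨n, ?_⟩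
        have h2 : t / T.toReal < 1 - 1 / ((n : ℝ) + 1) := by linarith
        rw [div_lt_iff₀ hT0] at h2
        linarith
      · rintro ⟨n, hn⟩
        exact hn.trans (hτ n)
theorem norm_average_map_sub_average_le {E : Type*} [NormedAddCommGroup E] [NormedSpace ℝ E]
    {f : E → E} {δ : ℝ} (hδ : 0 ≤ δ) (hf : ∀ x, ‖f x - x‖ ≤ δ) (l : List E) :
    ‖(l.length : ℝ)⁻¹ • (l.map f).sum - (l.length : ℝ)⁻¹ • l.sum‖ ≤ δ := by
  have hsum : ‖(l.map f).sum - l.sum‖ ≤ l.length * δ := by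
    induction l with
    | nil => simp
    | cons a l ih =>
      simp only [List.map_cons, List.sum_cons, List.length_cons, Nat.cast_add, Nat.cast_one]
      calc ‖f a + (l.map f).sum - (a + l.sum)‖ = ‖(f a - a) + ((l.map f).sum - l.sum)‖ := by
            congr 1; abel
        _ ≤ ‖f a - a‖ + ‖(l.map f).sum - l.sum‖ := norm_add_le _ _
        _ ≤ (l.length + 1) * δ := by linarith [hf a]
  rw [← smul_sub, norm_smul, norm_inv, Real.norm_natCast]
  rcases Nat.eq_zero_or_pos l.length with h | h
  · simpa [h] using hδ
  · have h' : (0 : ℝ) < l.length := by exact_mod_cast h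
    rw [inv_mul_le_iff₀ h']
    exact hsum

/-- Points of the closed convex hull are approximated by averages of points of a dense sequence
that are close to the set. -/
theorem exists_list_average_denseSeq {X : Type*} [NormedAddCommGroup X] [NormedSpace ℝ X]
    [TopologicalSpace.SeparableSpace X] {G : Set X} {v : X} (hv : v ∈ closure (convexHull ℝ G))
    {η : ℝ} (hη : 0 < η) :
    ∃ c : List ℕ, c ≠ [] ∧ (∀ i ∈ c, Metric.infDist (TopologicalSpace.denseSeq X i) G < η) ∧
      ‖(c.length : ℝ)⁻¹ • (c.map (TopologicalSpace.denseSeq X)).sum - v‖ < η := by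
  obtain ⟨a, ⟨l, hl, hlG, rfl⟩, hav⟩ := Metric.mem_closure_iff.1
    (closure_convexHull_subset_closure_averages G hv) (η / 2) (half_pos hη)
  choose n hn using fun x : X =>
    (TopologicalSpace.denseRange_denseSeq X).exists_dist_lt x (half_pos hη)
  refine ⟨l.map n, by simpa using hl, ?_, ?_⟩
  · intro i hi
    obtain ⟨g, hg, rfl⟩ := List.mem_map.1 hi
    refine (Metric.infDist_le_dist_of_mem (hlG g hg)).trans_lt ?_
    rw [dist_comm]
    linarith [hn g]
  · have h1 := norm_average_map_sub_average_le (f := fun x => TopologicalSpace.denseSeq X (n x))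
      (half_pos hη).le (fun x => by rw [← dist_eq_norm, dist_comm]; exact (hn x).le) l
    rw [dist_comm, dist_eq_norm] at hav
    rw [List.length_map, List.map_map]
    calc _ ≤ ‖(l.length : ℝ)⁻¹ • (l.map fun x => TopologicalSpace.denseSeq X (n x)).sum
          - (l.length : ℝ)⁻¹ • l.sum‖ + ‖(l.length : ℝ)⁻¹ • l.sum - v‖ :=
          norm_sub_le_norm_sub_add_norm_sub _ _ _
      _ < η := by linarith

theorem norm_le_of_infDist_le {X : Type*} [NormedAddCommGroup X] {G : Set X} (hG : G.Nonempty)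
    {a : ℝ} (ha : ∀ ζ ∈ G, ‖ζ‖ ≤ a) (x : X) : ‖x‖ ≤ a + Metric.infDist x G := by
  refine le_of_forall_pos_le_add fun e he => ?_
  obtain ⟨ζ, hζ, hd⟩ := (Metric.infDist_lt_iff hG).1 (lt_add_of_pos_right (Metric.infDist x G) he)
  rw [dist_eq_norm] at hd
  have := norm_le_insert' x ζ
  linarith [ha ζ hζ]

namespace Exhausts

variable {τ : ℕ → ℝ} {I : Set ℝ}

theorem integral_Ico_zero_eq {E : Type*} [NormedAddCommGroup E] [NormedSpace ℝ E]
    (h : Exhausts τ I) {t : ℝ} (ht : t ∈ I) (u : ℝ → E) :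
    ∫ s in I ∩ Iio t, u s = ∫ s in (0 : ℝ)..t, u s := by
  rw [intervalIntegral.integral_of_le (h.nonneg ht), ← integral_Ico_eq_integral_Ioc]
  congr 2
  ext s
  simp only [mem_inter_iff, mem_Iio, mem_Ico]
  exact ⟨fun hs => ⟨h.nonneg hs.1, hs.2⟩, fun hs => ⟨h.mem_of_le hs.1 hs.2.le ht, hs.2⟩⟩

/-- A vector-valued function with values in the closed convex hulls of `G t` is approximated, up
to an integrable error, by a function whose primitive is close to the primitive of a function
with values close to `G t`. -/
theorem exists_chattering {X : Type*} [NormedAddCommGroup X] [NormedSpace ℝ X] [CompleteSpace X]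
    [MeasurableSpace X] [BorelSpace X] [TopologicalSpace.SeparableSpace X]
    (h : Exhausts τ I) {G : ℝ → Set X} (hGne : ∀ t ∈ I, (G t).Nonempty)
    (hGm : ∀ x, AEMeasurable (fun t => Metric.infDist x (G t)) (volume.restrict I))
    {α : ℝ → ℝ} (hα : ∀ t ∈ I, IntegrableOn α (Icc 0 t))
    (hGα : ∀ᵐ t ∂volume.restrict I, ∀ ζ ∈ G t, ‖ζ‖ ≤ α t)
    {v : ℝ → X} (hv : ∀ t ∈ I, IntegrableOn v (Icc 0 t))
    (hvG : ∀ᵐ t ∂volume.restrict I, v t ∈ closure (convexHull ℝ (G t)))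
    {η ε : ℝ → ℝ} (hη0 : ∀ t ∈ I, 0 < η t) (hηi : IntegrableOn η I)
    (hε0 : ∀ t ∈ I, 0 < ε t) (hε : AntitoneOn ε I) :
    ∃ w q : ℝ → X, (∀ t ∈ I, IntegrableOn w (Icc 0 t)) ∧ (∀ t ∈ I, IntegrableOn q (Icc 0 t)) ∧
      (∀ᵐ t ∂volume.restrict I, Metric.infDist (w t) (G t) ≤ η t) ∧
      (∀ᵐ t ∂volume.restrict I, ‖q t - v t‖ ≤ η t) ∧
      ∀ t ∈ I, ‖∫ s in (0 : ℝ)..t, (w s - q s)‖ ≤ ε t := by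
  let d : ℕ → X := TopologicalSpace.denseSeq X
  let ι := {c : List ℕ // c ≠ []}
  let : MeasurableSpace (ℕ × ι) := ⊤
  have : DiscreteMeasurableSpace (ℕ × ι) := ⟨fun _ => trivial⟩
  have : Nonempty ι := ⟨⟨[0], by simp⟩⟩
  let avg : ι → X := fun c => (c.1.length : ℝ)⁻¹ • (c.1.map d).sum
  have hIm := h.measurableSet
  have hvm := h.aestronglyMeasurable hv
  have hηm : AEMeasurable η (volume.restrict I) := hηi.aemeasurable
  let P : ℕ × ι → Set ℝ := fun κ => Ico (τ κ.1) (τ (κ.1 + 1)) ∩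
    ({t | ∀ i ∈ κ.2.1, Metric.infDist (d i) (G t) < η t} ∩ {t | ‖avg κ.2 - v t‖ < η t})
  have hPm : ∀ κ, NullMeasurableSet (P κ) (volume.restrict I) := fun κ => by
    refine measurableSet_Ico.nullMeasurableSet.inter (NullMeasurableSet.inter ?_ ?_)
    · have : {t | ∀ i ∈ κ.2.1, Metric.infDist (d i) (G t) < η t} =
          ⋂ i ∈ {i | i ∈ κ.2.1}, {t | Metric.infDist (d i) (G t) < η t} := by
        ext t; simp
      rw [this]
      exact NullMeasurableSet.biInter (to_countable _) fun i _ => nullMeasurableSet_lt (hGm _) hηm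
    · exact nullMeasurableSet_lt
        (aestronglyMeasurable_const.sub hvm).norm.aemeasurable hηm
  have hcov : ∀ᵐ t ∂volume.restrict I, ∃ κ, t ∈ P κ := by
    filter_upwards [hvG, ae_restrict_mem hIm] with t ht htI
    obtain ⟨i, hi⟩ := h.exists_index htI
    obtain ⟨c, hc, hc1, hc2⟩ := exists_list_average_denseSeq ht (hη0 t htI)
    exact ⟨(i, ⟨c, hc⟩), hi, hc1, hc2⟩
  obtain ⟨κ, hκm, hκP⟩ := exists_measurable_choice hPm hcov
  let A : ℕ × ι → Set ℝ := fun l => κ ⁻¹' {l} ∩ Ico (τ l.1) (τ (l.1 + 1))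
  have hAm : ∀ l, MeasurableSet (A l) := fun l =>
    (hκm (measurableSet_singleton l)).inter measurableSet_Ico
  have hAd : Pairwise (Function.onFun Disjoint A) := fun l l' hne => by
    refine disjoint_left.2 fun t ht ht' => hne ?_
    have h1 : κ t = l := ht.1
    have h2 : κ t = l' := ht'.1
    rw [← h1, h2]
  have : Encodable (ℕ × ι) := Encodable.ofCountable _
  obtain ⟨b, hb0, B, hB, hB1⟩ := posSumOfEncodable zero_lt_one (ℕ × ι)
  choose j hjm hjlt hjle hj0 using fun l : ℕ × ι => exists_oscillation (hAm l)
    (inter_subset_right : A l ⊆ _) (List.length_pos_iff.2 l.2.2)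
    (fun i => d (l.2.1.getD i 0)) (mul_pos (hε0 _ (h.mem (l.1 + 1))) (hb0 l))
  have havg : ∀ c : ι, (c.1.length : ℝ)⁻¹ • ∑ i ∈ Finset.range c.1.length, d (c.1.getD i 0)
      = avg c := fun c => by
    simp only [avg]
    rw [← Fin.sum_univ_fun_getElem, Finset.sum_range]
    simp
  simp only [havg] at hjle hj0
  let w : ℝ → X := fun t => d ((κ t).2.1.getD (j (κ t) t) 0)
  let q : ℝ → X := fun t => avg (κ t).2
  have hwm : Measurable w := by
    have h1 : Measurable fun p : (ℕ × ι) × ℝ => d (p.1.2.1.getD (j p.1 p.2) 0) :=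
      measurable_from_prod_countable_right fun l =>
        (measurable_of_countable fun i => d (l.2.1.getD i 0)).comp (hjm l)
    exact h1.comp (hκm.prodMk measurable_id)
  have hqm : Measurable q := (measurable_of_countable fun l : ℕ × ι => avg l.2).comp hκm
  have hwG : ∀ᵐ t ∂volume.restrict I, Metric.infDist (w t) (G t) ≤ η t := by
    filter_upwards [hκP] with t ht
    refine (ht.2.1 _ ?_).le
    rw [List.getD_eq_getElem _ _ (hjlt (κ t) t)]
    exact List.getElem_mem _
  have hqv : ∀ᵐ t ∂volume.restrict I, ‖q t - v t‖ ≤ η t := by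
    filter_upwards [hκP] with t ht
    exact ht.2.2.le
  have hηl : ∀ t ∈ I, IntegrableOn η (Icc 0 t) := fun t ht => hηi.mono_set (h.Icc_subset ht)
  have hwi : ∀ t ∈ I, IntegrableOn w (Icc 0 t) := fun t ht => by
    refine ((hα t ht).add (hηl t ht)).mono' hwm.aestronglyMeasurable ?_
    refine ae_restrict_of_ae_restrict_of_subset (h.Icc_subset ht) ?_
    filter_upwards [hwG, hGα, ae_restrict_mem hIm] with s hs hsα hsI
    exact (norm_le_of_infDist_le (hGne s hsI) hsα (w s)).trans (by simpa using hs)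
  have hqi : ∀ t ∈ I, IntegrableOn q (Icc 0 t) := fun t ht => by
    refine ((hv t ht).norm.add (hηl t ht)).mono' hqm.aestronglyMeasurable ?_
    refine ae_restrict_of_ae_restrict_of_subset (h.Icc_subset ht) ?_
    filter_upwards [hqv] with s hs
    have := norm_le_insert' (q s) (v s)
    simp only [Pi.add_apply]
    linarith
  refine ⟨w, q, hwi, hqi, hwG, hqv, fun t ht => ?_⟩
  have hcongr : ∀ l, ∀ s ∈ A l, w s - q s = d (l.2.1.getD (j l s) 0) - avg l.2 := fun l s hs => by
    have : κ s = l := hs.1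
    simp only [w, q, this]
  have hU : (⋃ l, A l ∩ Iio t : Set ℝ) =ᵐ[volume] (I ∩ Iio t : Set ℝ) := by
    have hsub : (⋃ l, A l ∩ Iio t) ⊆ I ∩ Iio t :=
      iUnion_subset fun l s hs => ⟨h.Ico_subset _ hs.1.2, hs.2⟩
    refine hsub.eventuallyLE.antisymm ?_
    have := (ae_restrict_iff' hIm).1 hκP
    filter_upwards [this] with s hs hsI
    exact mem_iUnion.2 ⟨κ s, ⟨rfl, (hs hsI.1).1⟩, hsI.2⟩
  have hInt : IntegrableOn (fun s => w s - q s) (⋃ l, A l ∩ Iio t) := by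
    refine (((hwi t ht).sub (hqi t ht)).mono_set (t := Icc 0 t) (s := I ∩ Iio t)
      fun s hs => ⟨h.nonneg hs.1, le_of_lt hs.2⟩).congr_set_ae hU
  have hsum := hasSum_integral_iUnion (fun l => (hAm l).inter measurableSet_Iio)
    (fun l l' hne => (hAd hne).mono inter_subset_left inter_subset_left) hInt
  rw [← h.integral_Ico_zero_eq ht, ← setIntegral_congr_set hU, ← hsum.tsum_eq]
  refine (tsum_of_norm_bounded (hB.mul_left (ε t)) fun l => ?_).trans
    (mul_le_of_le_one_right (hε0 t ht).le hB1)
  rw [setIntegral_congr_fun ((hAm l).inter measurableSet_Iio) fun s hs => hcongr l s hs.1]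
  rcases lt_or_ge t (τ (l.1 + 1)) with hlt | hge
  · exact (hjle l t).trans
      (mul_le_mul_of_nonneg_right (hε ht (h.mem _) hlt.le) (hb0 l).le)
  · rw [inter_eq_left.2 (show A l ⊆ Iio t from fun s hs => hs.2.2.trans_le hge), hj0 l, norm_zero]
    exact mul_nonneg (hε0 t ht).le (hb0 l).le

end Exhausts

namespace Exhausts

variable {τ : ℕ → ℝ} {I : Set ℝ}

theorem integral_inter_Ici {E : Type*} [NormedAddCommGroup E] [NormedSpace ℝ E]
    (h : Exhausts τ I) {t : ℝ} (ht : t ∈ I) {f : ℝ → E} (hf : IntegrableOn f I) :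
    ∫ s in I ∩ Ici t, f s = (∫ s in I, f s) - ∫ s in (0 : ℝ)..t, f s := by
  have h1 := integral_inter_add_sdiff (μ := volume) (measurableSet_Iio (a := t)) hf
  rw [h.integral_Ico_zero_eq ht, sdiff_eq, compl_Iio] at h1
  rw [← h1, add_sub_cancel_left]

theorem locallyIntegrable_of_norm_sub_le {E : Type*} [NormedAddCommGroup E]
    (h : Exhausts τ I) {u u' : ℝ → E} (hu : ∀ t ∈ I, IntegrableOn u (Icc 0 t))
    (hm : AEStronglyMeasurable u' (volume.restrict I)) {g : ℝ → ℝ} (hg : IntegrableOn g I)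
    (hug : ∀ᵐ t ∂volume.restrict I, ‖u' t - u t‖ ≤ g t) :
    ∀ t ∈ I, IntegrableOn u' (Icc 0 t) := fun t ht => by
  have h1 : IntegrableOn (fun s => u' s - u s) I :=
    Integrable.mono' hg (hm.sub (h.aestronglyMeasurable hu)) hug
  refine ((h1.mono_set (h.Icc_subset ht)).add (hu t ht)).congr (Eventually.of_forall fun s => ?_)
  simp

/-- Changing the velocity of a curve by an integrable amount, and its starting point so that the
change disappears at the right end point, moves the curve by at most the tail of the amount. -/
theorem exists_curve_of_norm_sub_le {E : Type*} [NormedAddCommGroup E] [NormedSpace ℝ E]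
    (h : Exhausts τ I) {y u u' : ℝ → E} (hu : ∀ t ∈ I, IntegrableOn u (Icc 0 t))
    (hu' : ∀ t ∈ I, IntegrableOn u' (Icc 0 t))
    (hy : ∀ t ∈ I, y t = y 0 + ∫ s in (0 : ℝ)..t, u s) {g δ : ℝ → ℝ} (hg : IntegrableOn g I)
    (hgδ : ∀ t ∈ I, ∫ s in I ∩ Ici t, g s ≤ δ t) {c : ℝ} (hc : 0 ≤ c)
    (hug : ∀ᵐ t ∂volume.restrict I, ‖u' t - u t‖ ≤ c * g t) :
    ∃ y' : ℝ → E, (∀ t ∈ I, y' t = y' 0 + ∫ s in (0 : ℝ)..t, u' s) ∧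
      ∀ t ∈ I, ‖y' t - y t‖ ≤ c * δ t := by
  have hi : IntegrableOn (fun s => u' s - u s) I :=
    Integrable.mono' (hg.const_mul c)
      ((h.aestronglyMeasurable hu').sub (h.aestronglyMeasurable hu)) hug
  refine ⟨fun t => y t - ∫ s in I ∩ Ici t, (u' s - u s), fun t ht => ?_, fun t ht => ?_⟩
  · have h1 := intervalIntegral.integral_sub (h.intervalIntegrable hu' h.zero_mem ht)
      (h.intervalIntegrable hu h.zero_mem ht)
    simp only [h.integral_inter_Ici ht hi, h.integral_inter_Ici h.zero_mem hi, h1, hy t ht,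
      intervalIntegral.integral_same]
    abel
  · rw [sub_sub_cancel_left, norm_neg]
    calc ‖∫ s in I ∩ Ici t, (u' s - u s)‖ ≤ ∫ s in I ∩ Ici t, c * g s :=
          norm_integral_le_of_norm_le ((hg.mono_set inter_subset_left).const_mul c)
            (ae_restrict_of_ae_restrict_of_subset inter_subset_left hug)
      _ = c * ∫ s in I ∩ Ici t, g s := integral_const_mul _ _
      _ ≤ c * δ t := mul_le_mul_of_nonneg_left (hgδ t ht) hc

/-- A velocity within distance `b` of a measurable set-valued map can be moved by at most `2 * b`
to be within distance `b / 4`. -/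
theorem exists_velocity_infDist_le {X : Type*} [NormedAddCommGroup X]
    [MeasurableSpace X] [BorelSpace X] [TopologicalSpace.SeparableSpace X]
    (h : Exhausts τ I) {G : ℝ → Set X} (hGne : ∀ t ∈ I, (G t).Nonempty)
    (hGm : ∀ x, AEMeasurable (fun t => Metric.infDist x (G t)) (volume.restrict I))
    {u : ℝ → X} (hu : ∀ t ∈ I, IntegrableOn u (Icc 0 t)) {b : ℝ → ℝ} (hb : IntegrableOn b I)
    (hb0 : ∀ t ∈ I, 0 < b t) (hub : ∀ᵐ t ∂volume.restrict I, Metric.infDist (u t) (G t) ≤ b t) :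
    ∃ u' : ℝ → X, (∀ t ∈ I, IntegrableOn u' (Icc 0 t)) ∧
      (∀ᵐ t ∂volume.restrict I, ‖u' t - u t‖ ≤ 2 * b t) ∧
      ∀ᵐ t ∂volume.restrict I, Metric.infDist (u' t) (G t) ≤ b t / 4 := by
  have hum : AEMeasurable u (volume.restrict I) := (h.aestronglyMeasurable hu).aemeasurable
  have hbm : AEMeasurable b (volume.restrict I) := hb.aestronglyMeasurable.aemeasurable
  let d := TopologicalSpace.denseSeq X
  obtain ⟨c, hcm, hc⟩ := exists_measurable_choice (μ := volume.restrict I)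
    (P := fun i : ℕ => {t | ‖d i - u t‖ < 2 * b t} ∩ {t | Metric.infDist (d i) (G t) < b t / 4})
    (fun i => (nullMeasurableSet_lt (hum.const_sub (d i)).norm (hbm.const_mul 2)).inter
      (nullMeasurableSet_lt (hGm (d i)) (hbm.div_const 4))) (by
    filter_upwards [hub, ae_restrict_mem h.measurableSet] with t ht htI
    have hbt := hb0 t htI
    obtain ⟨ζ, hζ, hd⟩ := (Metric.infDist_lt_iff (hGne t htI)).1
      (show Metric.infDist (u t) (G t) < 3 / 2 * b t by linarith)
    obtain ⟨i, hi⟩ := (TopologicalSpace.denseRange_denseSeq X).exists_dist_lt ζ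
      (show 0 < b t / 4 by linarith)
    refine ⟨i, ?_, ?_⟩
    · show ‖d i - u t‖ < 2 * b t
      rw [← dist_eq_norm, dist_comm]
      linarith [dist_triangle (u t) ζ (d i)]
    · refine (Metric.infDist_le_dist_of_mem hζ).trans_lt ?_
      rwa [dist_comm])
  have hcu : ∀ᵐ t ∂volume.restrict I, ‖d (c t) - u t‖ ≤ 2 * b t := hc.mono fun t ht => ht.1.le
  have hdm : Measurable fun t => d (c t) := (measurable_of_countable d).comp hcm
  exact ⟨fun t => d (c t), h.locallyIntegrable_of_norm_sub_le hu hdm.aestronglyMeasurable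
    (hb.const_mul 2) hcu, hcu, hc.mono fun t ht => ht.2.le⟩

/-- **Filippov's theorem** on a half-open interval: near an approximate solution, whose defect is
controlled by a weight `ε` adapted to the Lipschitz modulus `k`, there is a solution. -/
theorem exists_solution_near {X : Type*} [NormedAddCommGroup X] [NormedSpace ℝ X]
    [CompleteSpace X] [MeasurableSpace X] [BorelSpace X] [TopologicalSpace.SeparableSpace X]
    (h : Exhausts τ I) {F : ℝ → X → Set X} (hFne : ∀ t ∈ I, ∀ x, (F t x).Nonempty)
    (hFcl : ∀ t ∈ I, ∀ x, IsClosed (F t x))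
    (hFm : ∀ y : ℝ → X, ContinuousOn y I → ∀ x,
      AEMeasurable (fun t => Metric.infDist x (F t (y t))) (volume.restrict I))
    {z : ℝ → X} {k ε : ℝ → ℝ} (hk0 : ∀ t, 0 < k t) (hε0 : ∀ t ∈ I, 0 < ε t)
    (hε1 : ∀ t ∈ I, ε t ≤ 1) (hkε : IntegrableOn (fun t => k t * ε t) I)
    (htail : ∀ t ∈ I, ∫ s in I ∩ Ici t, k s * ε s ≤ ε t / 16)
    (hLip : ∀ᵐ t ∂volume.restrict I, ∀ x ∈ Metric.closedBall (z t) 1,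
      ∀ x' ∈ Metric.closedBall (z t) 1, ∀ ζ,
        Metric.infDist ζ (F t x) ≤ Metric.infDist ζ (F t x') + k t * ‖x - x'‖)
    {y₀ u₀ : ℝ → X} (hu₀ : ∀ t ∈ I, IntegrableOn u₀ (Icc 0 t))
    (hy₀ : ∀ t ∈ I, y₀ t = y₀ 0 + ∫ s in (0 : ℝ)..t, u₀ s)
    (hy₀z : ∀ t ∈ I, ‖y₀ t - z t‖ ≤ ε t / 4)
    (hu₀F : ∀ᵐ t ∂volume.restrict I, Metric.infDist (u₀ t) (F t (y₀ t)) ≤ k t * ε t / 2) :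
    ∃ y u : ℝ → X, (∀ t ∈ I, IntegrableOn u (Icc 0 t)) ∧
      (∀ t ∈ I, y t = y 0 + ∫ s in (0 : ℝ)..t, u s) ∧
      (∀ᵐ t ∂volume.restrict I, u t ∈ F t (y t)) ∧ ∀ t ∈ I, ‖y t - z t‖ ≤ ε t := by
  have hpos : ∀ t ∈ I, 0 < k t * ε t := fun t ht => mul_pos (hk0 t) (hε0 t ht)
  let Inv : ℕ → (ℝ → X) × (ℝ → X) → Prop := fun n p =>
    (∀ t ∈ I, IntegrableOn p.2 (Icc 0 t)) ∧
    (∀ t ∈ I, p.1 t = p.1 0 + ∫ s in (0 : ℝ)..t, p.2 s) ∧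
    (∀ t ∈ I, ‖p.1 t - z t‖ ≤ ε t * (1 / 2 - 1 / 4 / 2 ^ n)) ∧
    ∀ᵐ t ∂volume.restrict I, Metric.infDist (p.2 t) (F t (p.1 t)) ≤ k t * ε t / 2 / 2 ^ n
  have hstep : ∀ n p, Inv n p → ∃ p', Inv (n + 1) p' ∧
      (∀ t ∈ I, ‖p'.1 t - p.1 t‖ ≤ ε t / 16 / 2 ^ n) ∧
      ∀ᵐ t ∂volume.restrict I, ‖p'.2 t - p.2 t‖ ≤ k t * ε t / 2 ^ n := by
    rintro n ⟨y, u⟩ ⟨hu, hy, hyz, huF⟩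
    have h2 : (0 : ℝ) < 1 / 2 ^ n := by positivity
    have h21 : (1 : ℝ) / 2 ^ n ≤ 1 := by
      rw [div_le_one (by positivity)]
      exact one_le_pow₀ one_le_two
    have hyc : ContinuousOn y I :=
      (continuousOn_const.add (h.continuousOn_primitive hu)).congr hy
    obtain ⟨u', hu', hu'u, hu'F⟩ := h.exists_velocity_infDist_le (fun t ht => hFne t ht (y t))
      (hFm y hyc) hu ((hkε.div_const 2).div_const (2 ^ n))
      (fun t ht => by have := hpos t ht; positivity) huF
    have hu'u' : ∀ᵐ t ∂volume.restrict I, ‖u' t - u t‖ ≤ 1 / 2 ^ n * (k t * ε t) := by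
      filter_upwards [hu'u] with t ht
      refine ht.trans_eq ?_
      ring
    obtain ⟨y', hy', hy'y⟩ := h.exists_curve_of_norm_sub_le hu hu' hy hkε htail h2.le hu'u'
    have hy'z : ∀ t ∈ I, ‖y' t - z t‖ ≤ ε t * (1 / 2 - 1 / 4 / 2 ^ (n + 1)) := fun t ht => by
      have h3 := norm_sub_le_norm_sub_add_norm_sub (y' t) (y t) (z t)
      have h4 := hy'y t ht
      have h5 := hyz t ht
      have h6 : ε t * (1 / 2 - 1 / 4 / 2 ^ (n + 1)) =
        ε t * (1 / 2 - 1 / 4 / 2 ^ n) + 2 * (1 / 2 ^ n * (ε t / 16)) := by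
        rw [pow_succ]; ring
      have h7 : 0 < 1 / 2 ^ n * (ε t / 16) := by have := hε0 t ht; positivity
      dsimp only at h5
      linarith
    refine ⟨⟨y', u'⟩, ⟨hu', hy', hy'z, ?_⟩, fun t ht => (hy'y t ht).trans_eq (by ring),
      hu'u'.mono fun t ht => ht.trans_eq (by ring)⟩
    filter_upwards [hLip, hu'F, ae_restrict_mem h.measurableSet] with t hL ht htI
    have hball : ∀ m : ℕ, ∀ x, ‖x - z t‖ ≤ ε t * (1 / 2 - 1 / 4 / 2 ^ m) →
        x ∈ Metric.closedBall (z t) 1 := fun m x hx => by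
      rw [mem_closedBall_iff_norm]
      have h3 : (0 : ℝ) < 1 / 4 / 2 ^ m := by positivity
      nlinarith [hε0 t htI, hε1 t htI]
    have h3 := hL (y' t) (hball _ _ (hy'z t htI)) (y t) (hball _ _ (hyz t htI)) (u' t)
    have h4 : k t * ‖y' t - y t‖ ≤ k t * (1 / 2 ^ n * (ε t / 16)) :=
      mul_le_mul_of_nonneg_left (hy'y t htI) (hk0 t).le
    have h5 : 0 < k t * ε t * (1 / 2 ^ n) := mul_pos (hpos t htI) h2
    have h6 : k t * (1 / 2 ^ n * (ε t / 16)) = k t * ε t * (1 / 2 ^ n) / 16 := by ring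
    have h7 : k t * ε t / 2 / 2 ^ n / 4 = k t * ε t * (1 / 2 ^ n) / 8 := by ring
    have h8 : k t * ε t / 2 / 2 ^ (n + 1) = k t * ε t * (1 / 2 ^ n) / 4 := by
      rw [pow_succ]; ring
    rw [h8]
    linarith
  have hInv₀ : Inv 0 (y₀, u₀) := by
    refine ⟨hu₀, hy₀, fun t ht => (hy₀z t ht).trans_eq (by norm_num; ring), ?_⟩
    simpa using hu₀F
  choose! succ hnext hnexty hnextu using hstep
  let p : ℕ → (ℝ → X) × (ℝ → X) := fun n => Nat.rec (y₀, u₀) succ n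
  have hp : ∀ n, Inv n (p n) := fun n => by
    induction n with
    | zero => exact hInv₀
    | succ n ih => exact hnext n _ ih
  have hpy : ∀ t ∈ I, ∀ n, dist ((p n).1 t) ((p (n + 1)).1 t) ≤ ε t / 8 / 2 / 2 ^ n :=
    fun t ht n => by
      rw [dist_comm, dist_eq_norm]
      exact (hnexty n _ (hp n) t ht).trans_eq (by ring)
  have hpu : ∀ᵐ t ∂volume.restrict I, ∀ n,
      dist ((p n).2 t) ((p (n + 1)).2 t) ≤ 2 * (k t * ε t) / 2 / 2 ^ n := by
    refine ae_all_iff.2 fun n => ?_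
    filter_upwards [hnextu n _ (hp n)] with t ht
    rw [dist_comm, dist_eq_norm]
    exact ht.trans_eq (by ring)
  let y : ℝ → X := fun t => limUnder atTop fun n => (p n).1 t
  let u : ℝ → X := fun t => limUnder atTop fun n => (p n).2 t
  have hy : ∀ t ∈ I, Tendsto (fun n => (p n).1 t) atTop (𝓝 (y t)) := fun t ht =>
    (cauchySeq_of_le_geometric_two (hpy t ht)).tendsto_limUnder
  have hu : ∀ᵐ t ∂volume.restrict I, Tendsto (fun n => (p n).2 t) atTop (𝓝 (u t)) := by
    filter_upwards [hpu] with t ht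
    exact (cauchySeq_of_le_geometric_two ht).tendsto_limUnder
  have hud : ∀ᵐ t ∂volume.restrict I, ∀ n,
      dist ((p n).2 t) (u t) ≤ 2 * (k t * ε t) / 2 ^ n := by
    filter_upwards [hpu, hu] with t ht htu n
    exact dist_le_of_le_geometric_two_of_tendsto ht htu n
  have hum : AEStronglyMeasurable u (volume.restrict I) :=
    aestronglyMeasurable_of_tendsto_ae atTop (fun n => h.aestronglyMeasurable (hp n).1) hu
  have hui : ∀ t ∈ I, IntegrableOn u (Icc 0 t) := by
    refine h.locallyIntegrable_of_norm_sub_le hu₀ hum (hkε.const_mul 2) ?_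
    filter_upwards [hud] with t ht
    have := ht 0
    rwa [dist_comm, dist_eq_norm, pow_zero, div_one] at this
  have hyz : ∀ t ∈ I, ‖y t - z t‖ ≤ ε t := fun t ht => by
    refine le_of_tendsto' ((hy t ht).sub_const (z t)).norm fun n => ((hp n).2.2.1 t ht).trans ?_
    have h3 : (0 : ℝ) < 1 / 4 / 2 ^ n := by positivity
    nlinarith [hε0 t ht]
  refine ⟨y, u, hui, fun t ht => ?_, ?_, hyz⟩
  · have hInt : Tendsto (fun n => ∫ s in (0 : ℝ)..t, (p n).2 s) atTop
        (𝓝 (∫ s in (0 : ℝ)..t, u s)) := by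
      have hsub : uIoc 0 t ⊆ I := by
        rw [uIoc_of_le (h.nonneg ht)]
        exact Ioc_subset_Icc_self.trans (h.Icc_subset ht)
      refine intervalIntegral.tendsto_integral_filter_of_dominated_convergence
        (fun s => ‖u s‖ + 2 * (k s * ε s)) (Eventually.of_forall fun n =>
          (h.aestronglyMeasurable (hp n).1).mono_measure (Measure.restrict_mono hsub le_rfl))
        (Eventually.of_forall fun n => ?_) ?_ ?_
      · rw [← ae_restrict_iff' measurableSet_uIoc]
        filter_upwards [ae_restrict_of_ae_restrict_of_subset hsub hud,
          ae_restrict_mem measurableSet_uIoc] with s hs hsI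
        have h3 := norm_le_insert' ((p n).2 s) (u s)
        rw [← dist_eq_norm] at h3
        have h4 : 2 * (k s * ε s) / 2 ^ n ≤ 2 * (k s * ε s) :=
          div_le_self (by linarith [hpos s (hsub hsI)]) (one_le_pow₀ one_le_two)
        linarith [hs n]
      · refine (h.intervalIntegrable hui h.zero_mem ht).norm.add ?_
        exact h.intervalIntegrable
          (fun t ht => IntegrableOn.mono_set (hkε.const_mul 2) (h.Icc_subset ht)) h.zero_mem ht
      · rw [← ae_restrict_iff' measurableSet_uIoc]
        exact ae_restrict_of_ae_restrict_of_subset hsub hu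
    refine tendsto_nhds_unique (hy t ht) (((hy 0 h.zero_mem).add hInt).congr fun n => ?_)
    exact ((hp n).2.1 t ht).symm
  · filter_upwards [hLip, hu, ae_all_iff.2 fun n => (hp n).2.2.2,
      ae_restrict_mem h.measurableSet] with t hL htu htF htI
    refine ((hFcl t htI (y t)).mem_iff_infDist_zero (hFne t htI (y t))).2
      (le_antisymm ?_ Metric.infDist_nonneg)
    have hball : ∀ x, ‖x - z t‖ ≤ ε t → x ∈ Metric.closedBall (z t) 1 := fun x hx =>
      mem_closedBall_iff_norm.2 (hx.trans (hε1 t htI))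
    have hlim : Tendsto (fun n : ℕ => k t * ε t / 2 / 2 ^ n + k t * ‖y t - (p n).1 t‖ +
        dist (u t) ((p n).2 t)) atTop (𝓝 (0 + k t * ‖y t - y t‖ + dist (u t) (u t))) := by
      refine ((tendsto_const_nhds.div_atTop
        (tendsto_pow_atTop_atTop_of_one_lt one_lt_two)).add ?_).add ?_
      · exact ((hy t htI).const_sub (y t)).norm.const_mul (k t)
      · exact tendsto_const_nhds.dist htu
    simp only [sub_self, norm_zero, mul_zero, add_zero, dist_self] at hlim
    refine ge_of_tendsto' hlim fun n => ?_
    have h3 := hL (y t) (hball _ (hyz t htI)) ((p n).1 t) (hball _ (by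
      refine ((hp n).2.2.1 t htI).trans ?_
      have h3 : (0 : ℝ) < 1 / 4 / 2 ^ n := by positivity
      nlinarith [hε0 t htI])) ((p n).2 t)
    have h4 := Metric.infDist_le_infDist_add_dist (s := F t (y t)) (x := u t) (y := (p n).2 t)
    linarith [htF n]

end Exhausts

end Relaxation

/-- **Infinite-time relaxation theorem** (Theorem 3.1 of the paper).
`X` is a separable Banach space, `0 < T ≤ ∞` and the interval `[0,T)` is encoded as
`Iv = {t : ℝ | 0 ≤ t ∧ ENNReal.ofReal t < T}`.  `F` has nonempty closed values and
satisfies (H1') measurability with respect to the product of the Lebesgue σ-algebra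
(the σ-algebra of null-measurable sets for `volume`) on `[0,T)` with the Borel
σ-algebra of `X`; (H2') a local (in space) Lipschitz estimate in Hausdorff distance
with locally integrable modulus; (H3') a local boundedness estimate with locally
integrable bound.  If `z` is a solution of the relaxed inclusion
`ż(t) ∈ clco F(t, z(t))`, `z(0) = ξ`, and `r` is a continuous strictly positive
function on `[0,T)`, then there are `η₀` with `‖η₀ - ξ‖ ≤ r 0` and a solution `γ` of
`γ̇(t) ∈ F(t, γ(t))`, `γ(0) = η₀`, with `‖z t - γ t‖ ≤ r t` for all `t ∈ [0,T)`.
(A solution on `[0,T)` is an absolutely continuous function, i.e. the indefinite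
Bochner integral of a locally integrable `v`, with `v t` in the right-hand side for
almost every `t ∈ [0,T)`.) -/
theorem infinite_time_relaxation
    {X : Type*} [NormedAddCommGroup X] [NormedSpace ℝ X] [CompleteSpace X]
    [MeasurableSpace X] [BorelSpace X] [TopologicalSpace.SeparableSpace X]
    (T : ℝ≥0∞) (hT : 0 < T)
    (Iv : Set ℝ) (hIv : Iv = {t : ℝ | 0 ≤ t ∧ ENNReal.ofReal t < T})
    (F : ℝ → X → Set X)
    (hFne : ∀ t ∈ Iv, ∀ ξ : X, (F t ξ).Nonempty)
    (hFcl : ∀ t ∈ Iv, ∀ ξ : X, IsClosed (F t ξ))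
    -- (H1'): measurability w.r.t. Lebesgue ⊗ Borel
    (H1 : ∀ U : Set X, IsOpen U →
      MeasurableSet[MeasurableSpace.prod
          (inferInstanceAs (MeasurableSpace (NullMeasurableSpace ℝ volume)))
          (inferInstance : MeasurableSpace X)]
        {p : ℝ × X | p.1 ∈ Iv ∧ (F p.1 p.2 ∩ U).Nonempty})
    -- (H2'): local Lipschitz condition with locally integrable modulus
    (H2 : ∀ R : ℝ, 0 < R → ∃ k : ℝ → ℝ,
      (∀ t ∈ Iv, IntegrableOn k (Icc (0:ℝ) t)) ∧
      (∀ᵐ t ∂(volume.restrict Iv), ∀ ξ ∈ Metric.closedBall (0:X) R,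
        ∀ η ∈ Metric.closedBall (0:X) R,
          Metric.hausdorffDist (F t ξ) (F t η) ≤ k t * ‖ξ - η‖))
    -- (H3'): local boundedness condition with locally integrable bound
    (H3 : ∀ R : ℝ, 0 < R → ∃ α : ℝ → ℝ,
      (∀ t ∈ Iv, IntegrableOn α (Icc (0:ℝ) t)) ∧
      (∀ᵐ t ∂(volume.restrict Iv), ∀ ξ ∈ Metric.closedBall (0:X) R,
        ∀ ζ ∈ F t ξ, ‖ζ‖ ≤ α t))
    -- `z` is a solution of the relaxed inclusion with `z 0 = ξ`
    (ξ : X) (z : ℝ → X) (hz0 : z 0 = ξ)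
    (hz : ∃ v : ℝ → X,
      (∀ t ∈ Iv, IntegrableOn v (Icc (0:ℝ) t)) ∧
      (∀ t ∈ Iv, z t = z 0 + ∫ s in (0:ℝ)..t, v s) ∧
      (∀ᵐ t ∂(volume.restrict Iv), v t ∈ closure (convexHull ℝ (F t (z t)))))
    -- a continuous strictly positive error function
    (r : ℝ → ℝ) (hrc : ContinuousOn r Iv) (hrpos : ∀ t ∈ Iv, 0 < r t) :
    ∃ (η₀ : X) (γ : ℝ → X), ‖η₀ - ξ‖ ≤ r 0 ∧ γ 0 = η₀ ∧
      (∃ v : ℝ → X,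
        (∀ t ∈ Iv, IntegrableOn v (Icc (0:ℝ) t)) ∧
        (∀ t ∈ Iv, γ t = γ 0 + ∫ s in (0:ℝ)..t, v s) ∧
        (∀ᵐ t ∂(volume.restrict Iv), v t ∈ F t (γ t))) ∧
      (∀ t ∈ Iv, ‖z t - γ t‖ ≤ r t) := by
  obtain ⟨τ, h⟩ := exists_exhausts hT
  rw [← hIv] at h
  obtain ⟨v, hv, hzv, hvF⟩ := hz
  have hzc : ContinuousOn z Iv :=
    (continuousOn_const.add (h.continuousOn_primitive hv)).congr hzv
  have hbound : ∀ i, ∃ R : ℝ, 0 < R ∧ ∀ t ∈ Ico (τ i) (τ (i + 1)),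
      Metric.closedBall (z t) 1 ⊆ Metric.closedBall 0 R := fun i => by
    obtain ⟨C, hC⟩ := isCompact_Icc.exists_bound_of_continuousOn
      (hzc.mono (h.Icc_subset (h.mem (i + 1))))
    refine ⟨max C 0 + 1, by positivity, fun t ht => Metric.closedBall_subset_closedBall' ?_⟩
    rw [dist_zero_right]
    linarith [le_max_left C 0, hC t ⟨h.nonneg (h.Ico_subset i ht), ht.2.le⟩]
  choose R hR0 hR using hbound
  obtain ⟨k₀, hk₀, hk₀F⟩ := h.exists_glue (P := fun i t a =>
    ∀ x ∈ Metric.closedBall (0 : X) (R i), ∀ y ∈ Metric.closedBall (0 : X) (R i),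
      Metric.hausdorffDist (F t x) (F t y) ≤ a * ‖x - y‖) fun i => H2 (R i) (hR0 i)
  obtain ⟨α, hα, hαF⟩ := h.exists_glue (P := fun i t a =>
    ∀ x ∈ Metric.closedBall (0 : X) (R i), ∀ ζ ∈ F t x, ‖ζ‖ ≤ a) fun i => H3 (R i) (hR0 i)
  have hFα : ∀ᵐ t ∂volume.restrict Iv, ∀ x ∈ Metric.closedBall (z t) 1, ∀ ζ ∈ F t x,
      ‖ζ‖ ≤ α t := by
    filter_upwards [hαF] with t ⟨i, hti, ht⟩ x hx
    exact ht x (hR i t hti hx)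
  let k : ℝ → ℝ := fun t => max (k₀ t) 0 + 1
  have hk0 : ∀ t, 0 < k t := fun t => by positivity
  have hk : ∀ t ∈ Iv, IntegrableOn k (Icc 0 t) := fun t ht =>
    (hk₀ t ht).pos_part.add (integrableOn_const (by simp))
  have hLip : ∀ᵐ t ∂volume.restrict Iv, ∀ x ∈ Metric.closedBall (z t) 1,
      ∀ x' ∈ Metric.closedBall (z t) 1, ∀ ζ,
        Metric.infDist ζ (F t x) ≤ Metric.infDist ζ (F t x') + k t * ‖x - x'‖ := by
    filter_upwards [hk₀F, hFα, ae_restrict_mem h.measurableSet]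
      with t ⟨i, hti, ht⟩ hFt htI x hx x' hx' ζ
    have hbdd : ∀ x ∈ Metric.closedBall (z t) 1, Bornology.IsBounded (F t x) := fun x hx =>
      isBounded_iff_forall_norm_le.2 ⟨α t, hFt x hx⟩
    have h1 := Metric.infDist_le_infDist_add_hausdorffDist (x := ζ)
      (Metric.hausdorffEDist_ne_top_of_nonempty_of_bounded (hFne t htI x') (hFne t htI x)
        (hbdd x' hx') (hbdd x hx))
    have h2 := ht x' (hR i t hti hx') x (hR i t hti hx)
    have h3 : k₀ t * ‖x' - x‖ ≤ k t * ‖x - x'‖ := by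
      rw [norm_sub_rev]
      refine mul_le_mul_of_nonneg_right ?_ (norm_nonneg _)
      linarith [le_max_left (k₀ t) 0]
    linarith
  obtain ⟨ε, hε0, hερ, hεanti, hkε, htail⟩ := h.exists_weight hk (fun t => (hk0 t).le)
    (ρ := fun t => min (r t) 1) (hrc.inf continuousOn_const)
    (fun t ht => lt_min (hrpos t ht) one_pos) (c := 16) (by norm_num)
  have hε1 : ∀ t ∈ Iv, ε t ≤ 1 := fun t ht => (hερ t ht).trans (min_le_right _ _)
  have hFm : ∀ y : ℝ → X, ContinuousOn y Iv → ∀ x,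
      AEMeasurable (fun t => Metric.infDist x (F t (y t))) (volume.restrict Iv) := fun y hy x =>
    aemeasurable_infDist_comp h.measurableSet hFne H1 (hy.aemeasurable h.measurableSet) x
  have hpos : ∀ t ∈ Iv, 0 < k t * ε t := fun t ht => mul_pos (hk0 t) (hε0 t ht)
  obtain ⟨w, q, hw, hq, hwF, hqv, hwq⟩ := h.exists_chattering
    (fun t ht => hFne t ht (z t)) (hFm z hzc) hα
    (hFα.mono fun t ht => ht (z t) (Metric.mem_closedBall_self zero_le_one)) hv hvF
    (η := fun t => 1 / 4 * (k t * ε t)) (ε := fun t => ε t / 8)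
    (fun t ht => by have := hpos t ht; positivity) (hkε.const_mul _)
    (fun t ht => by have := hε0 t ht; positivity)
    (fun s hs t ht hst => by have := hεanti hs ht hst; dsimp only; linarith)
  obtain ⟨p, hp, hpz⟩ := h.exists_curve_of_norm_sub_le hv hq hzv hkε htail (by norm_num) hqv
  let y₀ : ℝ → X := fun t => p t + ∫ s in (0 : ℝ)..t, (w s - q s)
  have hy₀ : ∀ t ∈ Iv, y₀ t = y₀ 0 + ∫ s in (0 : ℝ)..t, w s := fun t ht => by
    simp only [y₀, intervalIntegral.integral_same, hp t ht, intervalIntegral.integral_sub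
      (h.intervalIntegrable hw h.zero_mem ht) (h.intervalIntegrable hq h.zero_mem ht)]
    abel
  have hy₀z : ∀ t ∈ Iv, ‖y₀ t - z t‖ ≤ ε t / 4 := fun t ht => by
    have h1 : y₀ t - z t = (p t - z t) + ∫ s in (0 : ℝ)..t, (w s - q s) := by
      simp only [y₀]
      abel
    rw [h1]
    linarith [norm_add_le (p t - z t) (∫ s in (0 : ℝ)..t, (w s - q s)), hpz t ht, hwq t ht,
      hε0 t ht]
  obtain ⟨γ, u, hu, hγ, huF, hγz⟩ := h.exists_solution_near hFne hFcl hFm hk0 hε0 hε1 hkε htail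
    hLip hw hy₀ hy₀z (by
      filter_upwards [hLip, hwF, ae_restrict_mem h.measurableSet] with t hL ht htI
      have h1 := hL (y₀ t) (mem_closedBall_iff_norm.2
        (by linarith [hy₀z t htI, hε1 t htI, hε0 t htI])) (z t)
        (Metric.mem_closedBall_self zero_le_one) (w t)
      have h2 : k t * ‖y₀ t - z t‖ ≤ k t * (ε t / 4) :=
        mul_le_mul_of_nonneg_left (hy₀z t htI) (hk0 t).le
      linarith)
  have hclose : ∀ t ∈ Iv, ‖γ t - z t‖ ≤ r t := fun t ht =>
    ((hγz t ht).trans (hερ t ht)).trans (min_le_left _ _)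
  exact ⟨γ 0, γ, hz0 ▸ hclose 0 h.zero_mem, rfl, ⟨u, hu, hγ, huF⟩, fun t ht =>
    norm_sub_rev (γ t) (z t) ▸ hclose t ht⟩
end

section
/- Let X be a separable Banach space, T > 0, ξ₀ ∈ X, and let F : [0,T] × X → P(X) be a set-valued map with nonempty closed values. Suppose z : [0,T] → X is a solution of the initial value problem ẋ(t) ∈ clco F(t, x(t)), x(0) = ξ₀, let ε > 0, and let T_tube := {ξ ∈ X : |ξ − z(t)| ≤ ε for some t ∈ [0,T]} be the ε-tube around the image of z. Assume: (H1) F is L[0,T] ⊗ B(X) measurable; (H2) there exists an integrable k₀ : [0,T] → ℝ such that d_H(F(t,ξ), F(t,η)) ≤ k₀(t)|ξ − η| for all ξ, η ∈ B(T_tube, 1) and almost every t ∈ [0,T]; (H3) there exists an integrable α : [0,T] → ℝ such that sup{|ζ| : ζ ∈ F(t,ξ)} ≤ α(t) for each ξ ∈ B(T_tube, 1) and almost every t ∈ [0,T]. Then there exist δ > 0 and a map x : [0,T] × V → X, where V := B(ξ₀, δ), such that: (a) for every η ∈ V, the function t ↦ x(t,η) is a solution on [0,T] of the initial value problem ẋ(t)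 ∈ F(t, x(t)), x(0) = η; (b) the map η ↦ x(·,η) is continuous from V into the Banach space AC([0,T], X) of absolutely continuous functions with norm ‖u‖_{AC} = |u(0)| + ∫₀^T |u̇(t)| dt; (c) for each η ∈ V, |z(t) − x(t,η)| < ε for all t ∈ [0,T]. -/
section Auxiliary

open MeasureTheory Set Filter Topology

/-- A Gronwall weight `E` for an integrable rate `k`: the Volterra operator
`g ↦ ∫ k g` contracts by `1/2` in the norm weighted by `E`. -/
theorem exists_gronwall_weight {T : ℝ} (hT : 0 < T) {k : ℝ → ℝ}
    (hk : IntegrableOn k (Icc 0 T)) (hk0 : ∀ t, 0 ≤ k t) :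
    ∃ E : ℝ → ℝ, (∀ t ∈ Icc 0 T, 1 ≤ E t) ∧ (∀ t ∈ Icc 0 T, E t ≤ E T) ∧
      IntegrableOn (fun t ↦ k t * E t) (Icc 0 T) ∧
      ∀ t ∈ Icc 0 T, ∫ s in (0 : ℝ)..t, k s * E s ≤ E t / 2 := by
  have hki : IntervalIntegrable k volume 0 T :=
    (intervalIntegrable_iff_integrableOn_Icc_of_le hT.le).2 hk
  set K : ℝ → ℝ := fun t ↦ ∫ s in (0 : ℝ)..t, k s with hK
  have hsub : ∀ {a b}, a ∈ Icc 0 T → b ∈ Icc 0 T → IntervalIntegrable k volume a b := by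
    intro a b ha hb
    refine hki.mono_set ?_
    rw [uIcc_of_le hT.le]
    exact uIcc_subset_Icc ha hb
  have h0 : (0 : ℝ) ∈ Icc 0 T := ⟨le_rfl, hT.le⟩
  have hKmono : MonotoneOn K (Icc 0 T) := by
    intro a ha b hb hab
    have := intervalIntegral.integral_interval_sub_left (hsub h0 hb) (hsub h0 ha)
    have h2 : 0 ≤ ∫ s in a..b, k s :=
      intervalIntegral.integral_nonneg hab (fun _ _ ↦ hk0 _)
    simp only [hK]
    linarith
  have hEmono : MonotoneOn (fun t ↦ Real.exp (2 * K t)) (Icc 0 T) := by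
    intro a ha b hb hab
    have := hKmono ha hb hab
    simp only
    gcongr
  have hKcont : ContinuousOn K (Icc 0 T) := by
    have := intervalIntegral.continuousOn_primitive_interval (μ := volume) (f := k) (a := 0)
      (b := T) (by rwa [uIcc_of_le hT.le])
    rwa [uIcc_of_le hT.le] at this
  have hK0 : K 0 = 0 := by simp [hK]
  refine ⟨fun t ↦ Real.exp (2 * K t), fun t ht ↦ ?_, fun t ht ↦ ?_, ?_, fun t ht ↦ ?_⟩
  · have := hKmono h0 ht ht.1
    rw [hK0] at this
    exact Real.one_le_exp (by linarith)
  · exact hEmono ht ⟨hT.le, le_rfl⟩ ht.2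
  · exact hk.mul_continuousOn (by fun_prop) isCompact_Icc
  · have hm : MonotoneOn (fun t ↦ Real.exp (2 * K t)) (uIcc 0 t) := by
      rw [uIcc_of_le ht.1]
      exact hEmono.mono (Icc_subset_Icc_right ht.2)
    have h1 := hm.intervalIntegral_deriv_mem_uIcc
    have hle : Real.exp (2 * K 0) ≤ Real.exp (2 * K t) := hEmono h0 ht ht.1
    rw [uIcc_of_le (by linarith)] at h1
    have h2 : ∫ s in (0 : ℝ)..t, deriv (fun t ↦ Real.exp (2 * K t)) s
        = ∫ s in (0 : ℝ)..t, 2 * (k s * Real.exp (2 * K s)) := by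
      apply intervalIntegral.integral_congr_ae
      filter_upwards [hki.ae_hasDerivAt_integral] with s hs hs2
      rw [uIoc_of_le ht.1] at hs2
      have h3 : HasDerivAt K (k s) s := hs (by
        rw [uIcc_of_le hT.le]; exact ⟨hs2.1.le, hs2.2.trans ht.2⟩) 0 (by simp)
      rw [((h3.const_mul 2).exp).deriv]
      ring
    rw [h2, intervalIntegral.integral_const_mul] at h1
    have := h1.2
    have := Real.exp_pos (2 * K 0)
    linarith

section Selection

variable {Ω : Type*} [MeasurableSpace Ω] {μ : Measure Ω}
  {X : Type*} [NormedAddCommGroup X] [TopologicalSpace.SeparableSpace X]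

theorem exists_measurable_nat_selection {p : ℕ → Ω → Prop}
    (hp : ∀ n, NullMeasurableSet {t | p n t} μ) (hex : ∀ᵐ t ∂μ, ∃ n, p n t) :
    ∃ m : Ω → ℕ, Measurable m ∧ ∀ᵐ t ∂μ, p (m t) t := by
  classical
  choose A hA hAp using fun n ↦ (hp n)
  have hq : ∀ t, ∃ n, t ∈ A n ∨ t ∉ ⋃ i, A i := by
    intro t
    by_cases h : t ∈ ⋃ i, A i
    · obtain ⟨n, hn⟩ := mem_iUnion.1 h
      exact ⟨n, Or.inl hn⟩
    · exact ⟨0, Or.inr h⟩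
  refine ⟨fun t ↦ Nat.find (hq t), measurable_find hq fun n ↦ ?_, ?_⟩
  · exact (hA n).union (MeasurableSet.iUnion hA).compl
  · have hall : ∀ᵐ t ∂μ, ∀ n, (p n t ↔ t ∈ A n) := by
      rw [ae_all_iff]
      intro n
      filter_upwards [hAp n] with t ht
      exact Iff.of_eq ht
    filter_upwards [hex, hall] with t ⟨n, hn⟩ ht
    rcases Nat.find_spec (hq t) with h | h
    · exact (ht _).2 h
    · exact absurd (mem_iUnion.2 ⟨n, (ht n).1 hn⟩) h

theorem aemeasurable_infDist_of_forall_const {Γ : Ω → Set X}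
    (hΓ : ∀ u, AEMeasurable (fun t ↦ Metric.infDist u (Γ t)) μ) {v : Ω → X}
    (hv : AEStronglyMeasurable v μ) :
    AEMeasurable (fun t ↦ Metric.infDist (v t) (Γ t)) μ := by
  let u := TopologicalSpace.denseSeq X
  have h : (fun t ↦ Metric.infDist (v t) (Γ t))
      = fun t ↦ ⨅ j, (‖v t - u j‖ + Metric.infDist (u j) (Γ t)) := by
    funext t
    have hle : ∀ j, Metric.infDist (v t) (Γ t) ≤ ‖v t - u j‖ + Metric.infDist (u j) (Γ t) := by
      intro j
      rw [← dist_eq_norm, add_comm]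
      exact Metric.infDist_le_infDist_add_dist
    refine le_antisymm (le_ciInf hle) (le_of_forall_pos_le_add fun r hr ↦ ?_)
    obtain ⟨j, hj⟩ := (TopologicalSpace.denseRange_denseSeq X).exists_dist_lt (v t) (half_pos hr)
    refine (ciInf_le ⟨_, forall_mem_range.2 hle⟩ j).trans ?_
    have h1 : Metric.infDist (u j) (Γ t) ≤ Metric.infDist (v t) (Γ t) + dist (u j) (v t) :=
      Metric.infDist_le_infDist_add_dist
    rw [← dist_eq_norm]
    rw [dist_comm] at h1
    change dist (v t) (u j) < _ at hj
    linarith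
  rw [h]
  exact AEMeasurable.iInf fun j ↦
    ((hv.sub aestronglyMeasurable_const).norm.aemeasurable).add (hΓ _)

theorem exists_stronglyMeasurable_near_selection {Γ : Ω → Set X}
    (hΓ : ∀ u, AEMeasurable (fun t ↦ Metric.infDist u (Γ t)) μ)
    (hne : ∀ᵐ t ∂μ, (Γ t).Nonempty) {v : Ω → X}
    (hv : AEStronglyMeasurable v μ) {σ : ℝ} (hσ : 0 < σ) :
    ∃ w : Ω → X, StronglyMeasurable w ∧ ∀ᵐ t ∂μ, Metric.infDist (w t) (Γ t) < σ ∧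
      ‖w t - v t‖ < Metric.infDist (v t) (Γ t) + σ := by
  let u := TopologicalSpace.denseSeq X
  obtain ⟨m, hm, hmp⟩ := exists_measurable_nat_selection (μ := μ)
    (p := fun j t ↦ Metric.infDist (u j) (Γ t) < σ ∧
      ‖u j - v t‖ < Metric.infDist (v t) (Γ t) + σ)
    (fun j ↦ (nullMeasurableSet_lt (hΓ _) aemeasurable_const).inter
      (nullMeasurableSet_lt (aestronglyMeasurable_const.sub hv).norm.aemeasurable
        ((aemeasurable_infDist_of_forall_const hΓ hv).add aemeasurable_const)))
    (by
      filter_upwards [hne] with t ht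
      obtain ⟨y, hy, hvy⟩ := (Metric.infDist_lt_iff ht).1
        (lt_add_of_pos_right (Metric.infDist (v t) (Γ t)) (half_pos hσ))
      obtain ⟨j, hj⟩ := (TopologicalSpace.denseRange_denseSeq X).exists_dist_lt y (half_pos hσ)
      change dist y (u j) < _ at hj
      refine ⟨j, ?_, ?_⟩
      · have := Metric.infDist_le_dist_of_mem (x := u j) hy
        rw [dist_comm] at this
        linarith
      · rw [← dist_eq_norm]
        have := dist_triangle_right (u j) (v t) y
        rw [dist_comm] at hj
        linarith)
  exact ⟨fun t ↦ u (m t), (StronglyMeasurable.of_discrete (f := u)).comp_measurable hm, hmp⟩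

end Selection

/-- Locally in the parameter, `v s t` does not depend on `s` outside a set of times `t` of
arbitrarily small measure. -/
def LocallyConstOffSmall {S Y : Type*} [PseudoMetricSpace S] (μ : Measure ℝ)
    (v : S → ℝ → Y) : Prop :=
  ∀ s, ∀ ω : ENNReal, 0 < ω → ∃ ρ : ℝ, 0 < ρ ∧ ∃ D : Set ℝ, MeasurableSet D ∧ μ D < ω ∧
    ∀ s', dist s' s < ρ → ∀ t ∉ D, v s' t = v s t

theorem tendsto_measure_abs_sub_mul_le_zero (μ : Measure ℝ) [IsFiniteMeasure μ]
    [NullSingletonClass μ] (a : ℝ) {b : ℝ} (hb : 0 < b) :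
    Tendsto (fun n : ℕ ↦ μ {t | |a - (1 + Real.sigmoid t) * b| ≤ 1 / ((n : ℝ) + 1)})
      atTop (𝓝 0) := by
  have hanti : Antitone (fun n : ℕ ↦
      {t : ℝ | |a - (1 + Real.sigmoid t) * b| ≤ 1 / ((n : ℝ) + 1)}) := by
    intro n m hnm t ht
    refine le_trans (α := ℝ) ht ?_
    exact Nat.one_div_le_one_div hnm
  have hmeas : ∀ n : ℕ, NullMeasurableSet
      {t : ℝ | |a - (1 + Real.sigmoid t) * b| ≤ 1 / ((n : ℝ) + 1)} μ := by
    intro n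
    refine (measurableSet_le ?_ measurable_const).nullMeasurableSet
    have := continuous_sigmoid
    fun_prop
  have h := tendsto_measure_iInter_atTop hmeas hanti ⟨0, measure_ne_top μ _⟩
  have h0 : μ (⋂ n : ℕ, {t : ℝ | |a - (1 + Real.sigmoid t) * b| ≤ 1 / ((n : ℝ) + 1)}) = 0 := by
    refine Set.Subsingleton.measure_zero ?_ μ
    have key : ∀ t ∈ (⋂ n : ℕ, {t : ℝ | |a - (1 + Real.sigmoid t) * b| ≤ 1 / ((n : ℝ) + 1)}),
        a - (1 + Real.sigmoid t) * b = 0 := by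
      intro t ht
      have h1 : |a - (1 + Real.sigmoid t) * b| ≤ 0 :=
        ge_of_tendsto' tendsto_one_div_add_atTop_nhds_zero_nat (fun n ↦ mem_iInter.1 ht n)
      exact abs_nonpos_iff.1 h1
    intro t ht t' ht'
    have h1 := key t ht
    have h2 := key t' ht'
    have h3 : Real.sigmoid t * b = Real.sigmoid t' * b := by linarith
    exact Real.sigmoid_injective (mul_right_cancel₀ hb.ne' h3)
  rwa [h0] at h

/-- Random nearest-point rule: a choice, depending on a time parameter, of a point of a dense
sequence at distance at most `2 r s` from `s`, which is locally constant off small sets. -/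
theorem exists_locallyConstOffSmall_index {S : Type*} [MetricSpace S]
    (μ : Measure ℝ) [IsFiniteMeasure μ] [NullSingletonClass μ] {q : ℕ → S} (hq : DenseRange q)
    {r : S → ℝ} (hr : Continuous r) (hr0 : ∀ s, 0 < r s) :
    ∃ idx : S → ℝ → ℕ, (∀ s, Measurable (idx s)) ∧
      (∀ s t, dist s (q (idx s t)) < 2 * r s) ∧ LocallyConstOffSmall μ idx := by
  classical
  have hex0 : ∀ s, ∃ i, dist s (q i) < r s := fun s ↦ hq.exists_dist_lt s (hr0 s)
  have hle : ∀ s t, r s ≤ (1 + Real.sigmoid t) * r s := fun s t ↦ by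
    nlinarith [Real.sigmoid_pos t, hr0 s]
  have hex : ∀ s t, ∃ i, dist s (q i) < (1 + Real.sigmoid t) * r s := by
    intro s t
    obtain ⟨i, hi⟩ := hex0 s
    exact ⟨i, hi.trans_le (hle s t)⟩
  refine ⟨fun s t ↦ Nat.find (hex s t), fun s ↦ measurable_find (hex s) fun i ↦ ?_,
    fun s t ↦ ?_, fun s ω hω ↦ ?_⟩
  · refine measurableSet_lt measurable_const ?_
    have := continuous_sigmoid
    fun_prop
  · have h := Nat.find_spec (hex s t)
    nlinarith [Real.sigmoid_lt_one t, hr0 s]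
  · obtain ⟨m, hm⟩ := hex0 s
    have hsum : Tendsto (fun n : ℕ ↦ ∑ i ∈ Finset.range (m + 1),
        μ {t | |dist s (q i) - (1 + Real.sigmoid t) * r s| ≤ 1 / ((n : ℝ) + 1)}) atTop (𝓝 0) := by
      have := tendsto_finsetSum (Finset.range (m + 1))
        (fun i _ ↦ tendsto_measure_abs_sub_mul_le_zero μ (dist s (q i)) (hr0 s))
      simpa using this
    obtain ⟨n, hn⟩ := ((tendsto_order.1 hsum).2 ω hω).exists
    set h : ℝ := 1 / ((n : ℝ) + 1) with hh
    have hhpos : 0 < h := by positivity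
    have hev : ∀ᶠ s' in 𝓝 s, |r s' - r s| < h / 4 ∧ dist s' s < h / 2 ∧ dist s' (q m) < r s' := by
      refine (?_ : ∀ᶠ s' in 𝓝 s, |r s' - r s| < h / 4).and
        ((?_ : ∀ᶠ s' in 𝓝 s, dist s' s < h / 2).and ?_)
      · have := (Metric.tendsto_nhds.1 (hr.tendsto s)) (h / 4) (by positivity)
        simpa [Real.dist_eq] using this
      · exact Metric.ball_mem_nhds s (half_pos hhpos)
      · exact (continuous_id.dist continuous_const).continuousAt.eventually_lt hr.continuousAt hm
    obtain ⟨ρ, hρ, hball⟩ := Metric.eventually_nhds_iff.1 hev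
    refine ⟨ρ, hρ, ⋃ i ∈ Finset.range (m + 1),
      {t | |dist s (q i) - (1 + Real.sigmoid t) * r s| ≤ h}, ?_, ?_, ?_⟩
    · refine Finset.measurableSet_biUnion _ fun i _ ↦ measurableSet_le ?_ measurable_const
      have := continuous_sigmoid
      fun_prop
    · exact (measure_biUnion_finset_le _ _).trans_lt hn
    · intro s' hs' t ht
      obtain ⟨h1, h2, h3⟩ := hball hs'
      have hiff : ∀ i ≤ m, (dist s' (q i) < (1 + Real.sigmoid t) * r s' ↔
          dist s (q i) < (1 + Real.sigmoid t) * r s) := by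
        intro i hi
        have hti : h < |dist s (q i) - (1 + Real.sigmoid t) * r s| := by
          by_contra hcon
          exact ht (mem_biUnion (Finset.mem_range.2 (by omega)) (not_lt.1 hcon))
        have hd : |dist s' (q i) - dist s (q i)| ≤ dist s' s := abs_dist_sub_le _ _ _
        have hθ1 := Real.sigmoid_pos t
        have hθ2 := Real.sigmoid_lt_one t
        have hdr : |(1 + Real.sigmoid t) * r s' - (1 + Real.sigmoid t) * r s| ≤ h / 2 := by
          rw [← mul_sub, abs_mul, abs_of_pos (by linarith)]
          nlinarith [abs_nonneg (r s' - r s)]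
        rw [abs_le] at hd hdr
        rcases lt_abs.1 hti with h4 | h4 <;> constructor <;> intro h5 <;> linarith
      have ha : Nat.find (hex s t) ≤ m := Nat.find_min' _ (hm.trans_le (hle s t))
      have hb : Nat.find (hex s' t) ≤ m := Nat.find_min' _ (h3.trans_le (hle s' t))
      refine le_antisymm (Nat.find_min' _ ?_) (Nat.find_min' _ ?_)
      · exact (hiff _ ha).2 (Nat.find_spec (hex s t))
      · exact (hiff _ hb).1 (Nat.find_spec (hex s' t))

theorem LocallyConstOffSmall.exists_continuous_radius {S Y : Type*} [MetricSpace S]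
    {μ : Measure ℝ} {v : S → ℝ → Y} (hv : LocallyConstOffSmall μ v) {ω : ENNReal} (hω : 0 < ω)
    {σ : ℝ} (hσ : 0 < σ) :
    ∃ r : S → ℝ, Continuous r ∧ (∀ s, 0 < r s) ∧ ∀ s, 2 * r s ≤ σ ∧
      ∃ D : Set ℝ, MeasurableSet D ∧ μ D < ω ∧
        ∀ s', dist s' s < 2 * r s → ∀ t ∉ D, v s' t = v s t := by
  let A : S → Set ℝ := fun s ↦ {ρ | 0 < ρ ∧ 2 * ρ ≤ σ ∧ ∃ D : Set ℝ, MeasurableSet D ∧ μ D < ω ∧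
        ∀ s', dist s' s < 2 * ρ → ∀ t ∉ D, v s' t = v s t}
  have hconv : ∀ s, Convex ℝ (A s) := by
    refine fun s ↦ Set.OrdConnected.convex ⟨fun a ha b hb c hc ↦ ⟨ha.1.trans_le hc.1, ?_, ?_⟩⟩
    · linarith [hb.2.1, hc.2]
    · obtain ⟨D, hD, hDω, hDv⟩ := hb.2.2
      exact ⟨D, hD, hDω, fun s' hs' ↦ hDv s' (by linarith [hc.2])⟩
  have hloc : ∀ s, ∃ c : ℝ, ∀ᶠ y in 𝓝 s, c ∈ A y := by
    intro s
    obtain ⟨ρ, hρ, D, hD, hDω, hDv⟩ := hv s ω hω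
    have hm : 0 < min ρ σ := lt_min hρ hσ
    refine ⟨min ρ σ / 4, ?_⟩
    filter_upwards [Metric.ball_mem_nhds s (half_pos hm)] with s' hs'
    rw [Metric.mem_ball] at hs'
    refine ⟨by positivity, by linarith [min_le_right ρ σ], D, hD, hDω, fun s'' hs'' t ht ↦ ?_⟩
    have h1 := min_le_left ρ σ
    have h2 := dist_triangle s'' s' s
    rw [hDv s'' (by linarith) t ht, hDv s' (by linarith) t ht]
  obtain ⟨r, hr⟩ := exists_continuous_forall_mem_convex_of_local_const hconv hloc
  exact ⟨r, r.continuous, fun s ↦ (hr s).1, fun s ↦ (hr s).2⟩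

theorem stronglyMeasurable_apply_nat_index {Ω X : Type*} [MeasurableSpace Ω]
    [NormedAddCommGroup X] [TopologicalSpace.SeparableSpace X] {w : ℕ → Ω → X}
    (hw : ∀ i, StronglyMeasurable (w i)) {m : Ω → ℕ} (hm : Measurable m) :
    StronglyMeasurable fun t ↦ w (m t) t := by
  borelize X
  have h : Measurable fun p : Ω × ℕ ↦ w p.2 p.1 :=
    measurable_from_prod_countable_left fun i ↦ (hw i).measurable
  exact (h.comp (measurable_id.prodMk hm)).stronglyMeasurable

theorem IntegrableOn.intervalIntegrable_zero {X : Type*} [NormedAddCommGroup X] {T : ℝ}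
    {v : ℝ → X} (hv : IntegrableOn v (Icc 0 T))
    {t : ℝ} (ht : t ∈ Icc 0 T) : IntervalIntegrable v volume 0 t :=
  (intervalIntegrable_iff_integrableOn_Icc_of_le ht.1).2
    (hv.mono_set (Icc_subset_Icc_right ht.2))

section Volterra

variable {X : Type*} [NormedAddCommGroup X] [NormedSpace ℝ X]

/-- The absolutely continuous curve with initial value `ξ` and velocity `v`. -/
noncomputable def curve (ξ : X) (v : ℝ → X) (t : ℝ) : X := ξ + ∫ s in (0 : ℝ)..t, v s

variable {T : ℝ}

theorem ae_Ioc_of_ae_restrict_Icc {p : ℝ → Prop} (hp : ∀ᵐ t ∂(volume.restrict (Icc 0 T)), p t)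
    {t : ℝ} (ht : t ∈ Icc 0 T) : ∀ᵐ s, s ∈ Ioc 0 t → p s := by
  rw [ae_restrict_iff' measurableSet_Icc] at hp
  filter_upwards [hp] with s hs hst
  exact hs ⟨hst.1.le, hst.2.trans ht.2⟩

theorem intervalIntegral_le_setIntegral_Icc {f : ℝ → ℝ} (hf : IntegrableOn f (Icc 0 T))
    (hf0 : ∀ᵐ t ∂(volume.restrict (Icc 0 T)), 0 ≤ f t) {t : ℝ} (ht : t ∈ Icc 0 T) :
    ∫ s in (0 : ℝ)..t, f s ≤ ∫ s in Icc 0 T, f s := by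
  rw [intervalIntegral.integral_of_le ht.1]
  exact setIntegral_mono_set hf hf0
    (LE.le.eventuallyLE (Ioc_subset_Icc_self.trans (Icc_subset_Icc_right ht.2)))

theorem norm_curve_sub_curve_le {ξ ξ' : X} {v v' : ℝ → X} {g : ℝ → ℝ}
    (hv : IntegrableOn v (Icc 0 T)) (hv' : IntegrableOn v' (Icc 0 T))
    (hg : IntegrableOn g (Icc 0 T))
    (h : ∀ᵐ t ∂(volume.restrict (Icc 0 T)), ‖v t - v' t‖ ≤ g t) {t : ℝ} (ht : t ∈ Icc 0 T) :
    ‖curve ξ v t - curve ξ' v' t‖ ≤ ‖ξ - ξ'‖ + ∫ s in (0 : ℝ)..t, g s := by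
  have h1 : curve ξ v t - curve ξ' v' t = (ξ - ξ') + ∫ s in (0 : ℝ)..t, (v s - v' s) := by
    rw [intervalIntegral.integral_sub (IntegrableOn.intervalIntegrable_zero hv ht)
      (IntegrableOn.intervalIntegrable_zero hv' ht)]
    simp only [curve]
    abel
  rw [h1]
  refine (norm_add_le _ _).trans (add_le_add le_rfl ?_)
  exact intervalIntegral.norm_integral_le_of_norm_le ht.1 (ae_Ioc_of_ae_restrict_Icc h ht)
    (IntegrableOn.intervalIntegrable_zero hg ht)

theorem continuousOn_curve (hT : 0 ≤ T) {ξ : X} {v : ℝ → X} (hv : IntegrableOn v (Icc 0 T)) :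
    ContinuousOn (curve ξ v) (Icc 0 T) := by
  have := intervalIntegral.continuousOn_primitive_interval (μ := volume) (f := v) (a := 0)
    (b := T) (by rwa [uIcc_of_le hT])
  rw [uIcc_of_le hT] at this
  exact continuousOn_const.add this

theorem exists_pos_setIntegral_le_of_measure_lt {Ω : Type*} [MeasurableSpace Ω] {μ : Measure Ω}
    {f : Ω → ℝ} (hf : Integrable f μ) (hf0 : ∀ t, 0 ≤ f t) {σ : ℝ} (hσ : 0 < σ) :
    ∃ ω : ENNReal, 0 < ω ∧ ∀ D, μ D < ω → ∫ t in D, f t ∂μ ≤ σ := by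
  obtain ⟨ω, hω, h⟩ := exists_pos_setLIntegral_lt_of_measure_lt
    (μ := μ) (f := fun t ↦ ENNReal.ofReal (f t)) (by
      rw [← ofReal_integral_eq_lintegral_ofReal hf (ae_of_all _ hf0)]; simp)
    (ε := ENNReal.ofReal σ) (by simpa using hσ)
  refine ⟨ω, hω, fun D hD ↦ ?_⟩
  rw [integral_eq_lintegral_of_nonneg_ae (ae_of_all _ hf0) hf.aestronglyMeasurable.restrict]
  exact ENNReal.toReal_le_of_le_ofReal hσ.le (h D hD).le

end Volterra

/-- A set-valued right-hand side on `[0,T]` with nonempty closed values that, for almost every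
time, is globally Lipschitz and bounded with a common integrable rate `k`. -/
structure IsLipschitzInclusion {X : Type*} [NormedAddCommGroup X] (T : ℝ) (G : ℝ → X → Set X)
    (k : ℝ → ℝ) : Prop where
  integrableOn : IntegrableOn k (Icc 0 T)
  one_le : ∀ t, 1 ≤ k t
  nonempty : ∀ᵐ t ∂(volume.restrict (Icc 0 T)), ∀ ξ, (G t ξ).Nonempty
  isClosed : ∀ᵐ t ∂(volume.restrict (Icc 0 T)), ∀ ξ, IsClosed (G t ξ)
  norm_add_one_le : ∀ᵐ t ∂(volume.restrict (Icc 0 T)), ∀ ξ, ∀ u ∈ G t ξ, ‖u‖ + 1 ≤ k t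
  infDist_le : ∀ᵐ t ∂(volume.restrict (Icc 0 T)), ∀ ξ ξ' u,
    Metric.infDist u (G t ξ) ≤ Metric.infDist u (G t ξ') + k t * ‖ξ - ξ'‖
  aemeasurable : ∀ x : ℝ → X, ContinuousOn x (Icc 0 T) → ∀ u,
    AEMeasurable (fun t ↦ Metric.infDist u (G t (x t))) (volume.restrict (Icc 0 T))

/-- A family of velocities `v s` whose curves issuing from `e s` solve the inclusion up to a
defect `c k E`. -/
structure IsApproxSolution {S X : Type*} [PseudoMetricSpace S] [NormedAddCommGroup X]
    [NormedSpace ℝ X] (T : ℝ) (G : ℝ → X → Set X) (k E : ℝ → ℝ) (e : S → X)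
    (v : S → ℝ → X) (c : ℝ) : Prop where
  locallyConst : LocallyConstOffSmall (volume.restrict (Icc 0 T)) v
  aestronglyMeasurable : ∀ s, AEStronglyMeasurable (v s) (volume.restrict (Icc 0 T))
  norm_le : ∀ s, ∀ᵐ t ∂(volume.restrict (Icc 0 T)), ‖v s t‖ ≤ k t
  infDist_le : ∀ s, ∀ᵐ t ∂(volume.restrict (Icc 0 T)),
    Metric.infDist (v s t) (G t (curve (e s) (v s) t)) ≤ c * (k t * E t)

theorem IsLipschitzInclusion.norm_le_of_infDist_lt {X : Type*} [NormedAddCommGroup X]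
    {T : ℝ} {G : ℝ → X → Set X} {k : ℝ → ℝ} (hG : IsLipschitzInclusion T G k) :
    ∀ᵐ t ∂(volume.restrict (Icc 0 T)), ∀ ξ u, Metric.infDist u (G t ξ) < 1 → ‖u‖ ≤ k t := by
  filter_upwards [hG.nonempty, hG.norm_add_one_le] with t hne hb ξ u hu
  obtain ⟨y, hy, huy⟩ := (Metric.infDist_lt_iff (hne ξ)).1 hu
  have h1 := hb ξ y hy
  have h2 := norm_le_norm_add_norm_sub' u y
  rw [dist_eq_norm] at huy
  linarith

section Improvement

variable {S X : Type*} [MetricSpace S] [NormedAddCommGroup X] [NormedSpace ℝ X]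
  {T : ℝ} {G : ℝ → X → Set X} {k E : ℝ → ℝ} {e : S → X} {v : S → ℝ → X} {c : ℝ}

theorem IsApproxSolution.integrableOn (hG : IsLipschitzInclusion T G k)
    (h : IsApproxSolution T G k E e v c) (s : S) : IntegrableOn (v s) (Icc 0 T) :=
  hG.integrableOn.mono' (h.aestronglyMeasurable s) (h.norm_le s)

theorem IsApproxSolution.norm_sub_le_indicator (h : IsApproxSolution T G k E e v c)
    {s s' : S} {D : Set ℝ} (hD : ∀ t ∉ D, v s' t = v s t) :
    ∀ᵐ t ∂(volume.restrict (Icc 0 T)), ‖v s' t - v s t‖ ≤ D.indicator (fun t ↦ 2 * k t) t := by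
  filter_upwards [h.norm_le s, h.norm_le s'] with t h1 h2
  by_cases ht : t ∈ D
  · rw [indicator_of_mem ht]
    linarith [norm_sub_le (v s' t) (v s t)]
  · rw [indicator_of_notMem ht, hD t ht]
    simp

theorem IsApproxSolution.exists_improvement [TopologicalSpace.SeparableSpace S] [Nonempty S]
    [TopologicalSpace.SeparableSpace X]
    (hT : 0 < T) (hG : IsLipschitzInclusion T G k)
    (hE1 : ∀ t ∈ Icc 0 T, 1 ≤ E t)
    (hkE : IntegrableOn (fun t ↦ k t * E t) (Icc 0 T))
    (hE : ∀ t ∈ Icc 0 T, ∫ s in (0 : ℝ)..t, k s * E s ≤ E t / 2)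
    (he : ∀ s s', ‖e s - e s'‖ ≤ dist s s') (hc : 0 < c)
    (h : IsApproxSolution T G k E e v c) :
    ∃ v' : S → ℝ → X, IsApproxSolution T G k E e v' (3 / 4 * c) ∧
      ∀ s, ∫ t in Icc 0 T, ‖v' s t - v s t‖ ≤ c * E T := by
  have hk0 : ∀ t, 0 ≤ k t := fun t ↦ zero_le_one.trans (hG.one_le t)
  set κ : ℝ := ∫ t in Icc 0 T, k t with hκ
  have hκ0 : 0 ≤ κ := integral_nonneg hk0
  obtain ⟨σ, hσ, hσ1, hσc⟩ : ∃ σ : ℝ, 0 < σ ∧ σ < 1 ∧ (3 * κ + 4) * σ ≤ c / 4 := by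
    refine ⟨min (1 / 2) (c / 4 / (3 * κ + 4)), by positivity,
      (min_le_left _ _).trans_lt (by norm_num), ?_⟩
    rw [mul_comm, ← le_div_iff₀ (by positivity)]
    exact min_le_right _ _
  have h2k : IntegrableOn (fun t ↦ 2 * k t) (Icc 0 T) := hG.integrableOn.const_mul 2
  obtain ⟨ω, hω, hωD⟩ := exists_pos_setIntegral_le_of_measure_lt (μ := volume.restrict (Icc 0 T))
    h2k (fun t ↦ by linarith [hk0 t]) hσ
  obtain ⟨r, hrc, hr0, hr⟩ := h.locallyConst.exists_continuous_radius hω hσ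
  choose hrσ D hDm hDω hDv using hr
  let q := TopologicalSpace.denseSeq S
  obtain ⟨idx, hidxm, hidxr, hidxc⟩ := exists_locallyConstOffSmall_index
    (volume.restrict (Icc 0 T)) (TopologicalSpace.denseRange_denseSeq S) hrc hr0
  have hvi := h.integrableOn hG
  have hsel : ∀ i, ∃ w : ℝ → X, StronglyMeasurable w ∧ ∀ᵐ t ∂(volume.restrict (Icc 0 T)),
      Metric.infDist (w t) (G t (curve (e (q i)) (v (q i)) t)) < σ ∧
      ‖w t - v (q i) t‖ <
        Metric.infDist (v (q i) t) (G t (curve (e (q i)) (v (q i)) t)) + σ := by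
    intro i
    refine exists_stronglyMeasurable_near_selection
      (hG.aemeasurable _ (continuousOn_curve hT.le (hvi _))) ?_ (h.aestronglyMeasurable _) hσ
    filter_upwards [hG.nonempty] with t ht using ht _
  choose w hwm hw using hsel
  have hw' := ae_all_iff.2 hw
  set v' : S → ℝ → X := fun s t ↦ w (idx s t) t with hv'
  have hmeas' : ∀ s, AEStronglyMeasurable (v' s) (volume.restrict (Icc 0 T)) :=
    fun s ↦ (stronglyMeasurable_apply_nat_index hwm (hidxm s)).aestronglyMeasurable
  have hnorm' : ∀ s, ∀ᵐ t ∂(volume.restrict (Icc 0 T)), ‖v' s t‖ ≤ k t := by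
    intro s
    filter_upwards [hw', hG.norm_le_of_infDist_lt] with t ht hb
    exact hb _ _ ((ht (idx s t)).1.trans hσ1)
  have hvi' : ∀ s, IntegrableOn (v' s) (Icc 0 T) := fun s ↦
    hG.integrableOn.mono' (hmeas' s) (hnorm' s)
  have hDi : ∀ s, IntegrableOn ((D s).indicator (fun t ↦ 2 * k t)) (Icc 0 T) := fun s ↦
    h2k.indicator (hDm s)
  have hDint : ∀ s, ∀ t ∈ Icc 0 T,
      ∫ τ in (0 : ℝ)..t, (D s).indicator (fun t ↦ 2 * k t) τ ≤ σ := by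
    intro s t ht
    refine (intervalIntegral_le_setIntegral_Icc (hDi s) (ae_of_all _ fun τ ↦
      indicator_nonneg (fun τ _ ↦ by linarith [hk0 τ]) τ) ht).trans ?_
    rw [integral_indicator (hDm s)]
    exact hωD _ (hDω s)
  -- curves of nearby parameters
  have hnear : ∀ s i, dist s (q i) < 2 * r s → ∀ t ∈ Icc 0 T,
      ‖curve (e (q i)) (v (q i)) t - curve (e s) (v s) t‖ ≤ 2 * σ := by
    intro s i hi t ht
    rw [dist_comm] at hi
    have h1 := norm_curve_sub_curve_le (ξ := e (q i)) (ξ' := e s) (hvi (q i)) (hvi s) (hDi s)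
      (h.norm_sub_le_indicator (hDv s (q i) hi)) ht
    linarith [he (q i) s, hrσ s, hDint s t ht]
  -- pointwise bound on the increment
  let g : S → ℝ → ℝ := fun s t ↦
    c * (k t * E t) + 3 * σ * k t + (D s).indicator (fun t ↦ 2 * k t) t
  have hgi : ∀ s, IntegrableOn (g s) (Icc 0 T) := fun s ↦
    ((hkE.const_mul c).add (hG.integrableOn.const_mul (3 * σ))).add (hDi s)
  have hg : ∀ s, ∀ᵐ t ∂(volume.restrict (Icc 0 T)), ‖v' s t - v s t‖ ≤ g s t := by
    intro s
    filter_upwards [hw', hG.infDist_le, h.infDist_le s, hnorm' s, h.norm_le s,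
      ae_restrict_mem measurableSet_Icc] with t ht hLip hdef hn' hn htI
    have hE0 : 0 ≤ c * (k t * E t) :=
      mul_nonneg hc.le (mul_nonneg (hk0 t) (zero_le_one.trans (hE1 t htI)))
    have hσk : 0 ≤ σ * k t := mul_nonneg hσ.le (hk0 t)
    by_cases hD : t ∈ D s
    · simp only [g, indicator_of_mem hD]
      linarith [norm_sub_le (v' s t) (v s t)]
    · simp only [g, indicator_of_notMem hD]
      have hi := hidxr s t
      have h1 := (ht (idx s t)).2
      have h2 := hnear s _ hi t htI
      have h3 := hLip (curve (e (q (idx s t))) (v (q (idx s t))) t) (curve (e s) (v s) t) (v s t)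
      have h4 := mul_le_mul_of_nonneg_left h2 (hk0 t)
      rw [hDv s (q (idx s t)) (by rwa [dist_comm]) t hD] at h1
      have h5 := mul_le_mul_of_nonneg_left (hG.one_le t) hσ.le
      change ‖w (idx s t) t - v s t‖ ≤ _
      linarith
  have hgint : ∀ s, ∀ t ∈ Icc 0 T, ∫ τ in (0 : ℝ)..t, g s τ ≤ c * E t / 2 + (3 * κ + 1) * σ := by
    intro s t ht
    have i1 := (IntegrableOn.intervalIntegrable_zero hkE ht).const_mul c
    have i2 := (IntegrableOn.intervalIntegrable_zero hG.integrableOn ht).const_mul (3 * σ)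
    have i3 := IntegrableOn.intervalIntegrable_zero (hDi s) ht
    have h1 : ∫ τ in (0 : ℝ)..t, g s τ = c * (∫ τ in (0 : ℝ)..t, k τ * E τ)
        + 3 * σ * (∫ τ in (0 : ℝ)..t, k τ)
        + ∫ τ in (0 : ℝ)..t, (D s).indicator (fun t ↦ 2 * k t) τ := by
      rw [← intervalIntegral.integral_const_mul, ← intervalIntegral.integral_const_mul,
        ← intervalIntegral.integral_add i1 i2, ← intervalIntegral.integral_add (i1.add i2) i3]
    have h2 := mul_le_mul_of_nonneg_left (hE t ht) hc.le
    have h3 := mul_le_mul_of_nonneg_left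
      (intervalIntegral_le_setIntegral_Icc hG.integrableOn (ae_of_all _ hk0) ht)
      (by positivity : 0 ≤ 3 * σ)
    rw [h1]
    linarith [hDint s t ht]
  have hTI : T ∈ Icc 0 T := ⟨hT.le, le_rfl⟩
  refine ⟨v', ⟨?_, hmeas', hnorm', ?_⟩, ?_⟩
  · intro s ω' hω'
    obtain ⟨ρ, hρ, D', hD', hD'ω, hD'i⟩ := hidxc s ω' hω'
    refine ⟨ρ, hρ, D', hD', hD'ω, fun s' hs' t ht ↦ ?_⟩
    simp only [hv', hD'i s' hs' t ht]
  · intro s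
    filter_upwards [hw', hG.infDist_le, ae_restrict_mem measurableSet_Icc] with t ht hLip htI
    have h1 := norm_curve_sub_curve_le (ξ := e s) (ξ' := e s) (hvi' s) (hvi s) (hgi s) (hg s) htI
    have h2 := hnear s _ (hidxr s t) t htI
    have h3 := (ht (idx s t)).1
    have h4 := hLip (curve (e s) (v' s) t) (curve (e (q (idx s t))) (v (q (idx s t))) t) (v' s t)
    have h5 := norm_sub_le_norm_sub_add_norm_sub (curve (e s) (v' s) t) (curve (e s) (v s) t)
      (curve (e (q (idx s t))) (v (q (idx s t))) t)
    rw [norm_sub_rev (curve (e s) (v s) t)] at h5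
    rw [sub_self, norm_zero, zero_add] at h1
    have h6 : ‖curve (e s) (v' s) t - curve (e (q (idx s t))) (v (q (idx s t))) t‖
        ≤ c * E t / 2 + (3 * κ + 3) * σ := by linarith [hgint s t htI]
    have h7 := mul_le_mul_of_nonneg_left h6 (hk0 t)
    have h8 := mul_le_mul_of_nonneg_left (hG.one_le t) hσ.le
    have h9 : c / 4 ≤ c / 4 * E t := le_mul_of_one_le_right (by positivity) (hE1 t htI)
    have h10 := mul_le_mul_of_nonneg_left (hσc.trans h9) (hk0 t)
    change Metric.infDist (v' s t) _ < σ at h3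
    nlinarith
  · intro s
    have h1 : ∫ t in Icc 0 T, ‖v' s t - v s t‖ ≤ ∫ t in Icc 0 T, g s t :=
      integral_mono_ae ((hvi' s).sub (hvi s)).norm (hgi s) (hg s)
    rw [integral_Icc_eq_integral_Ioc, ← intervalIntegral.integral_of_le hT.le] at h1 ⊢
    rw [integral_Icc_eq_integral_Ioc, ← intervalIntegral.integral_of_le hT.le] at h1
    have h2 : c ≤ c * E T := le_mul_of_one_le_right hc.le (hE1 T hTI)
    have h3 := hgint s T hTI
    nlinarith

end Improvement

section Limit

variable {S X : Type*} [MetricSpace S] [NormedAddCommGroup X] [NormedSpace ℝ X]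
  {T : ℝ} {G : ℝ → X → Set X} {k E : ℝ → ℝ} {e : S → X} {v : S → ℝ → X} {c : ℝ}

theorem dist_toL1_eq_integral_norm_sub {Ω Y : Type*} [MeasurableSpace Ω] {μ : Measure Ω}
    [NormedAddCommGroup Y] {f g : Ω → Y} (hf : Integrable f μ) (hg : Integrable g μ) :
    dist (hf.toL1 f) (hg.toL1 g) = ∫ t, ‖f t - g t‖ ∂μ := by
  rw [dist_eq_norm, ← Integrable.toL1_sub, L1.norm_of_fun_eq_integral_norm]
  rfl

theorem IsApproxSolution.continuous_toL1 (hG : IsLipschitzInclusion T G k)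
    (h : IsApproxSolution T G k E e v c) :
    Continuous fun s ↦ Integrable.toL1 (v s) (h.integrableOn hG s) := by
  have hk0 : ∀ t, 0 ≤ 2 * k t := fun t ↦ by linarith [hG.one_le t]
  have h2k : IntegrableOn (fun t ↦ 2 * k t) (Icc 0 T) := hG.integrableOn.const_mul 2
  rw [Metric.continuous_iff]
  intro s σ hσ
  obtain ⟨ω, hω, hωD⟩ := exists_pos_setIntegral_le_of_measure_lt (μ := volume.restrict (Icc 0 T))
    h2k hk0 (half_pos hσ)
  obtain ⟨ρ, hρ, D, hD, hDω, hDv⟩ := h.locallyConst s ω hω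
  refine ⟨ρ, hρ, fun s' hs' ↦ ?_⟩
  refine (dist_toL1_eq_integral_norm_sub _ _).trans_lt ?_
  have h1 : ∫ t in Icc 0 T, ‖v s' t - v s t‖ ≤ ∫ t in Icc 0 T, D.indicator (fun t ↦ 2 * k t) t :=
    integral_mono_ae ((h.integrableOn hG s').sub (h.integrableOn hG s)).norm (h2k.indicator hD)
      (h.norm_sub_le_indicator (hDv s' hs'))
  rw [integral_indicator hD] at h1
  linarith [hωD D hDω]

theorem IsApproxSolution.exists_seq [TopologicalSpace.SeparableSpace S] [Nonempty S]
    [TopologicalSpace.SeparableSpace X]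
    (hT : 0 < T) (hG : IsLipschitzInclusion T G k)
    (hE1 : ∀ t ∈ Icc 0 T, 1 ≤ E t)
    (hkE : IntegrableOn (fun t ↦ k t * E t) (Icc 0 T))
    (hE : ∀ t ∈ Icc 0 T, ∫ s in (0 : ℝ)..t, k s * E s ≤ E t / 2)
    (he : ∀ s s', ‖e s - e s'‖ ≤ dist s s') (hc : 0 < c)
    (h : IsApproxSolution T G k E e v c) :
    ∃ V : ℕ → S → ℝ → X, V 0 = v ∧
      (∀ n, IsApproxSolution T G k E e (V n) (c * (3 / 4) ^ n)) ∧
      ∀ n s, ∫ t in Icc 0 T, ‖V (n + 1) s t - V n s t‖ ≤ c * E T * (3 / 4) ^ n := by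
  have hstep : ∀ n : ℕ, ∀ u : {u : S → ℝ → X // IsApproxSolution T G k E e u (c * (3 / 4) ^ n)},
      ∃ u' : {u : S → ℝ → X // IsApproxSolution T G k E e u (c * (3 / 4) ^ (n + 1))},
        ∀ s, ∫ t in Icc 0 T, ‖u'.1 s t - u.1 s t‖ ≤ c * E T * (3 / 4) ^ n := by
    rintro n ⟨u, hu⟩
    obtain ⟨u', hu', hd⟩ := hu.exists_improvement hT hG hE1 hkE hE he (by positivity)
    refine ⟨⟨u', ?_⟩, fun s ↦ (hd s).trans_eq (by ring)⟩
    convert hu' using 1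
    ring
  choose F hF using hstep
  let V : (n : ℕ) → {u : S → ℝ → X // IsApproxSolution T G k E e u (c * (3 / 4) ^ n)} :=
    fun n ↦ Nat.rec ⟨v, by simpa using h⟩ F n
  exact ⟨fun n ↦ (V n).1, rfl, fun n ↦ (V n).2, fun n ↦ hF n (V n)⟩

theorem IsApproxSolution.exists_continuous_solution [CompleteSpace X]
    [TopologicalSpace.SeparableSpace S] [Nonempty S] [TopologicalSpace.SeparableSpace X]
    (hT : 0 < T) (hG : IsLipschitzInclusion T G k)
    (hE1 : ∀ t ∈ Icc 0 T, 1 ≤ E t)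
    (hkE : IntegrableOn (fun t ↦ k t * E t) (Icc 0 T))
    (hE : ∀ t ∈ Icc 0 T, ∫ s in (0 : ℝ)..t, k s * E s ≤ E t / 2)
    (he : ∀ s s', ‖e s - e s'‖ ≤ dist s s') (hc : 0 < c)
    (h : IsApproxSolution T G k E e v c) :
    ∃ f : S → Lp X 1 (volume.restrict (Icc 0 T)), Continuous f ∧
      (∀ s, ∀ᵐ t ∂(volume.restrict (Icc 0 T)), f s t ∈ G t (curve (e s) (f s) t)) ∧
      ∀ s, ∫ t in Icc 0 T, ‖f s t - v s t‖ ≤ 4 * (c * E T) := by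
  obtain ⟨V, hV0, hV, hVd⟩ := h.exists_seq hT hG hE1 hkE hE he hc
  have hVi : ∀ n s, IntegrableOn (V n s) (Icc 0 T) := fun n ↦ (hV n).integrableOn hG
  let L : ℕ → S → Lp X 1 (volume.restrict (Icc 0 T)) := fun n s ↦
    Integrable.toL1 (V n s) (hVi n s)
  have hLd : ∀ s n, dist (L n s) (L (n + 1) s) ≤ c * E T * (3 / 4) ^ n := by
    intro s n
    rw [dist_comm]
    exact (dist_toL1_eq_integral_norm_sub _ _).trans_le (hVd n s)
  have hlim : ∀ s, ∃ y, Tendsto (fun n ↦ L n s) atTop (𝓝 y) := fun s ↦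
    cauchySeq_tendsto_of_complete (cauchySeq_of_le_geometric _ _ (by norm_num) (hLd s))
  choose f hf using hlim
  have hfd : ∀ s n, dist (L n s) (f s) ≤ c * E T * (3 / 4) ^ n / (1 - 3 / 4) := fun s n ↦
    dist_le_of_le_geometric_of_tendsto _ _ (by norm_num) (hLd s) (hf s) n
  have hgeom : Tendsto (fun n : ℕ ↦ c * E T * (3 / 4 : ℝ) ^ n / (1 - 3 / 4)) atTop (𝓝 0) := by
    have := ((tendsto_pow_atTop_nhds_zero_of_lt_one (r := (3 / 4 : ℝ)) (by norm_num)
      (by norm_num)).const_mul (c * E T)).div_const (1 - 3 / 4)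
    simpa using this
  have hfi : ∀ s, IntegrableOn (f s) (Icc 0 T) := fun s ↦ L1.integrable_coeFn (f s)
  have hdist : ∀ s n, dist (L n s) (f s) = ∫ t in Icc 0 T, ‖f s t - V n s t‖ := by
    intro s n
    have h1 := dist_toL1_eq_integral_norm_sub (L1.integrable_coeFn (f s)) (hVi n s)
    rw [Integrable.toL1_coeFn] at h1
    rw [dist_comm]
    exact h1
  refine ⟨f, ?_, fun s ↦ ?_, fun s ↦ ?_⟩
  · have hu : TendstoUniformly L f atTop := by
      rw [Metric.tendstoUniformly_iff]
      intro σ hσ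
      filter_upwards [(tendsto_order.1 hgeom).2 σ hσ] with n hn s
      rw [dist_comm]
      exact (hfd s n).trans_lt hn
    exact hu.continuous (Frequently.of_forall fun n ↦ (hV n).continuous_toL1 hG)
  · have hx : ∀ n, ∀ t ∈ Icc 0 T, ‖curve (e s) (f s) t - curve (e s) (V n s) t‖
        ≤ dist (L n s) (f s) := by
      intro n t ht
      have hi : IntegrableOn (fun t ↦ ‖f s t - V n s t‖) (Icc 0 T) := ((hfi s).sub (hVi n s)).norm
      have h1 := norm_curve_sub_curve_le (ξ := e s) (ξ' := e s) (hfi s) (hVi n s) hi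
        (ae_of_all _ fun _ ↦ le_rfl) ht
      have h2 := intervalIntegral_le_setIntegral_Icc hi (ae_of_all _ fun _ ↦ norm_nonneg _) ht
      rw [sub_self, norm_zero, zero_add] at h1
      rw [hdist]
      exact h1.trans h2
    obtain ⟨ns, hns, hae⟩ := (tendstoInMeasure_of_tendsto_Lp (hf s)).exists_seq_tendsto_ae
    have hLV : ∀ᵐ t ∂(volume.restrict (Icc 0 T)), ∀ n, L n s t = V n s t :=
      ae_all_iff.2 fun n ↦ Integrable.coeFn_toL1 (hVi n s)
    have hdef := ae_all_iff.2 fun n ↦ (hV n).infDist_le s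
    filter_upwards [hae, hLV, hdef, hG.infDist_le, hG.nonempty, hG.isClosed,
      ae_restrict_mem measurableSet_Icc] with t hconv hLVt hdeft hLip hne hcl ht
    rw [(hcl _).mem_iff_infDist_zero (hne _)]
    refine le_antisymm ?_ Metric.infDist_nonneg
    have hbound : ∀ j, Metric.infDist (f s t) (G t (curve (e s) (f s) t)) ≤
        dist (f s t) (L (ns j) s t) + c * (3 / 4) ^ (ns j) * (k t * E t)
          + k t * dist (L (ns j) s) (f s) := by
      intro j
      have h1 : Metric.infDist (f s t) (G t (curve (e s) (f s) t)) ≤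
          Metric.infDist (V (ns j) s t) (G t (curve (e s) (f s) t)) + dist (f s t) (V (ns j) s t) :=
        Metric.infDist_le_infDist_add_dist
      have h2 := hLip (curve (e s) (f s) t) (curve (e s) (V (ns j) s) t) (V (ns j) s t)
      have h3 := mul_le_mul_of_nonneg_left (hx (ns j) t ht) (zero_le_one.trans (hG.one_le t))
      rw [hLVt]
      linarith [hdeft (ns j)]
    refine ge_of_tendsto' (x := atTop) ?_ hbound
    have hns' := hns.tendsto_atTop
    have t1 : Tendsto (fun j ↦ dist (f s t) (L (ns j) s t)) atTop (𝓝 0) := by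
      have := (tendsto_const_nhds (x := f s t)).dist hconv
      simpa using this
    have t2 : Tendsto (fun j ↦ c * (3 / 4 : ℝ) ^ (ns j) * (k t * E t)) atTop (𝓝 0) := by
      have := (((tendsto_pow_atTop_nhds_zero_of_lt_one (r := (3 / 4 : ℝ)) (by norm_num)
        (by norm_num)).comp hns').const_mul c).mul_const (k t * E t)
      simpa using this
    have t3 : Tendsto (fun j ↦ k t * dist (L (ns j) s) (f s)) atTop (𝓝 0) := by
      have := ((tendsto_iff_dist_tendsto_zero.1 (hf s)).comp hns').const_mul (k t)
      simpa using this
    simpa using (t1.add t2).add t3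
  · have := hfd s 0
    rw [hdist, hV0] at this
    refine this.trans_eq ?_
    norm_num
    ring

end Limit

section Oscillation

theorem intervalIntegrable_of_norm_le {X : Type*} [NormedAddCommGroup X] {γ : ℝ → X}
    {B : ℝ} (hγ : StronglyMeasurable γ) (hB : ∀ s, ‖γ s‖ ≤ B) (a b : ℝ) :
    IntervalIntegrable γ volume a b :=
  (intervalIntegrable_const (c := B)).mono_fun hγ.aestronglyMeasurable
    (ae_of_all _ fun s ↦ (hB s).trans (le_abs_self B))

theorem sum_range_indicator_of_mem {Ω Y : Type*} [AddCommMonoid Y] {f : ℕ → Set Ω}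
    (hd : Pairwise (Function.onFun Disjoint f)) {s : Ω} {j : ℕ} (hs : s ∈ f j) (g : ℕ → Ω → Y)
    (n : ℕ) : ∑ i ∈ Finset.range n, (f i).indicator (g i) s = if j < n then g j s else 0 := by
  have h : ∀ i, (f i).indicator (g i) s = if j = i then g i s else 0 := by
    intro i
    split_ifs with hij
    · exact indicator_of_mem (hij ▸ hs) _
    · exact indicator_of_notMem (fun hsi ↦ disjoint_left.1 (hd hij) hs hsi) _
  simp only [h, Finset.sum_ite_eq, Finset.mem_range]

variable {X : Type*} [NormedAddCommGroup X] [NormedSpace ℝ X]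

/-- Every convex combination of points of `S` is the mean of a bounded function on `[0,1]` with
values in `S`. -/
theorem exists_integral_eq_of_mem_convexHull [CompleteSpace X] {S : Set X} {p : X}
    (hp : p ∈ convexHull ℝ S) :
    ∃ γ : ℝ → X, StronglyMeasurable γ ∧ (∀ s, γ s ∈ S) ∧ (∃ B, ∀ s, ‖γ s‖ ≤ B) ∧
      ∫ s in (0 : ℝ)..1, γ s = p := by
  refine convexHull_min (t := {p | ∃ γ : ℝ → X, StronglyMeasurable γ ∧ (∀ s, γ s ∈ S) ∧
    (∃ B, ∀ s, ‖γ s‖ ≤ B) ∧ ∫ s in (0 : ℝ)..1, γ s = p}) (fun q hq ↦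
    ⟨fun _ ↦ q, stronglyMeasurable_const, fun _ ↦ hq, ⟨‖q‖, fun _ ↦ le_rfl⟩, by simp⟩) ?_ hp
  rintro p₁ ⟨γ₁, hm₁, hS₁, ⟨B₁, hB₁⟩, rfl⟩ p₂ ⟨γ₂, hm₂, hS₂, ⟨B₂, hB₂⟩, rfl⟩ a b ha hb hab
  have hmeas₁ : StronglyMeasurable fun s ↦ γ₁ (s / a) :=
    hm₁.comp_measurable (measurable_id.div_const a)
  have hmeas₂ : StronglyMeasurable fun s ↦ γ₂ (s / b - a / b) :=
    hm₂.comp_measurable ((measurable_id.div_const b).sub_const _)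
  have hmeas : StronglyMeasurable fun s ↦ if s < a then γ₁ (s / a) else γ₂ (s / b - a / b) :=
    StronglyMeasurable.ite measurableSet_Iio hmeas₁ hmeas₂
  have hB : ∀ s, ‖if s < a then γ₁ (s / a) else γ₂ (s / b - a / b)‖ ≤ max B₁ B₂ := by
    intro s
    split_ifs
    · exact (hB₁ _).trans (le_max_left _ _)
    · exact (hB₂ _).trans (le_max_right _ _)
  refine ⟨_, hmeas, fun s ↦ ?_, ⟨_, hB⟩, ?_⟩
  · split_ifs
    exacts [hS₁ _, hS₂ _]
  have hinterval := intervalIntegrable_of_norm_le hmeas hB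
  have ha1 : a ≤ 1 := by linarith
  rw [← intervalIntegral.integral_add_adjacent_intervals (hinterval 0 a) (hinterval a 1)]
  congr 1
  · rcases ha.eq_or_lt with rfl | ha
    · simp
    · rw [intervalIntegral.integral_congr_Ioo_of_le (g := fun s ↦ γ₁ (s / a)) ha.le
        (fun s hs ↦ if_pos hs.2), intervalIntegral.integral_comp_div _ ha.ne', zero_div,
        div_self ha.ne']
  · rw [intervalIntegral.integral_congr (g := fun s ↦ γ₂ (s / b - a / b))
      (fun s hs ↦ if_neg (not_lt.2 ?_))]
    · rcases hb.eq_or_lt with rfl | hb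
      · have : a = 1 := by linarith
        simp [this]
      · rw [intervalIntegral.integral_comp_div_sub _ hb.ne', sub_self, ← sub_div,
          show 1 - a = b by linarith, div_self hb.ne']
    · rw [uIcc_of_le ha1] at hs
      exact hs.1

theorem norm_integral_le_of_periodic {β : ℝ → X} {B : ℝ} (hβ : StronglyMeasurable β)
    (hB : ∀ s, ‖β s‖ ≤ B) (hper : Function.Periodic β 1) (hmean : ∫ s in (0 : ℝ)..1, β s = 0)
    {x : ℝ} (hx : 0 ≤ x) : ‖∫ s in (0 : ℝ)..x, β s‖ ≤ B := by
  have hinterval := intervalIntegrable_of_norm_le hβ hB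
  rw [← intervalIntegral.integral_add_adjacent_intervals (hinterval 0 ⌊x⌋₊) (hinterval ⌊x⌋₊ x)]
  have h1 : ∫ s in (0 : ℝ)..(⌊x⌋₊ : ℝ), β s = 0 := by
    have := hper.intervalIntegral_add_zsmul_eq ⌊x⌋₊ 0
    simpa [hmean] using this hinterval
  rw [h1, zero_add]
  refine (intervalIntegral.norm_integral_le_of_norm_le_const fun s _ ↦ hB s).trans ?_
  have h2 := Nat.floor_le hx
  have h3 := Nat.lt_floor_add_one x
  rw [abs_of_nonneg (by linarith)]
  exact mul_le_of_le_one_right ((norm_nonneg _).trans (hB 0)) (by linarith)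

theorem norm_integral_comp_mul_le_of_periodic {β : ℝ → X} {B : ℝ} (hβ : StronglyMeasurable β)
    (hB : ∀ s, ‖β s‖ ≤ B) (hper : Function.Periodic β 1) (hmean : ∫ s in (0 : ℝ)..1, β s = 0)
    {M : ℝ} (hM : 0 < M) {x : ℝ} (hx : 0 ≤ x) : ‖∫ s in (0 : ℝ)..x, β (M * s)‖ ≤ B / M := by
  rw [intervalIntegral.integral_comp_mul_left _ hM.ne', norm_smul, mul_zero, norm_inv,
    Real.norm_of_nonneg hM.le, div_eq_inv_mul]
  exact mul_le_mul_of_nonneg_left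
    (norm_integral_le_of_periodic hβ hB hper hmean (by positivity)) (by positivity)

/-- If the functions `g i M` have uniformly vanishing primitives as `M → ∞` and `h M` differs from
their partial sums by at most `κ` off the tail of a disjoint sequence of sets, then the primitives
of `h M` are eventually bounded by `κ T`, up to an arbitrarily small error. -/
theorem eventually_norm_integral_le_of_partition {T κ : ℝ} {k : ℝ → ℝ}
    {f : ℕ → Set ℝ} {g : ℕ → ℕ → ℝ → X} {h : ℕ → ℝ → X} (hT : 0 ≤ T) (hκ : 0 ≤ κ)
    (hk : IntegrableOn k (Icc 0 T)) (hk0 : ∀ t, 0 ≤ k t)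
    (hf : ∀ i, MeasurableSet (f i)) (hd : Pairwise (Function.onFun Disjoint f))
    (hg : ∀ i M, IntegrableOn (g i M) (Icc 0 T)) (hh : ∀ M, IntegrableOn (h M) (Icc 0 T))
    (hlim : ∀ i, ∀ σ > 0, ∀ᶠ M : ℕ in atTop, ∀ t ∈ Icc 0 T, ‖∫ s in (0 : ℝ)..t, g i M s‖ ≤ σ)
    (hrem : ∀ n M, ∀ᵐ s ∂(volume.restrict (Icc 0 T)),
      ‖h M s - ∑ i ∈ Finset.range n, g i M s‖ ≤ κ + (⋃ i ∈ Ici n, f i).indicator k s) :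
    ∀ σ > 0, ∀ᶠ M : ℕ in atTop, ∀ t ∈ Icc 0 T, ‖∫ s in (0 : ℝ)..t, h M s‖ ≤ κ * T + σ := by
  intro σ hσ
  have hmeas : ∀ n, MeasurableSet (⋃ i ∈ Ici n, f i) := fun n ↦
    MeasurableSet.biUnion (to_countable _) fun i _ ↦ hf i
  have hempty : ⋂ n, ⋃ i ∈ Ici n, f i = ∅ := by
    refine eq_empty_of_forall_notMem fun s hs ↦ ?_
    simp only [mem_iInter, mem_iUnion, mem_Ici, exists_prop] at hs
    obtain ⟨i, -, hi⟩ := hs 0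
    obtain ⟨j, hij, hj⟩ := hs (i + 1)
    exact disjoint_left.1 (hd (show i ≠ j by omega)) hi hj
  have htail : Tendsto (fun n ↦ ∫ s in ⋃ i ∈ Ici n, f i, k s ∂(volume.restrict (Icc 0 T)))
      atTop (𝓝 0) := by
    have := tendsto_setIntegral_of_antitone (μ := volume.restrict (Icc 0 T)) (f := k) hmeas
      (fun m n hmn ↦ biUnion_subset_biUnion_left (Ici_subset_Ici.2 hmn)) ⟨0, hk.integrableOn⟩
    rwa [hempty, setIntegral_empty] at this
  obtain ⟨n, hn⟩ := ((tendsto_order.1 htail).2 (σ / 2) (half_pos hσ)).exists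
  have hfin : ∀ᶠ M : ℕ in atTop, ∀ i ∈ Finset.range n, ∀ t ∈ Icc 0 T,
      ‖∫ s in (0 : ℝ)..t, g i M s‖ ≤ σ / 2 / (n + 1) :=
    (Filter.eventually_all_finset _).2 fun i _ ↦ hlim i _ (by positivity)
  filter_upwards [hfin] with M hM t ht
  have hgi : ∀ i ∈ Finset.range n, IntervalIntegrable (g i M) volume 0 t := fun i _ ↦
    IntegrableOn.intervalIntegrable_zero (hg i M) ht
  have hsum : IntervalIntegrable (fun s ↦ ∑ i ∈ Finset.range n, g i M s) volume 0 t :=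
    IntegrableOn.intervalIntegrable_zero (T := T)
      (integrable_finsetSum (Finset.range n) fun i _ ↦ hg i M) ht
  have hki : IntegrableOn ((⋃ i ∈ Ici n, f i).indicator k) (Icc 0 T) :=
    Integrable.indicator hk (hmeas n)
  have hkT : IntegrableOn (fun _ : ℝ ↦ κ) (Icc 0 T) := integrableOn_const (by simp)
  have hsplit : ∫ s in (0 : ℝ)..t, h M s =
      (∫ s in (0 : ℝ)..t, (h M s - ∑ i ∈ Finset.range n, g i M s)) +
        ∑ i ∈ Finset.range n, ∫ s in (0 : ℝ)..t, g i M s := by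
    rw [intervalIntegral.integral_sub (IntegrableOn.intervalIntegrable_zero (hh M) ht) hsum,
      intervalIntegral.integral_finsetSum hgi, sub_add_cancel]
  have h1 : ‖∫ s in (0 : ℝ)..t, (h M s - ∑ i ∈ Finset.range n, g i M s)‖ ≤ κ * T + σ / 2 := by
    calc _ ≤ ∫ s in (0 : ℝ)..t, (κ + (⋃ i ∈ Ici n, f i).indicator k s) :=
          intervalIntegral.norm_integral_le_of_norm_le ht.1
            (ae_Ioc_of_ae_restrict_Icc (hrem n M) ht)
            (IntegrableOn.intervalIntegrable_zero (hkT.add hki) ht)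
      _ ≤ ∫ s in Icc 0 T, (κ + (⋃ i ∈ Ici n, f i).indicator k s) :=
          intervalIntegral_le_setIntegral_Icc (hkT.add hki)
            (ae_of_all _ fun s ↦ add_nonneg hκ (indicator_nonneg (fun s _ ↦ hk0 s) s)) ht
      _ = κ * T + ∫ s in ⋃ i ∈ Ici n, f i, k s ∂(volume.restrict (Icc 0 T)) := by
          rw [integral_add hkT hki, integral_indicator (hmeas n)]
          simp [hT, mul_comm]
      _ ≤ κ * T + σ / 2 := by linarith
  have h2 : ‖∑ i ∈ Finset.range n, ∫ s in (0 : ℝ)..t, g i M s‖ ≤ σ / 2 := by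
    refine (norm_sum_le_of_le _ fun i hi ↦ hM i hi t ht).trans ?_
    rw [Finset.sum_const, Finset.card_range, nsmul_eq_mul, mul_div_assoc',
      div_le_iff₀ (by positivity)]
    nlinarith
  rw [hsplit]
  linarith [norm_add_le (∫ s in (0 : ℝ)..t, (h M s - ∑ i ∈ Finset.range n, g i M s))
    (∑ i ∈ Finset.range n, ∫ s in (0 : ℝ)..t, g i M s)]

/-- A fast oscillating mean-zero function has uniformly small primitives on any measurable set. -/
theorem eventually_norm_integral_indicator_comp_mul_le {β : ℝ → X} {B T : ℝ} (hT : 0 ≤ T)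
    (hβ : StronglyMeasurable β) (hB : ∀ s, ‖β s‖ ≤ B) (hper : Function.Periodic β 1)
    (hmean : ∫ s in (0 : ℝ)..1, β s = 0) {A : Set ℝ} (hA : MeasurableSet A) :
    ∀ σ > 0, ∀ᶠ M : ℕ in atTop, ∀ t ∈ Icc 0 T,
      ‖∫ s in (0 : ℝ)..t, A.indicator (fun s ↦ β (M * s)) s‖ ≤ σ := by
  have hB0 : 0 ≤ B := (norm_nonneg _).trans (hB 0)
  have hβM : ∀ M : ℕ, StronglyMeasurable fun s ↦ β (M * s) := fun M ↦
    hβ.comp_measurable (measurable_id.const_mul _)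
  have hind : ∀ (M : ℕ) {A : Set ℝ}, MeasurableSet A → ∀ a b,
      IntervalIntegrable (A.indicator fun s ↦ β (M * s)) volume a b := fun M A hA ↦
    intervalIntegrable_of_norm_le ((hβM M).indicator hA)
      fun s ↦ (norm_indicator_le_norm_self _ s).trans (hB _)
  have hlim : ∀ σ > 0, ∀ᶠ M : ℕ in atTop, ∀ t ≥ 0,
      ‖∫ s in (0 : ℝ)..t, β (M * s)‖ ≤ σ := by
    intro σ hσ
    filter_upwards [eventually_gt_atTop 0,
      (tendsto_order.1 (tendsto_const_div_atTop_nhds_zero_nat B)).2 σ hσ] with M hM hMσ t ht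
    exact (norm_integral_comp_mul_le_of_periodic hβ hB hper hmean (Nat.cast_pos.2 hM) ht).trans
      hMσ.le
  induction A, hA using MeasurableSpace.induction_on_inter
    (borel_eq_generateFrom_Iic ℝ ▸ BorelSpace.measurable_eq) isPiSystem_Iic with
  | empty =>
    intro σ hσ
    simp [hσ.le]
  | basic A hA =>
    obtain ⟨a, rfl⟩ := hA
    intro σ hσ
    filter_upwards [hlim σ hσ] with M hM t ht
    rw [intervalIntegral.integral_of_le ht.1, setIntegral_indicator measurableSet_Iic,
      Ioc_inter_Iic]
    rcases le_total 0 (t ⊓ a) with h | h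
    · rw [← intervalIntegral.integral_of_le h]
      exact hM _ h
    · rw [Ioc_eq_empty (not_lt.2 h)]
      simp [hσ.le]
  | compl A hA ih =>
    intro σ hσ
    filter_upwards [hlim (σ / 2) (half_pos hσ), ih (σ / 2) (half_pos hσ)] with M hM hM' t ht
    have h1 : ∫ s in (0 : ℝ)..t, Aᶜ.indicator (fun s ↦ β (M * s)) s =
        (∫ s in (0 : ℝ)..t, β (M * s)) - ∫ s in (0 : ℝ)..t, A.indicator (fun s ↦ β (M * s)) s := by
      rw [← intervalIntegral.integral_sub
        (intervalIntegrable_of_norm_le (hβM M) (fun s ↦ hB _) _ _) (hind M hA _ _)]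
      rw [indicator_compl]
      rfl
    rw [h1]
    linarith [norm_sub_le (∫ s in (0 : ℝ)..t, β (M * s))
      (∫ s in (0 : ℝ)..t, A.indicator (fun s ↦ β (M * s)) s), hM t ht.1, hM' t ht]
  | iUnion f hd hf ih =>
    intro σ hσ
    have hB' : ∀ (M : ℕ) {A : Set ℝ}, MeasurableSet A →
        IntegrableOn (A.indicator fun s ↦ β (M * s)) (Icc 0 T) := fun M A hA ↦
      (intervalIntegrable_iff_integrableOn_Icc_of_le hT).1 (hind M hA 0 T)
    have h := eventually_norm_integral_le_of_partition (k := fun _ ↦ B) (κ := 0)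
      (g := fun i M ↦ (f i).indicator fun s ↦ β (M * s))
      (h := fun M ↦ (⋃ i, f i).indicator fun s ↦ β (M * s)) hT le_rfl
      (integrableOn_const (by simp)) (fun _ ↦ hB0) hf hd (fun i M ↦ hB' M (hf i))
      (fun M ↦ hB' M (MeasurableSet.iUnion hf)) ih (fun n M ↦ ae_of_all _ fun s ↦ ?_) σ hσ
    · simpa using h
    rw [zero_add]
    by_cases hs : s ∈ ⋃ i, f i
    · obtain ⟨j, hj⟩ := mem_iUnion.1 hs
      rw [sum_range_indicator_of_mem hd hj (fun _ s ↦ β (M * s)), indicator_of_mem hs]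
      split_ifs with hjn
      · rw [sub_self, norm_zero]
        exact indicator_nonneg (fun _ _ ↦ hB0) s
      · rw [sub_zero, indicator_of_mem (mem_biUnion (mem_Ici.2 (not_lt.1 hjn)) hj)]
        exact hB _
    · have : ∀ i, s ∉ f i := fun i hi ↦ hs (mem_iUnion.2 ⟨i, hi⟩)
      simp [this]

end Oscillation

section Relaxation

variable {X : Type*} [NormedAddCommGroup X] [NormedSpace ℝ X] [CompleteSpace X]
  [TopologicalSpace.SeparableSpace X]

theorem exists_norm_integral_oscillation_le {T κ : ℝ} {k : ℝ → ℝ} {m : ℝ → ℕ}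
    {γ : ℕ → ℝ → X} {v : ℝ → X} (hT : 0 ≤ T) (hκ : 0 ≤ κ)
    (hk : IntegrableOn k (Icc 0 T)) (hk0 : ∀ t, 0 ≤ k t) (hm : Measurable m)
    (hγ : ∀ i, StronglyMeasurable (γ i)) (hB : ∀ i, ∃ B, ∀ s, ‖γ i s‖ ≤ B)
    (hv : IntegrableOn v (Icc 0 T))
    (hmean : ∀ᵐ t ∂(volume.restrict (Icc 0 T)), ‖(∫ s in (0 : ℝ)..1, γ (m t) s) - v t‖ ≤ κ)
    (hγk : ∀ᵐ t ∂(volume.restrict (Icc 0 T)), ∀ s, ‖γ (m t) s‖ ≤ k t)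
    (hvk : ∀ᵐ t ∂(volume.restrict (Icc 0 T)), ‖v t‖ ≤ k t) {σ : ℝ} (hσ : 0 < σ) :
    ∃ M : ℕ, ∀ t ∈ Icc 0 T,
      ‖∫ s in (0 : ℝ)..t, (γ (m s) (Int.fract (M * s)) - v s)‖ ≤ κ * T + σ := by
  have hd : Pairwise (Function.onFun Disjoint fun i ↦ m ⁻¹' {i}) := fun i j hij ↦
    Disjoint.preimage m (disjoint_singleton.2 hij)
  have hf : ∀ i, MeasurableSet (m ⁻¹' {i}) := fun i ↦ hm (measurableSet_singleton i)
  have hγfract : ∀ i, StronglyMeasurable fun s ↦ γ i (Int.fract s) := fun i ↦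
    (hγ i).comp_measurable measurable_fract
  set β : ℕ → ℝ → X := fun i s ↦ γ i (Int.fract s) - ∫ r in (0 : ℝ)..1, γ i r with hβdef
  have hβ : ∀ i, StronglyMeasurable (β i) := fun i ↦
    (hγfract i).sub stronglyMeasurable_const
  have hβB : ∀ i, ∃ B, ∀ s, ‖β i s‖ ≤ B := fun i ↦ by
    obtain ⟨B, hB⟩ := hB i
    exact ⟨B + ‖∫ r in (0 : ℝ)..1, γ i r‖, fun s ↦
      (norm_sub_le _ _).trans (add_le_add (hB _) le_rfl)⟩
  have hper : ∀ i, Function.Periodic (β i) 1 := fun i s ↦ by simp [hβdef]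
  have hβ0 : ∀ i, ∫ s in (0 : ℝ)..1, β i s = 0 := by
    intro i
    obtain ⟨B, hB⟩ := hB i
    rw [intervalIntegral.integral_sub
      (intervalIntegrable_of_norm_le (hγfract i) (fun s ↦ hB _) _ _) intervalIntegrable_const,
      intervalIntegral.integral_congr_Ioo_of_le (g := γ i) zero_le_one fun s hs ↦ by
        simp only [Int.fract_eq_self.2 ⟨hs.1.le, hs.2⟩]]
    simp
  have hβi : ∀ i (M : ℕ), IntegrableOn ((m ⁻¹' {i}).indicator fun s ↦ β i (M * s)) (Icc 0 T) := by
    intro i M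
    obtain ⟨B, hB⟩ := hβB i
    exact (intervalIntegrable_iff_integrableOn_Icc_of_le hT).1 (intervalIntegrable_of_norm_le
      (((hβ i).comp_measurable (measurable_id.const_mul _)).indicator (hf i))
      (fun s ↦ (norm_indicator_le_norm_self _ s).trans (hB _)) 0 T)
  have hw : ∀ M : ℕ, IntegrableOn (fun s ↦ γ (m s) (Int.fract (M * s)) - v s) (Icc 0 T) := by
    intro M
    refine Integrable.sub (hk.mono' (stronglyMeasurable_apply_nat_index (m := m)
      (w := fun i s ↦ γ i (Int.fract (M * s))) (fun i ↦ (hγfract i).comp_measurable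
        (measurable_id.const_mul _)) hm).aestronglyMeasurable ?_) hv
    filter_upwards [hγk] with t ht using ht _
  refine (eventually_norm_integral_le_of_partition (k := fun t ↦ 2 * k t)
    (g := fun i M ↦ (m ⁻¹' {i}).indicator fun s ↦ β i (M * s)) hT hκ (hk.const_mul 2)
    (fun t ↦ by linarith [hk0 t]) hf hd hβi hw (fun i ↦ ?_) (fun n M ↦ ?_) σ hσ).exists
  · obtain ⟨B, hB⟩ := hβB i
    exact eventually_norm_integral_indicator_comp_mul_le hT (hβ i) hB (hper i) (hβ0 i) (hf i)
  · filter_upwards [hmean, hγk, hvk] with s hs1 hs2 hs3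
    have hs : s ∈ m ⁻¹' {m s} := rfl
    rw [sum_range_indicator_of_mem hd hs (fun i s ↦ β i (M * s))]
    split_ifs with hn
    · have h1 : 0 ≤ (⋃ i ∈ Ici n, m ⁻¹' {i}).indicator (fun t ↦ 2 * k t) s :=
        indicator_nonneg (fun t _ ↦ by linarith [hk0 t]) s
      have h2 : γ (m s) (Int.fract (M * s)) - v s - β (m s) (M * s) =
          (∫ s' in (0 : ℝ)..1, γ (m s) s') - v s := by
        simp only [hβdef]
        abel
      rw [h2]
      linarith
    · have h1 : s ∈ ⋃ i ∈ Ici n, m ⁻¹' {i} := mem_biUnion (mem_Ici.2 (not_lt.1 hn)) hs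
      rw [sub_zero, indicator_of_mem h1]
      linarith [norm_sub_le (γ (m s) (Int.fract (M * s))) (v s), hs2 (Int.fract (M * s))]

/-- **Relaxation.** An integrable selection of the closed convex hull of `Γ` has a primitive that is
uniformly approximated by primitives of almost selections of `Γ`. -/
theorem exists_near_selection_of_mem_closure_convexHull {T : ℝ} {k : ℝ → ℝ} {Γ : ℝ → Set X}
    {v : ℝ → X} (hT : 0 < T) (hk : IntegrableOn k (Icc 0 T)) (hk0 : ∀ t, 0 ≤ k t)
    (hne : ∀ᵐ t ∂(volume.restrict (Icc 0 T)), (Γ t).Nonempty)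
    (hb : ∀ᵐ t ∂(volume.restrict (Icc 0 T)), ∀ u ∈ Γ t, ‖u‖ + 1 ≤ k t)
    (hΓ : ∀ u, AEMeasurable (fun t ↦ Metric.infDist u (Γ t)) (volume.restrict (Icc 0 T)))
    (hv : IntegrableOn v (Icc 0 T))
    (hvΓ : ∀ᵐ t ∂(volume.restrict (Icc 0 T)), v t ∈ closure (convexHull ℝ (Γ t)))
    {σ : ℝ} (hσ : 0 < σ) (hσ1 : σ < 1) :
    ∃ w : ℝ → X, StronglyMeasurable w ∧
      (∀ᵐ t ∂(volume.restrict (Icc 0 T)), Metric.infDist (w t) (Γ t) < σ) ∧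
      ∀ t ∈ Icc 0 T, ‖∫ s in (0 : ℝ)..t, (w s - v s)‖ ≤ σ := by
  obtain ⟨τ, hτ, hτσ, hτT⟩ : ∃ τ : ℝ, 0 < τ ∧ τ ≤ σ ∧ 2 * τ * T ≤ σ / 2 := by
    refine ⟨min σ (σ / 2 / (2 * T)), by positivity, min_le_left _ _, ?_⟩
    have := min_le_right σ (σ / 2 / (2 * T))
    rw [le_div_iff₀ (by positivity)] at this
    linarith
  let u : ℕ → X := TopologicalSpace.denseSeq X
  have hu : DenseRange u := TopologicalSpace.denseRange_denseSeq X
  -- each code consists of finitely many points of the dense sequence and a target point near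
  -- their convex hull
  let p : Finset ℕ × ℕ → ℝ → Prop := fun c t ↦
    (∃ q ∈ convexHull ℝ (u '' c.1), ‖u c.2 - q‖ < τ) ∧
      (∀ j ∈ c.1, Metric.infDist (u j) (Γ t) < τ) ∧ ‖v t - u c.2‖ < τ
  have hpm : ∀ c, NullMeasurableSet {t | p c t} (volume.restrict (Icc 0 T)) := by
    intro c
    have h1 : {t | p c t} = {_t : ℝ | ∃ q ∈ convexHull ℝ (u '' c.1), ‖u c.2 - q‖ < τ} ∩
        ((⋂ j ∈ c.1, {t | Metric.infDist (u j) (Γ t) < τ}) ∩ {t | ‖v t - u c.2‖ < τ}) := by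
      ext t
      simp [p]
    rw [h1]
    refine (MeasurableSet.const _).nullMeasurableSet.inter (NullMeasurableSet.inter
      (NullMeasurableSet.biInter (to_countable _) fun j _ ↦ ?_) ?_)
    · exact nullMeasurableSet_lt (hΓ (u j)) aemeasurable_const
    · exact nullMeasurableSet_lt
        (hv.aestronglyMeasurable.sub aestronglyMeasurable_const).norm.aemeasurable
        aemeasurable_const
  have hpe : ∀ᵐ t ∂(volume.restrict (Icc 0 T)), ∃ c, p c t := by
    filter_upwards [hvΓ, hne] with t hvt hnet
    set D : Set ℕ := {j | Metric.infDist (u j) (Γ t) < τ} with hD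
    have hΓD : Γ t ⊆ closure (convexHull ℝ (u '' D)) := by
      intro y hy
      rw [Metric.mem_closure_iff]
      intro ρ hρ
      obtain ⟨j, hj⟩ := hu.exists_dist_lt y (lt_min hρ hτ)
      refine ⟨u j, subset_convexHull ℝ _ (mem_image_of_mem u ?_), hj.trans_le (min_le_left _ _)⟩
      rw [dist_comm] at hj
      exact (Metric.infDist_le_dist_of_mem hy).trans_lt (hj.trans_le (min_le_right _ _))
    have hvD : v t ∈ closure (convexHull ℝ (u '' D)) :=
      closure_minimal (convexHull_min hΓD (convex_convexHull ℝ _).closure) isClosed_closure hvt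
    obtain ⟨q, hq, hvq⟩ := Metric.mem_closure_iff.1 hvD (τ / 2) (half_pos hτ)
    rw [convexHull_eq_union_convexHull_finite_subsets] at hq
    simp only [mem_iUnion] at hq
    obtain ⟨J', hJ', hq⟩ := hq
    classical
    obtain ⟨J, hJD, rfl⟩ := Finset.subset_set_image_iff.1 hJ'
    rw [Finset.coe_image] at hq
    obtain ⟨m, hm⟩ := hu.exists_dist_lt (v t) (half_pos hτ)
    rw [dist_eq_norm] at hvq hm
    refine ⟨(J, m), ⟨q, hq, ?_⟩, fun j hj ↦ hJD hj, hm.trans (half_lt_self hτ)⟩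
    calc ‖u m - q‖ = ‖(v t - q) - (v t - u m)‖ := by congr 1; abel
      _ ≤ ‖v t - q‖ + ‖v t - u m‖ := norm_sub_le _ _
      _ < τ := by linarith
  have hγ : ∀ c : Finset ℕ × ℕ, ∃ γ : ℝ → X, StronglyMeasurable γ ∧ (∃ B, ∀ s, ‖γ s‖ ≤ B) ∧
      ((∃ q ∈ convexHull ℝ (u '' c.1), ‖u c.2 - q‖ < τ) →
        (∀ s, γ s ∈ u '' c.1) ∧ ‖u c.2 - ∫ s in (0 : ℝ)..1, γ s‖ < τ) := by
    intro c
    by_cases hc : ∃ q ∈ convexHull ℝ (u '' c.1), ‖u c.2 - q‖ < τ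
    · obtain ⟨q, hq, hcq⟩ := hc
      obtain ⟨γ, hγ, hγu, hγB, rfl⟩ := exists_integral_eq_of_mem_convexHull hq
      exact ⟨γ, hγ, hγB, fun _ ↦ ⟨hγu, hcq⟩⟩
    · exact ⟨0, stronglyMeasurable_zero, ⟨0, fun _ ↦ by simp⟩, fun h ↦ absurd h hc⟩
  choose γ hγm hγB hγp using hγ
  obtain ⟨code, hcode⟩ := exists_surjective_nat (Finset ℕ × ℕ)
  obtain ⟨m, hm, hmp⟩ := exists_measurable_nat_selection (p := fun n ↦ p (code n))
    (fun n ↦ hpm (code n)) (by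
      filter_upwards [hpe] with t ⟨c, hc⟩
      obtain ⟨n, rfl⟩ := hcode c
      exact ⟨n, hc⟩)
  have hnear : ∀ᵐ t ∂(volume.restrict (Icc 0 T)), ∀ s,
      Metric.infDist (γ (code (m t)) s) (Γ t) < τ := by
    filter_upwards [hmp] with t ht s
    obtain ⟨j, hj, hjs⟩ := (hγp _ ht.1).1 s
    rw [← hjs]
    exact ht.2.1 j hj
  have hγk : ∀ᵐ t ∂(volume.restrict (Icc 0 T)), ∀ s, ‖γ (code (m t)) s‖ ≤ k t := by
    filter_upwards [hnear, hne, hb] with t ht hnet hbt s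
    obtain ⟨y, hy, hys⟩ := (Metric.infDist_lt_iff hnet).1 (ht s)
    rw [dist_eq_norm] at hys
    linarith [hbt y hy, norm_le_norm_add_norm_sub' (γ (code (m t)) s) y]
  have hvk : ∀ᵐ t ∂(volume.restrict (Icc 0 T)), ‖v t‖ ≤ k t := by
    filter_upwards [hvΓ, hb] with t ht hbt
    rw [← mem_closedBall_zero_iff]
    refine closure_minimal (convexHull_min (fun y hy ↦ ?_) (convex_closedBall 0 (k t)))
      Metric.isClosed_closedBall ht
    rw [mem_closedBall_zero_iff]
    linarith [hbt y hy]
  obtain ⟨M, hM⟩ := exists_norm_integral_oscillation_le (γ := fun n ↦ γ (code n)) (κ := 2 * τ)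
    hT.le (by positivity) hk hk0 hm (fun n ↦ hγm _) (fun n ↦ hγB _) hv (by
      filter_upwards [hmp] with t ht
      have h1 := (hγp _ ht.1).2
      have h2 := ht.2.2
      rw [norm_sub_rev] at h1 h2
      linarith [norm_sub_le_norm_sub_add_norm_sub (∫ s in (0 : ℝ)..1, γ (code (m t)) s)
        (u (code (m t)).2) (v t)]) hγk hvk (half_pos hσ)
  refine ⟨fun t ↦ γ (code (m t)) (Int.fract (M * t)), ?_, ?_, fun t ht ↦ (hM t ht).trans ?_⟩
  · exact stronglyMeasurable_apply_nat_index (w := fun n t ↦ γ (code n) (Int.fract (M * t)))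
      (fun n ↦ (hγm _).comp_measurable (measurable_fract.comp (measurable_id.const_mul _))) hm
  · filter_upwards [hnear] with t ht using (ht _).trans_le hτσ
  · linarith

end Relaxation

section RadialClip

variable {X : Type*} [NormedAddCommGroup X] [NormedSpace ℝ X]

/-- The radial retraction onto the closed ball of radius `ε` around the origin. -/
noncomputable def radialClip (ε : ℝ) (y : X) : X := (ε / max ε ‖y‖) • y

theorem radialClip_of_norm_le {ε : ℝ} (hε : 0 < ε) {y : X} (hy : ‖y‖ ≤ ε) :
    radialClip ε y = y := by
  rw [radialClip, max_eq_left hy, div_self hε.ne', one_smul]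

theorem norm_radialClip_le {ε : ℝ} (hε : 0 < ε) (y : X) : ‖radialClip ε y‖ ≤ ε := by
  have hm : 0 < max ε ‖y‖ := lt_max_of_lt_left hε
  rw [radialClip, norm_smul, Real.norm_of_nonneg (by positivity), div_mul_eq_mul_div,
    div_le_iff₀ hm]
  exact mul_le_mul_of_nonneg_left (le_max_right _ _) hε.le

theorem norm_radialClip_sub_le {ε : ℝ} (hε : 0 < ε) (x y : X) :
    ‖radialClip ε x - radialClip ε y‖ ≤ 2 * ‖x - y‖ := by
  have hx : 0 < max ε ‖x‖ := lt_max_of_lt_left hε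
  have hy : 0 < max ε ‖y‖ := lt_max_of_lt_left hε
  have h1 : radialClip ε x - radialClip ε y =
      (ε / max ε ‖x‖) • (x - y) + (ε / max ε ‖x‖ - ε / max ε ‖y‖) • y := by
    simp only [radialClip, smul_sub, sub_smul]
    abel
  have hx1 : ε / max ε ‖x‖ ≤ 1 := (div_le_one hx).2 (le_max_left _ _)
  have hy1 : ‖y‖ / max ε ‖y‖ ≤ 1 := (div_le_one hy).2 (le_max_right _ _)
  have h2 : |max ε ‖y‖ - max ε ‖x‖| ≤ ‖x - y‖ := by
    rw [norm_sub_rev]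
    refine (abs_max_sub_max_le_max ε ‖y‖ ε ‖x‖).trans ?_
    rw [sub_self, abs_zero, max_eq_right (abs_nonneg _)]
    exact abs_norm_sub_norm_le y x
  have h3 : ‖(ε / max ε ‖x‖ - ε / max ε ‖y‖) • y‖ ≤ ‖x - y‖ := by
    have h4 : ε / max ε ‖x‖ - ε / max ε ‖y‖ =
        ε / max ε ‖x‖ * ((max ε ‖y‖ - max ε ‖x‖) / max ε ‖y‖) := by
      field_simp
    rw [norm_smul, h4, Real.norm_eq_abs, abs_mul, abs_div _ (max ε ‖y‖), abs_of_pos hy,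
      abs_of_nonneg (a := ε / max ε ‖x‖) (by positivity)]
    calc _ = ε / max ε ‖x‖ * (‖y‖ / max ε ‖y‖) * |max ε ‖y‖ - max ε ‖x‖| := by ring
      _ ≤ 1 * ‖x - y‖ := mul_le_mul (mul_le_one₀ hx1 (by positivity) hy1) h2 (abs_nonneg _)
          zero_le_one
      _ = ‖x - y‖ := one_mul _
  rw [h1]
  refine (norm_add_le _ _).trans ?_
  rw [norm_smul, Real.norm_of_nonneg (by positivity)]
  have := mul_le_mul_of_nonneg_right hx1 (norm_nonneg (x - y))
  linarith

theorem continuous_radialClip {ε : ℝ} (hε : 0 < ε) : Continuous (radialClip ε : X → X) :=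
  (LipschitzWith.of_dist_le_mul (K := 2) fun x y ↦ by
    simpa [dist_eq_norm] using norm_radialClip_sub_le hε x y).continuous

end RadialClip

theorem aemeasurable_infDist_comp_of_measurableSet_prod {X : Type*} [NormedAddCommGroup X]
    [MeasurableSpace X] [BorelSpace X] [TopologicalSpace.SeparableSpace X] {T : ℝ}
    {F : ℝ → X → Set X} (hFne : ∀ t ∈ Icc (0 : ℝ) T, ∀ ξ, (F t ξ).Nonempty)
    (hF : ∀ U : Set X, IsOpen U →
      MeasurableSet[MeasurableSpace.prod
          (inferInstanceAs (MeasurableSpace (NullMeasurableSpace ℝ volume)))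
          (inferInstance : MeasurableSpace X)]
        {p : ℝ × X | p.1 ∈ Icc (0 : ℝ) T ∧ (F p.1 p.2 ∩ U).Nonempty})
    {x : ℝ → X} (hx : ContinuousOn x (Icc 0 T)) (u : X) :
    AEMeasurable (fun t ↦ Metric.infDist u (F t (x t))) (volume.restrict (Icc 0 T)) := by
  have hx' : Measurable ((Icc 0 T).indicator x) := by
    classical
    rw [← piecewise_eq_indicator]
    exact hx.measurable_piecewise continuousOn_const measurableSet_Icc
  have hset : ∀ U : Set X, IsOpen U →
      NullMeasurableSet {t | t ∈ Icc 0 T ∧ (F t (x t) ∩ U).Nonempty} volume := by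
    intro U hU
    have hmeas : @Measurable (NullMeasurableSpace ℝ volume) (ℝ × X) _
        (MeasurableSpace.prod (inferInstanceAs (MeasurableSpace (NullMeasurableSpace ℝ volume)))
          (inferInstance : MeasurableSpace X)) fun t : ℝ ↦ (t, (Icc 0 T).indicator x t) := by
      refine @Measurable.prodMk _ _ _ (_) (_) (_) _ _ measurable_id ?_
      exact fun s hs ↦ (hx' hs).nullMeasurableSet
    have := hmeas (hF U hU)
    have heq : {t | t ∈ Icc 0 T ∧ (F t (x t) ∩ U).Nonempty} =
        (fun t : ℝ ↦ (t, (Icc 0 T).indicator x t)) ⁻¹'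
          {p : ℝ × X | p.1 ∈ Icc (0 : ℝ) T ∧ (F p.1 p.2 ∩ U).Nonempty} := by
      ext t
      refine and_congr_right fun ht ↦ ?_
      simp only [indicator_of_mem ht]
    rw [heq]
    exact this
  refine NullMeasurable.aemeasurable ?_
  refine @measurable_of_Iio ℝ (NullMeasurableSpace ℝ (volume.restrict (Icc 0 T))) _ _ _ _ _ _ _
    (fun t ↦ Metric.infDist u (F t (x t))) fun r ↦ ?_
  have h1 := (hset (Metric.ball u r) Metric.isOpen_ball).mono_ac
    (Measure.absolutelyContinuous_of_le (Measure.restrict_le_self (s := Icc 0 T)))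
  refine h1.congr ?_
  filter_upwards [ae_restrict_mem measurableSet_Icc] with t ht
  refine propext ?_
  change (t ∈ Icc 0 T ∧ (F t (x t) ∩ Metric.ball u r).Nonempty) ↔ Metric.infDist u (F t (x t)) < r
  rw [Metric.infDist_lt_iff (hFne t ht _)]
  simp only [ht, true_and, Set.Nonempty, mem_inter_iff, Metric.mem_ball']

theorem IsLipschitzInclusion.exists_continuous_selection_near {X : Type*} [NormedAddCommGroup X]
    [NormedSpace ℝ X] [CompleteSpace X] [TopologicalSpace.SeparableSpace X] {T : ℝ} (hT : 0 < T)
    {G : ℝ → X → Set X} {k : ℝ → ℝ} (hG : IsLipschitzInclusion T G k) {ξ₀ : X} {vz : ℝ → X}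
    (hvz : IntegrableOn vz (Icc 0 T))
    (hvzG : ∀ᵐ t ∂(volume.restrict (Icc 0 T)),
      vz t ∈ closure (convexHull ℝ (G t (curve ξ₀ vz t))))
    {ε : ℝ} (hε : 0 < ε) :
    ∃ δ > 0, ∃ f : Metric.closedBall ξ₀ δ → Lp X 1 (volume.restrict (Icc 0 T)), Continuous f ∧
      (∀ s : Metric.closedBall ξ₀ δ, ∀ᵐ t ∂(volume.restrict (Icc 0 T)),
        f s t ∈ G t (curve (s : X) (f s) t)) ∧
      ∀ s : Metric.closedBall ξ₀ δ, ∀ t ∈ Icc 0 T,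
        ‖curve ξ₀ vz t - curve (s : X) (f s) t‖ < ε := by
  have hk0 : ∀ t, 0 ≤ k t := fun t ↦ zero_le_one.trans (hG.one_le t)
  obtain ⟨E, hE1, -, hkE, hE⟩ := exists_gronwall_weight hT hG.integrableOn hk0
  have hET : 1 ≤ E T := hE1 T ⟨hT.le, le_rfl⟩
  obtain ⟨σ, hσ, hσ1, hσε⟩ : ∃ σ : ℝ, 0 < σ ∧ σ < 1 ∧ 14 * (σ * E T) < ε := by
    refine ⟨min (1 / 2) (ε / (15 * E T)), by positivity,
      (min_le_left _ _).trans_lt (by norm_num), ?_⟩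
    have h1 : min (1 / 2) (ε / (15 * E T)) * (15 * E T) ≤ ε :=
      (le_div_iff₀ (by positivity)).1 (min_le_right _ _)
    have h2 : 0 < min (1 / 2) (ε / (15 * E T)) * E T := by positivity
    linarith
  obtain ⟨w, hw, hwG, hwz⟩ := exists_near_selection_of_mem_closure_convexHull
    (Γ := fun t ↦ G t (curve ξ₀ vz t)) hT hG.integrableOn hk0
    (hG.nonempty.mono fun t ht ↦ ht _) (hG.norm_add_one_le.mono fun t ht ↦ ht _)
    (hG.aemeasurable _ (continuousOn_curve hT.le hvz)) hvz hvzG hσ hσ1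
  have hwk : ∀ᵐ t ∂(volume.restrict (Icc 0 T)), ‖w t‖ ≤ k t := by
    filter_upwards [hwG, hG.norm_le_of_infDist_lt] with t h1 h2
    exact h2 _ _ (h1.trans hσ1)
  have hwi : IntegrableOn w (Icc 0 T) := hG.integrableOn.mono' hw.aestronglyMeasurable hwk
  have hcurve : ∀ s : Metric.closedBall ξ₀ σ, ∀ t ∈ Icc 0 T,
      ‖curve (s : X) w t - curve ξ₀ vz t‖ ≤ 2 * σ := by
    intro s t ht
    have h1 : curve (s : X) w t - curve ξ₀ vz t =
        ((s : X) - ξ₀) + ∫ r in (0 : ℝ)..t, (w r - vz r) := by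
      rw [intervalIntegral.integral_sub (IntegrableOn.intervalIntegrable_zero hwi ht)
        (IntegrableOn.intervalIntegrable_zero hvz ht)]
      simp only [curve]
      abel
    rw [h1]
    linarith [norm_add_le ((s : X) - ξ₀) (∫ r in (0 : ℝ)..t, (w r - vz r)), hwz t ht,
      mem_closedBall_iff_norm.1 s.2]
  have happrox : IsApproxSolution T G k E (fun s : Metric.closedBall ξ₀ σ ↦ (s : X))
      (fun _ ↦ w) (3 * σ) := by
    refine ⟨fun s ω hω ↦ ⟨1, one_pos, ∅, MeasurableSet.empty, by simpa using hω, by simp⟩,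
      fun _ ↦ hw.aestronglyMeasurable, fun _ ↦ hwk, fun s ↦ ?_⟩
    filter_upwards [hwG, hG.infDist_le, ae_restrict_mem measurableSet_Icc] with t h1 h2 ht
    have h3 := h2 (curve (s : X) w t) (curve ξ₀ vz t) (w t)
    have h4 := mul_le_mul_of_nonneg_left (hcurve s t ht) (hk0 t)
    have h5 : σ * 1 ≤ σ * k t := mul_le_mul_of_nonneg_left (hG.one_le t) hσ.le
    have h6 : 3 * σ * (k t * 1) ≤ 3 * σ * (k t * E t) := by
      have := hE1 t ht
      have := hk0 t
      gcongr
    linarith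
  have : Nonempty (Metric.closedBall ξ₀ σ) := ⟨⟨ξ₀, Metric.mem_closedBall_self hσ.le⟩⟩
  obtain ⟨f, hf, hfG, hfw⟩ := happrox.exists_continuous_solution hT hG hE1 hkE hE
    (fun s s' ↦ (dist_eq_norm s.1 s'.1).ge) (by positivity)
  refine ⟨σ, hσ, f, hf, hfG, fun s t ht ↦ ?_⟩
  have hfi : IntegrableOn (f s) (Icc 0 T) := L1.integrable_coeFn (f s)
  have hi : IntegrableOn (fun t ↦ ‖f s t - w t‖) (Icc 0 T) := (hfi.sub hwi).norm
  have h1 := norm_curve_sub_curve_le (ξ := (s : X)) (ξ' := (s : X)) hfi hwi hi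
    (ae_of_all _ fun _ ↦ le_rfl) ht
  have h2 := intervalIntegral_le_setIntegral_Icc hi (ae_of_all _ fun _ ↦ norm_nonneg _) ht
  rw [sub_self, norm_zero, zero_add] at h1
  have h3 := norm_sub_le_norm_sub_add_norm_sub (curve (s : X) (f s) t) (curve (s : X) w t)
    (curve ξ₀ vz t)
  have h4 : σ * 1 ≤ σ * E T := mul_le_mul_of_nonneg_left hET hσ.le
  rw [norm_sub_rev]
  linarith [hfw s, hcurve s t ht]

/-- Composing a set-valued map that is Lipschitz and bounded on a tube around `z` with the radial
retraction onto the tube gives a globally Lipschitz and bounded inclusion. -/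
theorem isLipschitzInclusion_radialClip {X : Type*} [NormedAddCommGroup X] [NormedSpace ℝ X]
    [MeasurableSpace X] [BorelSpace X] [TopologicalSpace.SeparableSpace X] {T : ℝ}
    {F : ℝ → X → Set X} (hFne : ∀ t ∈ Icc (0 : ℝ) T, ∀ ξ, (F t ξ).Nonempty)
    (hFcl : ∀ t ∈ Icc (0 : ℝ) T, ∀ ξ, IsClosed (F t ξ))
    (hF : ∀ U : Set X, IsOpen U →
      MeasurableSet[MeasurableSpace.prod
          (inferInstanceAs (MeasurableSpace (NullMeasurableSpace ℝ volume)))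
          (inferInstance : MeasurableSpace X)]
        {p : ℝ × X | p.1 ∈ Icc (0 : ℝ) T ∧ (F p.1 p.2 ∩ U).Nonempty})
    {z : ℝ → X} (hz : ContinuousOn z (Icc 0 T)) {ε : ℝ} (hε : 0 < ε) {A : Set X}
    (hA : ∀ t ∈ Icc 0 T, Metric.closedBall (z t) ε ⊆ A) {k₀ α : ℝ → ℝ}
    (hk₀ : IntegrableOn k₀ (Icc 0 T)) (hα : IntegrableOn α (Icc 0 T))
    (hlip : ∀ᵐ t ∂(volume.restrict (Icc 0 T)), ∀ ξ ∈ A, ∀ η ∈ A,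
      Metric.hausdorffDist (F t ξ) (F t η) ≤ k₀ t * ‖ξ - η‖)
    (hbd : ∀ᵐ t ∂(volume.restrict (Icc 0 T)), ∀ ξ ∈ A, ∀ ζ ∈ F t ξ, ‖ζ‖ ≤ α t) :
    IsLipschitzInclusion T (fun t ξ ↦ F t (z t + radialClip ε (ξ - z t)))
      (fun t ↦ 2 * |k₀ t| + |α t| + 1) where
  integrableOn := ((hk₀.abs.const_mul 2).add hα.abs).add (integrableOn_const (by simp))
  one_le t := by linarith [abs_nonneg (k₀ t), abs_nonneg (α t)]
  nonempty := by
    filter_upwards [ae_restrict_mem measurableSet_Icc] with t ht ξ using hFne t ht _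
  isClosed := by
    filter_upwards [ae_restrict_mem measurableSet_Icc] with t ht ξ using hFcl t ht _
  norm_add_one_le := by
    filter_upwards [ae_restrict_mem measurableSet_Icc, hbd] with t ht hb ξ u hu
    have := hb _ (hA t ht (by simpa using norm_radialClip_le hε (ξ - z t))) u hu
    linarith [abs_nonneg (k₀ t), le_abs_self (α t)]
  infDist_le := by
    filter_upwards [ae_restrict_mem measurableSet_Icc, hbd, hlip] with t ht hb hl ξ ξ' u
    have hmem : ∀ ξ, z t + radialClip ε (ξ - z t) ∈ A := fun ξ ↦
      hA t ht (by simpa using norm_radialClip_le hε (ξ - z t))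
    have hbdd : ∀ ξ ∈ A, Bornology.IsBounded (F t ξ) := fun ξ hξ ↦
      isBounded_iff_forall_norm_le.2 ⟨α t, hb ξ hξ⟩
    have h1 := Metric.infDist_le_infDist_add_hausdorffDist (x := u)
      (Metric.hausdorffEDist_ne_top_of_nonempty_of_bounded
        (hFne t ht (z t + radialClip ε (ξ' - z t))) (hFne t ht (z t + radialClip ε (ξ - z t)))
        (hbdd _ (hmem ξ')) (hbdd _ (hmem ξ)))
    have h2 := hl _ (hmem ξ') _ (hmem ξ)
    have h3 : ‖z t + radialClip ε (ξ' - z t) - (z t + radialClip ε (ξ - z t))‖ ≤ 2 * ‖ξ - ξ'‖ := by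
      rw [add_sub_add_left_eq_sub, norm_sub_rev ξ]
      simpa using norm_radialClip_sub_le hε (ξ' - z t) (ξ - z t)
    have h4 := mul_le_mul (le_abs_self (k₀ t)) h3 (norm_nonneg _) (abs_nonneg _)
    have h5 : 0 ≤ (|α t| + 1) * ‖ξ - ξ'‖ := by positivity
    linarith
  aemeasurable x hx u := aemeasurable_infDist_comp_of_measurableSet_prod hFne hF
    (hz.add ((continuous_radialClip hε).comp_continuousOn (hx.sub hz))) u

end Auxiliary

open MeasureTheory Set

/-- **Continuous selections of finite-time approximations** (Lemma 2.4 of the paper).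
`X` is a separable Banach space.  `z` is a solution on `[0,T]` of the relaxed initial
value problem `ż ∈ clco F(t,z)`, `z(0) = ξ₀`, `ε > 0` and `Tube` is the `ε`-tube around
the image of `z`.  Under (H1) measurability of `F` w.r.t. the product of the Lebesgue
σ-algebra (null-measurable sets for `volume`) on `[0,T]` with the Borel σ-algebra of
`X`, (H2) a Lipschitz estimate in Hausdorff distance on `B(Tube,1)` with integrable
modulus `k₀`, and (H3) an integrable bound `α` on `B(Tube,1)`, there exist `δ > 0` and
a map `x : [0,T] × B(ξ₀,δ) → X` such that:
(a) for each `η ∈ B(ξ₀,δ)`, `t ↦ x t η` is a solution of `ẋ ∈ F(t,x)`, `x(0) = η`,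
    on `[0,T]` (absolutely continuous, with a.e. derivative `v η` integrable on `[0,T]`);
(b) `η ↦ x (·) η` is continuous into `AC([0,T],X)`, i.e. continuous for the norm
    `‖u‖ = ‖u 0‖ + ∫₀ᵀ ‖u̇‖`;
(c) `‖z t - x t η‖ < ε` for all `t ∈ [0,T]` and all `η ∈ B(ξ₀,δ)`. -/
theorem finite_time_relaxation_continuous_selection
    {X : Type*} [NormedAddCommGroup X] [NormedSpace ℝ X] [CompleteSpace X]
    [MeasurableSpace X] [BorelSpace X] [TopologicalSpace.SeparableSpace X]
    (T : ℝ) (hT : 0 < T) (ξ₀ : X)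
    (F : ℝ → X → Set X)
    (hFne : ∀ t ∈ Icc (0:ℝ) T, ∀ ξ : X, (F t ξ).Nonempty)
    (hFcl : ∀ t ∈ Icc (0:ℝ) T, ∀ ξ : X, IsClosed (F t ξ))
    -- `z` is a solution of the relaxed initial value problem on `[0,T]`
    (z : ℝ → X) (hz0 : z 0 = ξ₀)
    (hz : ∃ vz : ℝ → X, IntegrableOn vz (Icc (0:ℝ) T) ∧
      (∀ t ∈ Icc (0:ℝ) T, z t = ξ₀ + ∫ s in (0:ℝ)..t, vz s) ∧
      (∀ᵐ t ∂(volume.restrict (Icc (0:ℝ) T)), vz t ∈ closure (convexHull ℝ (F t (z t)))))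
    (ε : ℝ) (hε : 0 < ε)
    -- the ε-tube around the image of `z`
    (Tube : Set X) (hTube : Tube = {ξ : X | ∃ t ∈ Icc (0:ℝ) T, ‖ξ - z t‖ ≤ ε})
    -- (H1): measurability w.r.t. Lebesgue ⊗ Borel
    (H1 : ∀ U : Set X, IsOpen U →
      MeasurableSet[MeasurableSpace.prod
          (inferInstanceAs (MeasurableSpace (NullMeasurableSpace ℝ volume)))
          (inferInstance : MeasurableSpace X)]
        {p : ℝ × X | p.1 ∈ Icc (0:ℝ) T ∧ (F p.1 p.2 ∩ U).Nonempty})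
    -- (H2): Lipschitz estimate on `B(Tube, 1) = {ξ | d(ξ, Tube) ≤ 1}`
    (H2 : ∃ k₀ : ℝ → ℝ, IntegrableOn k₀ (Icc (0:ℝ) T) ∧
      (∀ᵐ t ∂(volume.restrict (Icc (0:ℝ) T)),
        ∀ ξ : X, Metric.infDist ξ Tube ≤ 1 → ∀ η : X, Metric.infDist η Tube ≤ 1 →
          Metric.hausdorffDist (F t ξ) (F t η) ≤ k₀ t * ‖ξ - η‖))
    -- (H3): integrable bound on `B(Tube, 1)`
    (H3 : ∃ α : ℝ → ℝ, IntegrableOn α (Icc (0:ℝ) T) ∧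
      (∀ᵐ t ∂(volume.restrict (Icc (0:ℝ) T)),
        ∀ ξ : X, Metric.infDist ξ Tube ≤ 1 → ∀ ζ ∈ F t ξ, ‖ζ‖ ≤ α t)) :
    ∃ δ : ℝ, 0 < δ ∧ ∃ (x : ℝ → X → X) (v : X → ℝ → X),
      -- (a) for each `η` in `V = B(ξ₀, δ)`, `t ↦ x t η` solves `ẋ ∈ F(t,x)`, `x 0 = η`
      (∀ η ∈ Metric.closedBall ξ₀ δ,
        x 0 η = η ∧
        IntegrableOn (v η) (Icc (0:ℝ) T) ∧
        (∀ t ∈ Icc (0:ℝ) T, x t η = η + ∫ s in (0:ℝ)..t, v η s) ∧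
        (∀ᵐ t ∂(volume.restrict (Icc (0:ℝ) T)), v η t ∈ F t (x t η))) ∧
      -- (b) continuity of `η ↦ x (·) η` from `V` into `AC([0,T], X)`
      (∀ η ∈ Metric.closedBall ξ₀ δ, ∀ ε' : ℝ, 0 < ε' → ∃ δ' : ℝ, 0 < δ' ∧
        ∀ η' ∈ Metric.closedBall ξ₀ δ, ‖η' - η‖ < δ' →
          ‖x 0 η' - x 0 η‖ + ∫ t in Icc (0:ℝ) T, ‖v η' t - v η t‖ < ε') ∧
      -- (c) the approximation stays within `ε` of `z`
      (∀ η ∈ Metric.closedBall ξ₀ δ, ∀ t ∈ Icc (0:ℝ) T, ‖z t - x t η‖ < ε) := by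
  obtain ⟨vz, hvz, hzv, hvzF⟩ := hz
  obtain ⟨k₀, hk₀, hlip⟩ := H2
  obtain ⟨α, hα, hbd⟩ := H3
  have hzc : ∀ t ∈ Icc (0 : ℝ) T, z t = curve ξ₀ vz t := hzv
  have hzcont : ContinuousOn z (Icc 0 T) := (continuousOn_curve hT.le hvz).congr hzc
  have hG := isLipschitzInclusion_radialClip hFne hFcl H1 hzcont hε
    (A := {ξ | Metric.infDist ξ Tube ≤ 1}) (fun t ht ξ hξ ↦ by
      have hξT : ξ ∈ Tube := hTube ▸ ⟨t, ht, mem_closedBall_iff_norm.1 hξ⟩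
      rw [mem_ofPred_eq, Metric.infDist_zero_of_mem hξT]
      exact zero_le_one) hk₀ hα hlip hbd
  obtain ⟨δ, hδ, f, hf, hfG, hfz⟩ := hG.exists_continuous_selection_near hT (ξ₀ := ξ₀) hvz (by
    filter_upwards [hvzF, ae_restrict_mem measurableSet_Icc] with t h1 ht
    rwa [← hzc t ht, sub_self, radialClip_of_norm_le hε (by simpa using hε.le), add_zero]) hε
  classical
  let v : X → ℝ → X := fun η ↦ if h : η ∈ Metric.closedBall ξ₀ δ then f ⟨η, h⟩ else 0
  have hv : ∀ η (h : η ∈ Metric.closedBall ξ₀ δ), v η = f ⟨η, h⟩ := fun η h ↦ dif_pos h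
  have hclose : ∀ η ∈ Metric.closedBall ξ₀ δ, ∀ t ∈ Icc (0 : ℝ) T,
      ‖z t - curve η (v η) t‖ < ε := by
    intro η hη t ht
    rw [hv η hη, hzc t ht]
    exact hfz ⟨η, hη⟩ t ht
  refine ⟨δ, hδ, fun t η ↦ curve η (v η) t, v, fun η hη ↦ ⟨by simp [curve], ?_, fun t _ ↦ rfl, ?_⟩,
    fun η hη ε' hε' ↦ ?_, hclose⟩
  · rw [hv η hη]
    exact L1.integrable_coeFn _
  · filter_upwards [hfG ⟨η, hη⟩, ae_restrict_mem measurableSet_Icc] with t h1 ht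
    have h2 := hclose η hη t ht
    rw [norm_sub_rev] at h2
    rw [← hv η hη] at h1
    rwa [radialClip_of_norm_le hε h2.le, add_sub_cancel] at h1
  · obtain ⟨ρ, hρ, hfρ⟩ := Metric.continuous_iff.1 hf ⟨η, hη⟩ (ε' / 2) (half_pos hε')
    refine ⟨min ρ (ε' / 2), lt_min hρ (half_pos hε'), fun η' hη' hd ↦ ?_⟩
    have h1 := hfρ ⟨η', hη'⟩ (by
      rw [Subtype.dist_eq, dist_eq_norm]
      exact hd.trans_le (min_le_left _ _))
    have h2 := dist_toL1_eq_integral_norm_sub (L1.integrable_coeFn (f ⟨η', hη'⟩))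
      (L1.integrable_coeFn (f ⟨η, hη⟩))
    rw [Integrable.toL1_coeFn, Integrable.toL1_coeFn] at h2
    rw [hv η hη, hv η' hη', ← h2]
    have h3 := hd.trans_le (min_le_right _ _)
    simp only [curve, intervalIntegral.integral_same, add_zero]
    linarith
end
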